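/- Let σ₀, σ₁, σ₂, β₀, β₁, β₂ ∈ ℝ satisfy: 0 ≤ β₀ < 1/2 < β₁, β₂ < 1; σ₀+σ₁+σ₂+β₀ > 3/2 − (β₀+σ₁+σ₂); σ₀+σ₁+σ₂ > 3/2 − (σ₀+β₁+σ₂); σ₀+σ₁+σ₂ > 3/2 − (σ₀+σ₁+β₂); σ₀+σ₁+σ₂+β₀ ≥ 1; min(σ₀+σ₁, σ₀+σ₂, β₀+σ₁+σ₂) ≥ 0; and the last two inequalities are not both equalities. Then for any choice of signs ±₁, ±₂ one has the null form estimate ‖B_{±₁,±₂}(u,v)‖_{H^{−σ₀,−β₀}} ≲ ‖u‖_{X^{σ₁,β₁}_{±₁}} ‖v‖_{X^{σ₂,β₂}_{±₂}} for all Schwartz functions u, v on ℝ^{1+3}. -/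

import Mathlib

noncomputable section

open MeasureTheory Complex
open scoped FourierTransform RealInnerProductSpace BigOperators

/-! ## Basic setup: space-time `ℝ^{1+3}` and Fourier analytic toolbox -/

/-- Space-time `ℝ^{1+3}` (used both for physical points `(t,x)` and
Fourier variables `(τ,ξ)`); coordinate `0` is time. -/
abbrev SpaceTime : Type := EuclideanSpace ℝ (Fin 4)

/-- Space `ℝ³`. -/
abbrev Space : Type := EuclideanSpace ℝ (Fin 3)

/-- The spatial part of a space-time point / frequency. -/
def spt (z : SpaceTime) : Space := (WithLp.equiv 2 (Fin 3 → ℝ)).symm fun i => z i.succ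

/-- The space-time point `(t, x)`. -/
def stpt (t : ℝ) (x : Space) : SpaceTime :=
  (WithLp.equiv 2 (Fin 4 → ℝ)).symm fun μ => Fin.cases t (fun i => x i) μ

/-- Japanese bracket `⟨x⟩ = (1+x²)^{1/2}`. -/
def jap (x : ℝ) : ℝ := Real.sqrt (1 + x ^ 2)

/-- The sign `±1` encoded by a boolean (`true ↦ +1`). -/
def sgnv (sg : Bool) : ℝ := if sg then 1 else -1

/-- Minkowski metric coefficient `η^{μμ}`, used to raise indices. -/
def mink (μ : Fin 4) : ℝ := if μ = 0 then -1 else 1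

section Ops

variable {E : Type*} [NormedAddCommGroup E] [NormedSpace ℂ E]

/-- Space-time Fourier transform. -/
def FT (u : SpaceTime → E) : SpaceTime → E := fun ζ => 𝓕 u ζ

/-- Inverse space-time Fourier transform. -/
def FTinv (u : SpaceTime → E) : SpaceTime → E := fun x => 𝓕⁻ u x

/-- Spatial Fourier transform. -/
def FT3 (u : Space → E) : Space → E := fun ξ => 𝓕 u ξ

/-- Inverse spatial Fourier transform. -/
def FT3inv (u : Space → E) : Space → E := fun x => 𝓕⁻ u x

/-- Weighted `L²`-norm (on the Fourier side). -/
def wnorm (w : SpaceTime → ℝ) (f : SpaceTime → E) : ℝ := (∫ ζ, (w ζ * ‖f ζ‖) ^ 2) ^ ((1:ℝ)/2)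

/-- Finiteness of the weighted `L²`-norm. -/
def wfin (w : SpaceTime → ℝ) (f : SpaceTime → E) : Prop :=
  MeasureTheory.HasFiniteIntegral (fun ζ => (w ζ * ‖f ζ‖) ^ 2) volume

/-- The weight of the wave-Sobolev space `H^{s,b}`. -/
def hWt (s b : ℝ) (ζ : SpaceTime) : ℝ := jap ‖spt ζ‖ ^ s * jap (|ζ 0| - ‖spt ζ‖) ^ b

/-- The weight of the space `X^{s,b}_±`. -/
def xWt (sg : Bool) (s b : ℝ) (ζ : SpaceTime) : ℝ :=
  jap ‖spt ζ‖ ^ s * jap (-(ζ 0) + sgnv sg * ‖spt ζ‖) ^ b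

/-- The norm of the wave-Sobolev space `H^{s,b}`:
`‖u‖ = ‖⟨ξ⟩^s ⟨|τ|-|ξ|⟩^b ũ(τ,ξ)‖_{L²}`. -/
def HsbNorm (s b : ℝ) (u : SpaceTime → E) : ℝ := wnorm (hWt s b) (FT u)

/-- Membership (finiteness of the norm) for `H^{s,b}`. -/
def HsbFin (s b : ℝ) (u : SpaceTime → E) : Prop := wfin (hWt s b) (FT u)

/-- The norm of `X^{s,b}_±` : `‖u‖ = ‖⟨ξ⟩^s ⟨-τ ± |ξ|⟩^b ũ(τ,ξ)‖_{L²}`. -/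
def XsbNorm (sg : Bool) (s b : ℝ) (u : SpaceTime → E) : ℝ := wnorm (xWt sg s b) (FT u)

/-- Membership (finiteness of the norm) for `X^{s,b}_±`. -/
def XsbFin (sg : Bool) (s b : ℝ) (u : SpaceTime → E) : Prop := wfin (xWt sg s b) (FT u)

/-- Fourier multiplier with (complex) symbol `m`. -/
def mult (m : SpaceTime → ℂ) (u : SpaceTime → E) : SpaceTime → E := FTinv fun ζ => m ζ • FT u ζ

/-- Fourier multiplier with real symbol `m`. -/
def rmult (m : SpaceTime → ℝ) (u : SpaceTime → E) : SpaceTime → E := mult (fun ζ => (m ζ : ℂ)) u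

/-- `Λ^α`, the multiplier with symbol `⟨ξ⟩^α`. -/
def Lam (α : ℝ) (u : SpaceTime → E) : SpaceTime → E := rmult (fun ζ => jap ‖spt ζ‖ ^ α) u

/-- `Λ₊^α`, the multiplier with symbol `⟨|τ|+|ξ|⟩^α`. -/
def LamPlus (α : ℝ) (u : SpaceTime → E) : SpaceTime → E := rmult (fun ζ => jap (|ζ 0| + ‖spt ζ‖) ^ α) u

/-- `Λ₋^α`, the multiplier with symbol `⟨|τ|-|ξ|⟩^α`. -/
def LamMinus (α : ℝ) (u : SpaceTime → E) : SpaceTime → E := rmult (fun ζ => jap (|ζ 0| - ‖spt ζ‖) ^ α) u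

/-- `D^α`, the multiplier with symbol `|ξ|^α`. -/
def Dop (α : ℝ) (u : SpaceTime → E) : SpaceTime → E := rmult (fun ζ => ‖spt ζ‖ ^ α) u

/-- `D₊^α`, the multiplier with symbol `(|τ|+|ξ|)^α`. -/
def DPlus (α : ℝ) (u : SpaceTime → E) : SpaceTime → E := rmult (fun ζ => (|ζ 0| + ‖spt ζ‖) ^ α) u

/-- `D₋^α`, the multiplier with symbol `||τ|-|ξ||^α`. -/
def DMinus (α : ℝ) (u : SpaceTime → E) : SpaceTime → E := rmult (fun ζ => |(|ζ 0| - ‖spt ζ‖)| ^ α) u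

/-- `|∇|`, the multiplier with symbol `|ξ|`. -/
def absNabla (u : SpaceTime → E) : SpaceTime → E := Dop 1 u

/-- The partial derivative `∂_μ` on space-time. -/
def pd (μ : Fin 4) (u : SpaceTime → E) : SpaceTime → E := fun x => fderiv ℝ u x (EuclideanSpace.single μ 1)

/-- The spatial partial derivative `∂_i` on `ℝ³`. -/
def pd3 (i : Fin 3) (u : Space → E) : Space → E := fun x => fderiv ℝ u x (EuclideanSpace.single i 1)

/-- The (inhomogeneous) Riesz transform `R_j = Λ^{-1} ∂_j`. -/
def Riesz (j : Fin 3) (u : SpaceTime → E) : SpaceTime → E := Lam (-1) (pd j.succ u)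

/-- The d'Alembertian `□ = ∂_t² - Δ`. -/
def box (u : SpaceTime → E) : SpaceTime → E :=
  fun x => pd 0 (pd 0 u) x - ∑ j : Fin 3, pd j.succ (pd j.succ u) x

/-- The `F^s` norm, `‖u‖_{F^s} = ‖Λ₊ u‖_{H^{s-1,3/4+ε}}`. -/
def FsNorm (ε s : ℝ) (u : SpaceTime → E) : ℝ := HsbNorm (s - 1) (3/4 + ε) (LamPlus 1 u)

/-- Membership in `F^s`. -/
def FsFin (ε s : ℝ) (u : SpaceTime → E) : Prop := HsbFin (s - 1) (3/4 + ε) (LamPlus 1 u)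

/-- The `G^r` norm, `‖v‖_{G^r} = ‖Λ₊ v‖_{H^{r-1,1/2+ε}}`. -/
def GrNorm (ε r : ℝ) (v : SpaceTime → E) : ℝ := HsbNorm (r - 1) (1/2 + ε) (LamPlus 1 v)

/-- Membership in `G^r`. -/
def GrFin (ε r : ℝ) (v : SpaceTime → E) : Prop := HsbFin (r - 1) (1/2 + ε) (LamPlus 1 v)

/-- The time slab `[0,T] × ℝ³`. -/
def slab (T : ℝ) : Set SpaceTime := {x | x 0 ∈ Set.Icc 0 T}

/-- `u` belongs to the restriction to `[0,T]` of the space with defining predicate `P`: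
it has an extension lying in that space. -/
def MemRestrict (P : (SpaceTime → E) → Prop) (T : ℝ) (u : SpaceTime → E) : Prop :=
  ∃ U : SpaceTime → E, P U ∧ Set.EqOn U u (slab T)

/-- The spatial Sobolev `H^s(ℝ³)` norm. -/
def HNorm (s : ℝ) (f : Space → E) : ℝ :=
  (∫ ξ, (jap ‖ξ‖ ^ s * ‖FT3 f ξ‖) ^ 2) ^ ((1:ℝ)/2)

/-- Membership in the spatial Sobolev space `H^s(ℝ³)`. -/
def MemHs (s : ℝ) (f : Space → E) : Prop :=
  MeasureTheory.HasFiniteIntegral (fun ξ => (jap ‖ξ‖ ^ s * ‖FT3 f ξ‖) ^ 2) volume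

/-- Continuity with values in `H^s` on the time interval `[0,T]` (for a space-time function). -/
def ContHsOn (s T : ℝ) (u : SpaceTime → E) : Prop :=
  (∀ t ∈ Set.Icc (0:ℝ) T, MemHs s fun ξ => u (stpt t ξ)) ∧
  ∀ t ∈ Set.Icc (0:ℝ) T,
    Filter.Tendsto (fun t' => HNorm s fun ξ => u (stpt t' ξ) - u (stpt t ξ))
      (nhdsWithin t (Set.Icc 0 T)) (nhds 0)

end Ops

/-- The angle weight `|∠(±₁ξ₁, ±₂ξ₂)|`. -/
def angleWt (sg1 sg2 : Bool) (η θ : SpaceTime) : ℝ :=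
  |InnerProductGeometry.angle (sgnv sg1 • spt η) (sgnv sg2 • spt θ)|

/-- The bilinear null-form operator `B_{±₁,±₂}`, defined by its space-time Fourier transform
`𝓕(B(u,v))(ζ) = ∫ |∠(±₁ξ₁, ±₂ξ₂)| ũ(ζ₁) ṽ(ζ-ζ₁) dζ₁`. -/
def Bop (sg1 sg2 : Bool) (u v : SpaceTime → ℂ) : SpaceTime → ℂ :=
  FTinv fun ζ => ∫ η, (angleWt sg1 sg2 η (ζ - η) : ℂ) * FT u η * FT v (ζ - η)

/-! ## Null forms -/

/-- The null form `Q₀(u,v) = ∂_α u ∂^α v`. -/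
def Q0f (u v : SpaceTime → ℂ) : SpaceTime → ℂ := fun x => ∑ μ : Fin 4, mink μ • (pd μ u x * pd μ v x)

/-- The null form `Q_{αβ}(u,v) = ∂_α u ∂_β v - ∂_β u ∂_α v`. -/
def Qf (α β : Fin 4) (u v : SpaceTime → ℂ) : SpaceTime → ℂ :=
  fun x => pd α u x * pd β v x - pd β u x * pd α v x

/-! ## Matrix-valued (Lie algebra) objects -/

/-- `n×n` complex matrices, the ambient space of `su(n,ℂ)`. -/
abbrev G (n : ℕ) : Type := Matrix (Fin n) (Fin n) ℂ

attribute [local instance] Matrix.frobeniusNormedAddCommGroup Matrix.frobeniusNormedSpace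

/-- Membership in the Lie algebra `su(n,ℂ)` (trace-free skew-hermitian matrices). -/
def IsSu {n : ℕ} (X : G n) : Prop := X.conjTranspose = -X ∧ X.trace = 0

/-- The matrix commutator `[X,Y] = XY - YX`. -/
def mcomm {n : ℕ} (X Y : G n) : G n := X * Y - Y * X

/-- The commutator null form `Q_{αβ}[u,v] = [∂_α u, ∂_β v] - [∂_β u, ∂_α v]`. -/
def Qc {n : ℕ} (α β : Fin 4) (u v : SpaceTime → G n) : SpaceTime → G n :=
  fun x => mcomm (pd α u x) (pd β v x) - mcomm (pd β u x) (pd α v x)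

/-- The commutator null form `Q₀[u,v] = [∂_α u, ∂^α v]`. -/
def Q0c {n : ℕ} (u v : SpaceTime → G n) : SpaceTime → G n :=
  fun x => ∑ μ : Fin 4, mink μ • mcomm (pd μ u x) (pd μ v x)

/-! ## Dirac operators -/

/-- The spinor space `ℂ⁴`. -/
abbrev C4 : Type := EuclideanSpace ℂ (Fin 4)

/-- A `4×4` matrix acting on `ℂ⁴`. -/
def matAct (M : Matrix (Fin 4) (Fin 4) ℂ) (v : C4) : C4 :=
  (WithLp.equiv 2 (Fin 4 → ℂ)).symm (M.mulVec ((WithLp.equiv 2 (Fin 4 → ℂ)) v))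

/-- The Dirac matrices `α^0 = I`, `α^j = ((0,σ^j),(σ^j,0))`. -/
def alphaMat : Fin 4 → Matrix (Fin 4) (Fin 4) ℂ
  | 0 => 1
  | 1 => !![0,0,0,1; 0,0,1,0; 0,1,0,0; 1,0,0,0]
  | 2 => !![0,0,0,-I; 0,0,I,0; 0,-I,0,0; I,0,0,0]
  | 3 => !![0,0,1,0; 0,0,0,-1; 1,0,0,0; 0,-1,0,0]

/-- Matrix-symbol Fourier multiplier on spinor fields (space-time). -/
def multM (m : SpaceTime → Matrix (Fin 4) (Fin 4) ℂ) (u : SpaceTime → C4) : SpaceTime → C4 :=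
  FTinv fun ζ => matAct (m ζ) (FT u ζ)

/-- Matrix-symbol Fourier multiplier on spinor fields (space). -/
def multM3 (m : Space → Matrix (Fin 4) (Fin 4) ℂ) (u : Space → C4) : Space → C4 :=
  FT3inv fun ξ => matAct (m ξ) (FT3 u ξ)

/-- The symbol `Π(±ξ) = ½(I ± ξ_j α^j / |ξ|)` of the Dirac projections. -/
def PiSymb (sg : Bool) (ξ : Space) : Matrix (Fin 4) (Fin 4) ℂ :=
  (2⁻¹ : ℂ) • (1 + ∑ j : Fin 3, ((sgnv sg * ξ j / ‖ξ‖ : ℝ) : ℂ) • alphaMat j.succ)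

/-- The Dirac projection `Π_± = Π_±(∇/i)` (space-time version). -/
def PiProj (sg : Bool) (u : SpaceTime → C4) : SpaceTime → C4 := multM (fun ζ => PiSymb sg (spt ζ)) u

/-- The Dirac projection `Π_± = Π_±(∇/i)` acting on functions of the space variable. -/
def PiProj3 (sg : Bool) (u : Space → C4) : Space → C4 := multM3 (fun ξ => PiSymb sg ξ) u

open scoped ENNReal

/-! ## Trilinear integral forms on a group -/

lemma lintegral_mul_sq_le {α : Type*} [MeasurableSpace α] (μ : Measure α) {f g : α → ℝ≥0∞}
    (hf : AEMeasurable f μ) (hg : AEMeasurable g μ) :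
    (∫⁻ x, f x * g x ∂μ) ^ 2 ≤ (∫⁻ x, f x ^ 2 ∂μ) * ∫⁻ x, g x ^ 2 ∂μ := by
  have h := ENNReal.lintegral_mul_le_Lp_mul_Lq μ Real.HolderConjugate.two_two hf hg
  have h2 : ∀ x : ℝ≥0∞, (x ^ ((1:ℝ) / 2)) ^ 2 = x := fun x => by
    rw [← ENNReal.rpow_natCast, ← ENNReal.rpow_mul]; norm_num
  calc (∫⁻ x, f x * g x ∂μ) ^ 2 ≤ _ := pow_le_pow_left' h 2
    _ = _ := by
      rw [mul_pow, h2, h2]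
      simp

lemma ennreal_two_mul_le (x y : ℝ≥0∞) : 2 * (x * y) ≤ x ^ 2 + y ^ 2 := by
  rcases eq_or_ne x ⊤ with rfl | hx
  · simp
  rcases eq_or_ne y ⊤ with rfl | hy
  · simp
  lift x to NNReal using hx
  lift y to NNReal using hy
  norm_cast
  have := two_mul_le_add_sq x y
  linarith

lemma tsum_sq_le_of_sq_le {c : ℝ≥0∞} {T a b : ℕ → ℝ≥0∞} (h : ∀ n, T n ^ 2 ≤ c * (a n * b n)) :
    (∑' n, T n) ^ 2 ≤ c * ((∑' n, a n) * ∑' n, b n) := by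
  have h2 : ∀ x : ℝ≥0∞, (x ^ ((1:ℝ) / 2)) ^ 2 = x := fun x => by
    rw [← ENNReal.rpow_natCast, ← ENNReal.rpow_mul]; norm_num
  have h3 : ∀ n, T n ≤ (c * a n) ^ ((1:ℝ)/2) * (b n) ^ ((1:ℝ)/2) := fun n => by
    rw [← ENNReal.mul_rpow_of_nonneg _ _ (by norm_num)]
    have := ENNReal.rpow_le_rpow (h n) (z := (1:ℝ)/2) (by norm_num)
    rw [← ENNReal.rpow_natCast, ← ENNReal.rpow_mul] at this
    norm_num at this
    rw [mul_assoc]; norm_num; exact this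
  calc (∑' n, T n) ^ 2 ≤ (∑' n, (c * a n) ^ ((1:ℝ)/2) * (b n) ^ ((1:ℝ)/2)) ^ 2 :=
        pow_le_pow_left' (ENNReal.tsum_le_tsum h3) 2
    _ = (∫⁻ n, (c * a n) ^ ((1:ℝ)/2) * (b n) ^ ((1:ℝ)/2) ∂Measure.count) ^ 2 := by
        rw [lintegral_count]
    _ ≤ _ := lintegral_mul_sq_le _ (measurable_of_countable _).aemeasurable
        (measurable_of_countable _).aemeasurable
    _ = _ := by
        simp only [h2, lintegral_count, ENNReal.tsum_mul_left]
        ring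

/-- Frequency space `ℝ × ℝ³`, with coordinates `(τ, ξ)`. -/
abbrev Ph : Type := ℝ × Space

instance : (volume : Measure Ph).IsAddHaarMeasure :=
  inferInstanceAs ((volume : Measure ℝ).prod (volume : Measure Space)).IsAddHaarMeasure

/-- `∫ f²`. -/
def sqInt (f : Ph → ℝ≥0∞) : ℝ≥0∞ := ∫⁻ x, f x ^ 2

/-- The trilinear form with kernel `K`. -/
def triForm (K : Ph → Ph → ℝ≥0∞) (f₀ f₁ f₂ : Ph → ℝ≥0∞) : ℝ≥0∞ :=
  ∫⁻ a, ∫⁻ b, K a b * (f₁ a * f₂ b * f₀ (a + b))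

/-- The trilinear form with kernel `K` is bounded on `L² × L² × L²`, with constant `C^{1/2}`. -/
def TriBdd (K : Ph → Ph → ℝ≥0∞) (C : ℝ≥0∞) : Prop :=
  ∀ f₀ f₁ f₂ : Ph → ℝ≥0∞, Measurable f₀ → Measurable f₁ → Measurable f₂ →
    triForm K f₀ f₁ f₂ ^ 2 ≤ C * (sqInt f₀ * sqInt f₁ * sqInt f₂)

lemma TriBdd.mono {K K' : Ph → Ph → ℝ≥0∞} {C C' : ℝ≥0∞} (h : TriBdd K C)
    (hK : ∀ a b, K' a b ≤ K a b) (hC : C ≤ C') : TriBdd K' C' := by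
  intro f₀ f₁ f₂ h0 h1 h2
  calc triForm K' f₀ f₁ f₂ ^ 2 ≤ triForm K f₀ f₁ f₂ ^ 2 := by
        refine pow_le_pow_left' ?_ 2
        exact lintegral_mono fun a => lintegral_mono fun b => by gcongr; exact hK a b
    _ ≤ _ := h f₀ f₁ f₂ h0 h1 h2
    _ ≤ _ := by gcongr

lemma triForm_eq_sum {K : Ph → Ph → ℝ≥0∞} (hK : Measurable (Function.uncurry K))
    {f₀ f₁ f₂ : Ph → ℝ≥0∞} (h0 : Measurable f₀) (h1 : Measurable f₁) (h2 : Measurable f₂) :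
    triForm K f₀ f₁ f₂ = ∫⁻ c, ∫⁻ a, K a (c - a) * (f₁ a * f₂ (c - a) * f₀ c) := by
  rw [lintegral_lintegral_swap]
  · refine lintegral_congr fun a => ?_
    rw [← lintegral_add_left_eq_self (fun c => K a (c - a) * (f₁ a * f₂ (c - a) * f₀ c)) a]
    simp
  · refine Measurable.aemeasurable ?_
    have e : (Function.uncurry fun (c a : Ph) => K a (c - a) * (f₁ a * f₂ (c - a) * f₀ c))
        = fun p : Ph × Ph => Function.uncurry K (p.2, p.1 - p.2) *
          (f₁ p.2 * f₂ (p.1 - p.2) * f₀ p.1) := rfl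
    rw [e]
    fun_prop

lemma triForm_swap {K : Ph → Ph → ℝ≥0∞} (hK : Measurable (Function.uncurry K))
    {f₀ f₁ f₂ : Ph → ℝ≥0∞} (h0 : Measurable f₀) (h1 : Measurable f₁) (h2 : Measurable f₂) :
    triForm (fun a b => K b a) f₀ f₂ f₁ = triForm K f₀ f₁ f₂ := by
  unfold triForm
  rw [lintegral_lintegral_swap]
  · refine lintegral_congr fun a => lintegral_congr fun b => ?_
    rw [add_comm b a]; ring
  · refine Measurable.aemeasurable ?_
    have e : (Function.uncurry fun (a b : Ph) => K b a * (f₂ a * f₁ b * f₀ (a + b)))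
        = fun p : Ph × Ph => Function.uncurry K (p.2, p.1) *
          (f₂ p.1 * f₁ p.2 * f₀ (p.1 + p.2)) := rfl
    rw [e]
    fun_prop

lemma TriBdd.swap {K : Ph → Ph → ℝ≥0∞} (hK : Measurable (Function.uncurry K)) {C : ℝ≥0∞}
    (h : TriBdd (fun a b => K b a) C) : TriBdd K C := by
  intro f₀ f₁ f₂ h0 h1 h2
  rw [← triForm_swap hK h0 h1 h2]
  refine (h f₀ f₂ f₁ h0 h2 h1).trans (le_of_eq ?_)
  ring

/-- Cauchy–Schwarz in `a`, for fixed `a + b`. -/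
lemma TriBdd.of_sum {K : Ph → Ph → ℝ≥0∞} (hK : Measurable (Function.uncurry K)) {M : ℝ≥0∞}
    (h : ∀ c, ∫⁻ a, K a (c - a) ^ 2 ≤ M) : TriBdd K M := by
  intro f₀ f₁ f₂ h0 h1 h2
  have hKm : Measurable fun p : Ph × Ph => K p.2 (p.1 - p.2) := by
    have : (fun p : Ph × Ph => K p.2 (p.1 - p.2))
      = fun p => Function.uncurry K (p.2, p.1 - p.2) := rfl
    rw [this]; fun_prop
  have hKc : ∀ c, Measurable fun a : Ph => K a (c - a) := fun c =>
    hKm.comp (measurable_prodMk_left (x := c))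
  set G : Ph → ℝ≥0∞ := fun c => ∫⁻ a, K a (c - a) * (f₁ a * f₂ (c - a)) with hG
  have hGm : Measurable G := Measurable.lintegral_prod_right' (f := fun p : Ph × Ph =>
    K p.2 (p.1 - p.2) * (f₁ p.2 * f₂ (p.1 - p.2))) (by fun_prop)
  have e : triForm K f₀ f₁ f₂ = ∫⁻ c, f₀ c * G c := by
    rw [triForm_eq_sum hK h0 h1 h2]
    refine lintegral_congr fun c => ?_
    have := hKc c
    rw [← lintegral_const_mul _ (by fun_prop)]
    refine lintegral_congr fun a => ?_
    ring
  rw [e]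
  refine (lintegral_mul_sq_le _ h0.aemeasurable hGm.aemeasurable).trans ?_
  have hG2 : ∀ c, G c ^ 2 ≤ M * ∫⁻ a, (f₁ a * f₂ (c - a)) ^ 2 := fun c => by
    refine (lintegral_mul_sq_le _ (hKc c).aemeasurable (by fun_prop)).trans ?_
    gcongr
    exact h c
  have hfin : ∫⁻ c, ∫⁻ a, (f₁ a * f₂ (c - a)) ^ 2 = sqInt f₁ * sqInt f₂ := by
    rw [lintegral_lintegral_swap (by fun_prop)]
    simp only [mul_pow]
    have : ∀ a, ∫⁻ c, f₁ a ^ 2 * f₂ (c - a) ^ 2 = f₁ a ^ 2 * sqInt f₂ := fun a => by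
      rw [lintegral_const_mul _ (by fun_prop),
        lintegral_sub_right_eq_self (fun c => f₂ c ^ 2) a]; rfl
    simp only [this]
    rw [lintegral_mul_const _ (by fun_prop)]; rfl
  calc (∫⁻ c, f₀ c ^ 2) * ∫⁻ c, G c ^ 2
      ≤ sqInt f₀ * ∫⁻ c, M * ∫⁻ a, (f₁ a * f₂ (c - a)) ^ 2 := by
        gcongr with c
        · exact le_rfl
        · exact hG2 c
    _ = sqInt f₀ * (M * (sqInt f₁ * sqInt f₂)) := by
        rw [lintegral_const_mul, hfin]
        exact Measurable.lintegral_prod_right' (f := fun p : Ph × Ph =>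
          (f₁ p.2 * f₂ (p.1 - p.2)) ^ 2) (by fun_prop)
    _ = _ := by ring

/-- Cauchy–Schwarz in `b`, for fixed `a`. -/
lemma TriBdd.of_left {K : Ph → Ph → ℝ≥0∞} (hK : Measurable (Function.uncurry K)) {M : ℝ≥0∞}
    (h : ∀ a, ∫⁻ b, K a b ^ 2 ≤ M) : TriBdd K M := by
  intro f₀ f₁ f₂ h0 h1 h2
  have hKc : ∀ a, Measurable fun b : Ph => K a b := fun a =>
    hK.comp (measurable_prodMk_left (x := a))
  have hK' : Measurable fun p : Ph × Ph => K p.1 p.2 := hK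
  set G : Ph → ℝ≥0∞ := fun a => ∫⁻ b, K a b * (f₂ b * f₀ (a + b)) with hG
  have hGm : Measurable G := Measurable.lintegral_prod_right' (f := fun p : Ph × Ph =>
    K p.1 p.2 * (f₂ p.2 * f₀ (p.1 + p.2))) (by fun_prop)
  have e : triForm K f₀ f₁ f₂ = ∫⁻ c, f₁ c * G c := by
    refine lintegral_congr fun c => ?_
    have := hKc c
    rw [← lintegral_const_mul _ (by fun_prop)]
    refine lintegral_congr fun a => ?_
    ring
  rw [e]
  refine (lintegral_mul_sq_le _ h1.aemeasurable hGm.aemeasurable).trans ?_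
  have hG2 : ∀ a, G a ^ 2 ≤ M * ∫⁻ b, (f₂ b * f₀ (a + b)) ^ 2 := fun c => by
    refine (lintegral_mul_sq_le _ (hKc c).aemeasurable (by fun_prop)).trans ?_
    gcongr
    exact h c
  have hfin : ∫⁻ a, ∫⁻ b, (f₂ b * f₀ (a + b)) ^ 2 = sqInt f₂ * sqInt f₀ := by
    rw [lintegral_lintegral_swap (by fun_prop)]
    simp only [mul_pow]
    have : ∀ b, ∫⁻ a, f₂ b ^ 2 * f₀ (a + b) ^ 2 = f₂ b ^ 2 * sqInt f₀ := fun a => by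
      rw [lintegral_const_mul _ (by fun_prop),
        lintegral_add_right_eq_self (fun c => f₀ c ^ 2) a]; rfl
    simp only [this]
    rw [lintegral_mul_const _ (by fun_prop)]; rfl
  calc (∫⁻ c, f₁ c ^ 2) * ∫⁻ c, G c ^ 2
      ≤ sqInt f₁ * ∫⁻ a, M * ∫⁻ b, (f₂ b * f₀ (a + b)) ^ 2 := by
        gcongr with c
        · exact le_rfl
        · exact hG2 c
    _ = sqInt f₁ * (M * (sqInt f₂ * sqInt f₀)) := by
        rw [lintegral_const_mul, hfin]
        exact Measurable.lintegral_prod_right' (f := fun p : Ph × Ph =>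
          (f₂ p.2 * f₀ (p.1 + p.2)) ^ 2) (by fun_prop)
    _ = _ := by ring

/-- The `TT*` bound: expand the square of the inner integral. -/
lemma ttStar_bound {K S : Ph → Ph → ℝ≥0∞} (hK : Measurable (Function.uncurry K))
    (hS : Measurable (Function.uncurry S)) (hKS : ∀ o j, K o j ≤ K o j * S o j)
    {ψ φ : Ph → Ph → Ph} (hψ : Measurable (Function.uncurry ψ))
    (hφ : Measurable (Function.uncurry φ))
    (hmp : ∀ o, MeasurePreserving (ψ o)) (hinv : ∀ o j, φ o (ψ o j) = j)
    {f h g : Ph → ℝ≥0∞} (hf : Measurable f) (hh : Measurable h) (hg : Measurable g) {M : ℝ≥0∞}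
    (hM : ∀ j k, ∫⁻ o, K o j ^ 2 * S o (φ o k) ^ 2 ≤ M) :
    (∫⁻ o, ∫⁻ j, K o j * (f o * h j * g (ψ o j))) ^ 2 ≤
      M * (sqInt f * sqInt h * sqInt g) := by
  have hK' : Measurable fun p : Ph × Ph => K p.1 p.2 := hK
  have hS' : Measurable fun p : Ph × Ph => S p.1 p.2 := hS
  have hψ' : Measurable fun p : Ph × Ph => ψ p.1 p.2 := hψ
  have hφ' : Measurable fun p : Ph × Ph => φ p.1 p.2 := hφ
  have hKc : ∀ a, Measurable fun b : Ph => K a b := fun a =>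
    hK.comp (measurable_prodMk_left (x := a))
  have hSc : ∀ a, Measurable fun b : Ph => S a b := fun a =>
    hS.comp (measurable_prodMk_left (x := a))
  have hφc : ∀ a, Measurable fun b : Ph => φ a b := fun a =>
    hφ.comp (measurable_prodMk_left (x := a))
  have hψc : ∀ a, Measurable fun b : Ph => ψ a b := fun a => (hmp a).measurable
  set F : Ph → Ph → ℝ≥0∞ := fun o j => K o j * S o j * (h j * g (ψ o j)) with hF
  have hFm : Measurable fun p : Ph × Ph => F p.1 p.2 := by simp only [hF]; fun_prop
  have hFc : ∀ a, Measurable fun b : Ph => F a b := fun a =>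
    hFm.comp (measurable_prodMk_left (x := a))
  have hFi : Measurable fun o => ∫⁻ j, F o j := Measurable.lintegral_prod_right' hFm
  have s1 : (∫⁻ o, ∫⁻ j, K o j * (f o * h j * g (ψ o j))) ≤ ∫⁻ o, f o * ∫⁻ j, F o j := by
    refine lintegral_mono fun o => ?_
    have := hFc o
    rw [← lintegral_const_mul _ (by fun_prop)]
    refine lintegral_mono fun j => ?_
    calc K o j * (f o * h j * g (ψ o j)) ≤ (K o j * S o j) * (f o * h j * g (ψ o j)) := by
          gcongr; exact hKS o j
      _ = _ := by simp only [hF]; ring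
  set Q : Ph → Ph → Ph → ℝ≥0∞ := fun o j j' =>
    (K o j * S o j' * (h j * g (ψ o j'))) ^ 2 with hQ
  have hQm : Measurable fun p : Ph × Ph × Ph => Q p.1 p.2.1 p.2.2 := by
    simp only [hQ]; fun_prop
  have s2 : ∀ o, 2 * (∫⁻ j, F o j) ^ 2 ≤ 2 * ∫⁻ j, ∫⁻ j', Q o j j' := fun o => by
    have e0 := hFc o
    have hQo : Measurable fun p : Ph × Ph => Q o p.1 p.2 :=
      hQm.comp (measurable_prodMk_left (x := o))
    have hQo' : Measurable fun p : Ph × Ph => Q o p.2 p.1 := hQo.comp measurable_swap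
    have e1 : (∫⁻ j, F o j) ^ 2 = ∫⁻ j, ∫⁻ j', F o j * F o j' := by
      have : ∀ j, ∫⁻ j', F o j * F o j' = F o j * ∫⁻ j', F o j' := fun j =>
        lintegral_const_mul _ e0
      simp only [this]
      rw [lintegral_mul_const _ e0, sq]
    rw [e1, two_mul (∫⁻ j, ∫⁻ j', Q o j j')]
    conv_rhs => 
      arg 2
      rw [lintegral_lintegral_swap hQo.aemeasurable]
    rw [← lintegral_add_left (Measurable.lintegral_prod_right' hQo)]
    rw [← lintegral_const_mul _ (Measurable.lintegral_prod_right'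
      (f := fun p : Ph × Ph => F o p.1 * F o p.2) (by fun_prop))]
    refine lintegral_mono fun j => ?_
    have hQj : Measurable fun y => Q o j y := hQo.comp (measurable_prodMk_left (x := j))
    rw [← lintegral_add_left hQj, ← lintegral_const_mul _ (by fun_prop)]
    refine lintegral_mono fun j' => ?_
    refine le_trans (le_of_eq ?_) (ennreal_two_mul_le _ _)
    simp only [hF]; ring
  have s3 : ∀ o, (∫⁻ j, F o j) ^ 2 ≤ ∫⁻ j, ∫⁻ j', Q o j j' := fun o =>
    (ENNReal.mul_le_mul_iff_right (by norm_num) (by norm_num)).1 (s2 o)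
  have s4 : ∀ o j, ∫⁻ j', Q o j j' = ∫⁻ k, (K o j * S o (φ o k) * (h j * g k)) ^ 2 := fun o j => by
    have := hSc o
    have := hφc o
    rw [← (hmp o).lintegral_comp (f := fun k => (K o j * S o (φ o k) * (h j * g k)) ^ 2)
      (by fun_prop)]
    simp only [hinv]; rfl
  have hP : Measurable fun p : Ph × Ph × Ph =>
      (K p.1 p.2.1 * S p.1 (φ p.1 p.2.2) * (h p.2.1 * g p.2.2)) ^ 2 := by fun_prop
  have s5 : ∫⁻ o, (∫⁻ j, F o j) ^ 2 ≤ M * (sqInt h * sqInt g) := by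
    calc ∫⁻ o, (∫⁻ j, F o j) ^ 2
        ≤ ∫⁻ o, ∫⁻ j, ∫⁻ k, (K o j * S o (φ o k) * (h j * g k)) ^ 2 := by
          refine lintegral_mono fun o => (s3 o).trans (le_of_eq ?_)
          simp only [s4]
      _ = ∫⁻ j, ∫⁻ o, ∫⁻ k, (K o j * S o (φ o k) * (h j * g k)) ^ 2 := by
          apply lintegral_lintegral_swap
          refine Measurable.aemeasurable ?_
          exact Measurable.lintegral_prod_right' (f := fun q : (Ph × Ph) × Ph =>
            (K q.1.1 q.1.2 * S q.1.1 (φ q.1.1 q.2) * (h q.1.2 * g q.2)) ^ 2) (by fun_prop)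
      _ = ∫⁻ j, ∫⁻ k, ∫⁻ o, (K o j * S o (φ o k) * (h j * g k)) ^ 2 := by
          refine lintegral_congr fun j => lintegral_lintegral_swap ?_
          exact (hP.comp (f := fun q : Ph × Ph => (q.1, j, q.2)) (by fun_prop)).aemeasurable
      _ ≤ ∫⁻ j, ∫⁻ k, M * (h j ^ 2 * g k ^ 2) := by
          refine lintegral_mono fun j => lintegral_mono fun k => ?_
          simp only [mul_pow]
          have : Measurable fun o => K o j ^ 2 * S o (φ o k) ^ 2 := by
            exact Measurable.comp (g := fun q : Ph × Ph × Ph =>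
              K q.1 q.2.1 ^ 2 * S q.1 (φ q.1 q.2.2) ^ 2) (f := fun o => (o, j, k))
              (by fun_prop) (by fun_prop)
          rw [lintegral_mul_const _ this]
          gcongr
          exact hM j k
      _ = _ := by
          have : ∀ j, ∫⁻ k, M * (h j ^ 2 * g k ^ 2) = M * (h j ^ 2 * sqInt g) := fun j => by
            rw [lintegral_const_mul _ (by fun_prop), lintegral_const_mul _ (by fun_prop)]; rfl
          simp only [this]
          rw [lintegral_const_mul _ (by fun_prop), lintegral_mul_const _ (by fun_prop)]; rfl
  calc _ ≤ (∫⁻ o, f o * ∫⁻ j, F o j) ^ 2 := pow_le_pow_left' s1 2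
    _ ≤ sqInt f * ∫⁻ o, (∫⁻ j, F o j) ^ 2 :=
        lintegral_mul_sq_le _ hf.aemeasurable hFi.aemeasurable
    _ ≤ sqInt f * (M * (sqInt h * sqInt g)) := by gcongr
    _ = _ := by ring

/-- `TT*` bound with `a + b` and the second copy of `b` frozen. -/
lemma TriBdd.of_tt_sum {K S : Ph → Ph → ℝ≥0∞} (hK : Measurable (Function.uncurry K))
    (hS : Measurable (Function.uncurry S)) (hKS : ∀ a b, K a b ≤ K a b * S a b) {M : ℝ≥0∞}
    (h : ∀ c b', ∫⁻ a, K a (c - a) ^ 2 * S a b' ^ 2 ≤ M) : TriBdd K M := by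
  intro f₀ f₁ f₂ h0 h1 h2
  have hK' : Measurable fun p : Ph × Ph => K p.1 p.2 := hK
  have hS' : Measurable fun p : Ph × Ph => S p.1 p.2 := hS
  have e : triForm K f₀ f₁ f₂ = ∫⁻ a, ∫⁻ c, K a (c - a) * (f₁ a * f₀ c * f₂ (c - a)) := by
    refine lintegral_congr fun a => ?_
    rw [← lintegral_add_left_eq_self (fun c => K a (c - a) * (f₁ a * f₀ c * f₂ (c - a))) a]
    refine lintegral_congr fun b => ?_
    simp only [add_sub_cancel_left]; ring
  rw [e]
  refine (ttStar_bound (K := fun a c => K a (c - a)) (S := fun a c => S a (c - a))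
    (ψ := fun a c => c - a) (φ := fun a k => k + a) (M := M) ?_ ?_ (fun a c => hKS _ _) ?_ ?_
    (fun a => measurePreserving_sub_right volume a) (by simp) h1 h0 h2 ?_).trans (le_of_eq ?_)
  · show Measurable fun p : Ph × Ph => K p.1 (p.2 - p.1)
    fun_prop
  · show Measurable fun p : Ph × Ph => S p.1 (p.2 - p.1)
    fun_prop
  · show Measurable fun p : Ph × Ph => p.2 - p.1
    fun_prop
  · show Measurable fun p : Ph × Ph => p.2 + p.1
    fun_prop
  · intro c b'
    simpa using h c b'
  · ring

/-- `TT*` bound with `a` and the second copy of `b` frozen. -/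
lemma TriBdd.of_tt_left {K S : Ph → Ph → ℝ≥0∞} (hK : Measurable (Function.uncurry K))
    (hS : Measurable (Function.uncurry S)) (hKS : ∀ a b, K a b ≤ K a b * S a b) {M : ℝ≥0∞}
    (h : ∀ a b', ∫⁻ c, K a (c - a) ^ 2 * S (c - b') b' ^ 2 ≤ M) : TriBdd K M := by
  intro f₀ f₁ f₂ h0 h1 h2
  have hK' : Measurable fun p : Ph × Ph => K p.1 p.2 := hK
  have hS' : Measurable fun p : Ph × Ph => S p.1 p.2 := hS
  have e : triForm K f₀ f₁ f₂ = ∫⁻ c, ∫⁻ a, K a (c - a) * (f₀ c * f₁ a * f₂ (c - a)) := by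
    rw [triForm_eq_sum hK h0 h1 h2]
    refine lintegral_congr fun c => lintegral_congr fun a => ?_
    ring
  rw [e]
  refine (ttStar_bound (K := fun c a => K a (c - a)) (S := fun c a => S a (c - a))
    (ψ := fun c a => c - a) (φ := fun c k => c - k) (M := M) ?_ ?_ (fun a c => hKS _ _) ?_ ?_
    (fun c => Measure.measurePreserving_sub_left volume c) (by simp) h0 h1 h2 ?_)
  · show Measurable fun p : Ph × Ph => K p.2 (p.1 - p.2)
    fun_prop
  · show Measurable fun p : Ph × Ph => S p.2 (p.1 - p.2)
    fun_prop
  · show Measurable fun p : Ph × Ph => p.1 - p.2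
    fun_prop
  · show Measurable fun p : Ph × Ph => p.1 - p.2
    fun_prop
  · intro a b'
    simpa using h a b'

lemma triForm_tsum {K : ℕ → Ph → Ph → ℝ≥0∞} (hK : ∀ n, Measurable (Function.uncurry (K n)))
    {f₀ f₁ f₂ : Ph → ℝ≥0∞} (h0 : Measurable f₀) (h1 : Measurable f₁) (h2 : Measurable f₂) :
    triForm (fun a b => ∑' n, K n a b) f₀ f₁ f₂ = ∑' n, triForm (K n) f₀ f₁ f₂ := by
  have hK' : ∀ n, Measurable fun p : Ph × Ph => K n p.1 p.2 := hK
  unfold triForm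
  rw [← lintegral_tsum fun n => (Measurable.lintegral_prod_right' (f := fun p : Ph × Ph =>
    K n p.1 p.2 * (f₁ p.1 * f₂ p.2 * f₀ (p.1 + p.2))) (by have := hK' n; fun_prop)).aemeasurable]
  refine lintegral_congr fun a => ?_
  rw [← lintegral_tsum fun n => Measurable.aemeasurable ?_]
  · exact lintegral_congr fun b => ENNReal.tsum_mul_right.symm
  · have : Measurable fun b => K n a b := (hK n).comp (measurable_prodMk_left (x := a))
    fun_prop

/-- Summation of an almost orthogonal series of kernels. -/
lemma TriBdd.of_weighted_tsum {K : ℕ → Ph → Ph → ℝ≥0∞} {ω : ℕ → Ph → ℝ≥0∞} {C D : ℝ≥0∞}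
    (hK : ∀ n, Measurable (Function.uncurry (K n))) (hω : ∀ n, Measurable (ω n))
    (hb : ∀ n, TriBdd (K n) C) (hsum : ∀ a, ∑' n, ω n a ^ 2 ≤ D) :
    TriBdd (fun a b => ∑' n, ω n a * ω n b * K n a b) (C * D ^ 2) := by
  intro f₀ f₁ f₂ h0 h1 h2
  have hK' : ∀ n, Measurable fun p : Ph × Ph => K n p.1 p.2 := hK
  have hs : ∀ f : Ph → ℝ≥0∞, Measurable f →
      ∑' n, sqInt (fun a => ω n a * f a) ≤ D * sqInt f := fun f hf => by
    unfold sqInt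
    rw [← lintegral_tsum fun n => by have := hω n; fun_prop,
      ← lintegral_const_mul _ (by fun_prop)]
    refine lintegral_mono fun a => ?_
    simp only [mul_pow]
    rw [ENNReal.tsum_mul_right]
    gcongr
    exact hsum a
  have hm : ∀ n, Measurable (Function.uncurry fun a b => ω n a * ω n b * K n a b) := fun n => by
    have := hω n
    have := hK' n
    show Measurable fun p : Ph × Ph => ω n p.1 * ω n p.2 * K n p.1 p.2
    fun_prop
  rw [triForm_tsum hm h0 h1 h2]
  have key : ∀ n, triForm (fun a b => ω n a * ω n b * K n a b) f₀ f₁ f₂ ^ 2 ≤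
      (C * sqInt f₀) * (sqInt (fun a => ω n a * f₁ a) * sqInt (fun a => ω n a * f₂ a)) := fun n => by
    have e : triForm (fun a b => ω n a * ω n b * K n a b) f₀ f₁ f₂ =
        triForm (K n) f₀ (fun a => ω n a * f₁ a) (fun a => ω n a * f₂ a) :=
      lintegral_congr fun a => lintegral_congr fun b => by ring
    rw [e]
    refine (hb n f₀ (fun a => ω n a * f₁ a) (fun a => ω n a * f₂ a) h0
      ((hω n).mul h1) ((hω n).mul h2)).trans (le_of_eq ?_)
    ring
  calc _ ≤ _ := tsum_sq_le_of_sq_le key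
    _ ≤ (C * sqInt f₀) * ((D * sqInt f₁) * (D * sqInt f₂)) := by
        gcongr
        · exact hs f₁ h1
        · exact hs f₂ h2
    _ = _ := by ring

lemma TriBdd.add {K K' : Ph → Ph → ℝ≥0∞} {C C' : ℝ≥0∞} (hK : Measurable (Function.uncurry K))
    (h : TriBdd K C) (h' : TriBdd K' C') :
    TriBdd (fun a b => K a b + K' a b) (2 * (C + C')) := by
  intro f₀ f₁ f₂ h0 h1 h2
  have hK1 : Measurable fun p : Ph × Ph => K p.1 p.2 := hK
  have e : triForm (fun a b => K a b + K' a b) f₀ f₁ f₂ =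
      triForm K f₀ f₁ f₂ + triForm K' f₀ f₁ f₂ := by
    unfold triForm
    rw [← lintegral_add_left (Measurable.lintegral_prod_right' (f := fun p : Ph × Ph =>
      K p.1 p.2 * (f₁ p.1 * f₂ p.2 * f₀ (p.1 + p.2))) (by fun_prop))]
    refine lintegral_congr fun a => ?_
    have : Measurable fun b => K a b := hK.comp (measurable_prodMk_left (x := a))
    rw [← lintegral_add_left (by fun_prop)]
    exact lintegral_congr fun b => add_mul _ _ _
  rw [e]
  set x := triForm K f₀ f₁ f₂
  set y := triForm K' f₀ f₁ f₂
  calc (x + y) ^ 2 = x ^ 2 + 2 * (x * y) + y ^ 2 := by ring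
    _ ≤ x ^ 2 + (x ^ 2 + y ^ 2) + y ^ 2 := by gcongr; exact ennreal_two_mul_le x y
    _ = 2 * (x ^ 2 + y ^ 2) := by ring
    _ ≤ 2 * (C * (sqInt f₀ * sqInt f₁ * sqInt f₂) + C' * (sqInt f₀ * sqInt f₁ * sqInt f₂)) := by
        gcongr
        · exact h f₀ f₁ f₂ h0 h1 h2
        · exact h' f₀ f₁ f₂ h0 h1 h2
    _ = _ := by ring

/-! ## Integration in bipolar coordinates -/

lemma lintegral_sqrt_add_le {b : ℝ} (hb : 0 ≤ b) (G : ℝ → ℝ≥0∞) :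
    ∫⁻ t in Set.Ioi (0:ℝ), ENNReal.ofReal t * G (√(t ^ 2 + b)) ≤
      ∫⁻ r in Set.Ioi (0:ℝ), ENNReal.ofReal r * G r := by
  have hpos : ∀ t ∈ Set.Ioi (0:ℝ), 0 < t ^ 2 + b := fun t (ht : 0 < t) => by positivity
  have hd : ∀ t ∈ Set.Ioi (0:ℝ), HasDerivWithinAt (fun t => √(t ^ 2 + b)) (t / √(t ^ 2 + b))
      (Set.Ioi 0) t := fun t ht => by
    have h1 : HasDerivAt (fun t : ℝ => t ^ 2 + b) (2 * t) t := by
      simpa using (hasDerivAt_pow 2 t).add_const b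
    have h2 := h1.sqrt (hpos t ht).ne'
    refine (h2.congr_deriv ?_).hasDerivWithinAt
    rw [mul_div_mul_left _ _ two_ne_zero]
  have hinj : Set.InjOn (fun t => √(t ^ 2 + b)) (Set.Ioi 0) := fun t ht t' ht' h => by
    have h' : t ^ 2 + b = t' ^ 2 + b :=
      (Real.sqrt_inj (hpos t ht).le (hpos t' ht').le).1 h
    have : t ^ 2 = t' ^ 2 := by linarith
    exact (sq_eq_sq₀ (le_of_lt ht) (le_of_lt ht')).1 this
  have key := lintegral_image_eq_lintegral_abs_deriv_mul measurableSet_Ioi hd hinj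
    (fun r => ENNReal.ofReal r * G r)
  calc _ = ∫⁻ t in Set.Ioi (0:ℝ), ENNReal.ofReal |t / √(t ^ 2 + b)| *
        (ENNReal.ofReal √(t ^ 2 + b) * G √(t ^ 2 + b)) := by
        refine setLIntegral_congr_fun measurableSet_Ioi fun t ht => ?_
        have hs : 0 < √(t ^ 2 + b) := Real.sqrt_pos.2 (hpos t ht)
        have ht' : 0 < t := ht
        rw [← mul_assoc, ← ENNReal.ofReal_mul (abs_nonneg _), abs_of_pos (div_pos ht' hs),
          div_mul_cancel₀ _ hs.ne']
    _ = _ := key.symm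
    _ ≤ _ := by
        refine lintegral_mono_set ?_
        rintro _ ⟨t, ht, rfl⟩
        exact Real.sqrt_pos.2 (hpos t ht)

lemma lintegral_sqrt_sub_le {X : ℝ} (hX : 0 < X) (q : ℝ) (G : ℝ → ℝ≥0∞) :
    ∫⁻ w in {w : ℝ | 0 < q - 2 * w * X}, ENNReal.ofReal X * G (√(q - 2 * w * X)) ≤
      ∫⁻ s in Set.Ioi (0:ℝ), ENNReal.ofReal s * G s := by
  have hm : MeasurableSet {w : ℝ | 0 < q - 2 * w * X} :=
    measurableSet_lt measurable_const (by fun_prop)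
  have hd : ∀ t ∈ {w : ℝ | 0 < q - 2 * w * X}, HasDerivWithinAt (fun w => √(q - 2 * w * X))
      (-X / √(q - 2 * t * X)) {w : ℝ | 0 < q - 2 * w * X} t := fun t ht => by
    have h1 : HasDerivAt (fun w : ℝ => q - 2 * w * X) (-(2 * X)) t := by
      simpa using (((hasDerivAt_id t).const_mul 2).mul_const X).const_sub q
    have h2 := h1.sqrt (ne_of_gt ht)
    refine (h2.congr_deriv ?_).hasDerivWithinAt
    rw [← mul_neg, mul_div_mul_left _ _ two_ne_zero]
  have hinj : Set.InjOn (fun w => √(q - 2 * w * X)) {w : ℝ | 0 < q - 2 * w * X} :=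
    fun t ht t' ht' h => by
      have h' : q - 2 * t * X = q - 2 * t' * X :=
        (Real.sqrt_inj (le_of_lt ht) (le_of_lt ht')).1 h
      have : t * X = t' * X := by linarith
      exact mul_right_cancel₀ hX.ne' this
  have key := lintegral_image_eq_lintegral_abs_deriv_mul hm hd hinj
    (fun r => ENNReal.ofReal r * G r)
  calc _ = ∫⁻ t in {w : ℝ | 0 < q - 2 * w * X}, ENNReal.ofReal |-X / √(q - 2 * t * X)| *
        (ENNReal.ofReal √(q - 2 * t * X) * G √(q - 2 * t * X)) := by
        refine setLIntegral_congr_fun hm fun t ht => ?_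
        have hs : 0 < √(q - 2 * t * X) := Real.sqrt_pos.2 ht
        rw [← mul_assoc, ← ENNReal.ofReal_mul (abs_nonneg _), neg_div, abs_neg,
          abs_of_pos (div_pos hX hs), div_mul_cancel₀ _ hs.ne']
    _ = _ := key.symm
    _ ≤ _ := by
        refine lintegral_mono_set ?_
        rintro _ ⟨t, ht, rfl⟩
        exact Real.sqrt_pos.2 ht

lemma lintegral_bipolar_plane_le {X : ℝ} (hX : 0 < X) (c : ℝ) {F : ℝ × ℝ → ℝ≥0∞}
    (hF : Measurable F) :
    ∫⁻ w, ∫⁻ t in Set.Ioi (0:ℝ), ENNReal.ofReal X * (ENNReal.ofReal t *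
        F (√(w ^ 2 + t ^ 2 + c ^ 2), √((w - X) ^ 2 + t ^ 2 + c ^ 2))) ≤
      ∫⁻ r in Set.Ioi (0:ℝ), ∫⁻ s in Set.Ioi (0:ℝ), ENNReal.ofReal (r * s) * F (r, s) := by
  set A : ℝ → Set ℝ := fun r => {w | 0 < r ^ 2 + X ^ 2 - 2 * w * X}
  have hAm : ∀ r, MeasurableSet (A r) := fun r =>
    measurableSet_lt measurable_const (by fun_prop)
  set H : ℝ → ℝ → ℝ≥0∞ := fun w r => (A r).indicator
    (fun w => ENNReal.ofReal X * F (r, √(r ^ 2 + X ^ 2 - 2 * w * X))) w with hH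
  have hHm : Measurable (Function.uncurry H) := by
    have : Function.uncurry H = {p : ℝ × ℝ | 0 < p.2 ^ 2 + X ^ 2 - 2 * p.1 * X}.indicator
        (fun p => ENNReal.ofReal X * F (p.2, √(p.2 ^ 2 + X ^ 2 - 2 * p.1 * X))) := by
      ext ⟨w, r⟩
      simp only [hH, Function.uncurry, Set.indicator, A, Set.mem_ofPred_eq]
    rw [this]
    refine Measurable.indicator (by fun_prop) ?_
    exact measurableSet_lt measurable_const (by fun_prop)
  calc _ ≤ ∫⁻ w, ∫⁻ t in Set.Ioi (0:ℝ), ENNReal.ofReal t * H w (√(t ^ 2 + (w ^ 2 + c ^ 2))) := by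
        refine lintegral_mono fun w => setLIntegral_mono' measurableSet_Ioi fun t ht => ?_
        have ht' : 0 < t := ht
        have e1 : w ^ 2 + t ^ 2 + c ^ 2 = t ^ 2 + (w ^ 2 + c ^ 2) := by ring
        have e2 : √(t ^ 2 + (w ^ 2 + c ^ 2)) ^ 2 = t ^ 2 + (w ^ 2 + c ^ 2) :=
          Real.sq_sqrt (by positivity)
        have e3 : t ^ 2 + (w ^ 2 + c ^ 2) + X ^ 2 - 2 * w * X = (w - X) ^ 2 + t ^ 2 + c ^ 2 := by
          ring
        have : w ∈ A √(t ^ 2 + (w ^ 2 + c ^ 2)) := by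
          simp only [A, Set.mem_ofPred_eq, e2, e3]; positivity
        simp only [hH, Set.indicator_of_mem this, e2, e3, e1]
        exact le_of_eq (by ring)
    _ ≤ ∫⁻ w, ∫⁻ r in Set.Ioi (0:ℝ), ENNReal.ofReal r * H w r :=
        lintegral_mono fun w => lintegral_sqrt_add_le (by positivity) (H w)
    _ = ∫⁻ r in Set.Ioi (0:ℝ), ∫⁻ w, ENNReal.ofReal r * H w r := by
        refine lintegral_lintegral_swap (Measurable.aemeasurable ?_)
        show Measurable fun p : ℝ × ℝ => ENNReal.ofReal p.2 * H p.1 p.2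
        have : Measurable fun p : ℝ × ℝ => H p.1 p.2 := hHm
        fun_prop
    _ ≤ _ := by
        refine setLIntegral_mono' measurableSet_Ioi fun r hr => ?_
        have hHr : Measurable fun w => H w r := hHm.comp (by fun_prop : Measurable fun w => (w, r))
        rw [lintegral_const_mul _ hHr]
        calc ENNReal.ofReal r * ∫⁻ w, H w r ≤ ENNReal.ofReal r *
              ∫⁻ s in Set.Ioi (0:ℝ), ENNReal.ofReal s * F (r, s) := by
              refine mul_le_mul_right ?_ _
              simp only [hH]
              rw [lintegral_indicator (hAm r)]
              exact lintegral_sqrt_sub_le hX (r ^ 2 + X ^ 2) (fun s => F (r, s))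
          _ = _ := by
              rw [← lintegral_const_mul _ (by fun_prop)]
              refine lintegral_congr fun s => ?_
              rw [ENNReal.ofReal_mul (le_of_lt hr), mul_assoc]

lemma exists_frame {x e : Space} (hx : x ≠ 0) (he : ‖e‖ = 1) (hxe : inner ℝ e x = 0) :
    ∃ B : OrthonormalBasis (Fin 3) ℝ Space, x = ‖x‖ • B 0 ∧ B 2 = e := by
  have hxn : ‖x‖ ≠ 0 := norm_ne_zero_iff.2 hx
  set v : Fin 3 → Space := fun i => if i = 0 then ‖x‖⁻¹ • x else e with hv
  have hn : ∀ i, ‖v i‖ = 1 := fun i => by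
    by_cases hi : i = 0 <;> simp [hv, hi, norm_smul, hxn, he]
  have hi : ∀ i j, i = 0 → j ≠ 0 → inner ℝ (v i) (v j) = 0 := fun i j hi hj => by
    have hxe' : inner ℝ x e = 0 := (real_inner_comm _ _).trans hxe
    simp [hv, hi, hj, inner_smul_left, hxe']
  have ho : Orthonormal ℝ (({0, 2} : Set (Fin 3)).domRestrict v) := by
    refine ⟨fun i => hn _, fun i j hij => ?_⟩
    have hij' : i.1 ≠ j.1 := fun h => hij (Subtype.ext h)
    have h1 : i.1 = 0 ∨ i.1 = 2 := i.2
    have h2 : j.1 = 0 ∨ j.1 = 2 := j.2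
    show inner ℝ (v i.1) (v j.1) = 0
    by_cases h3 : i.1 = 0
    · exact hi _ _ h3 (fun h => hij' (h3.trans h.symm))
    · by_cases h4 : j.1 = 0
      · rw [real_inner_comm]
        exact hi _ _ h4 h3
      · exact absurd ((h1.resolve_left h3).trans (h2.resolve_left h4).symm) hij'
  obtain ⟨B, hB⟩ := ho.exists_orthonormalBasis_extension_of_card_eq (by simp)
  refine ⟨B, ?_, ?_⟩
  · have := hB 0 (by simp)
    simp only [hv, if_true] at this
    rw [this, smul_smul, mul_inv_cancel₀ hxn, one_smul]
  · have := hB 2 (by simp)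
    simpa [hv] using this

lemma lintegral_frame (B : OrthonormalBasis (Fin 3) ℝ Space) {H : ℝ → ℝ → ℝ → ℝ≥0∞}
    (hH : Measurable fun p : ℝ × ℝ × ℝ => H p.1 p.2.1 p.2.2) :
    ∫⁻ w : Space, H (inner ℝ (B 0) w) (inner ℝ (B 1) w) (inner ℝ (B 2) w) =
      ∫⁻ a, ∫⁻ b, ∫⁻ c, H a b c := by
  have hm1 := B.measurePreserving_repr
  have hm2 := PiLp.volume_preserving_ofLp (Fin 3)
  have hm3 := volume_preserving_piFinSuccAbove (fun _ : Fin 3 => ℝ) 0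
  have hm4 := volume_preserving_piFinTwo (fun _ : Fin 2 => ℝ)
  have hm5 : MeasurePreserving (fun p : ℝ × (Fin 2 → ℝ) => (p.1, (p.2 0, p.2 1)))
      ((volume : Measure ℝ).prod volume) ((volume : Measure ℝ).prod volume) :=
    (MeasurePreserving.id volume).prod hm4
  have hm := hm5.comp (hm3.comp (hm2.comp hm1))
  have := hm.lintegral_comp hH
  calc _ = ∫⁻ p : ℝ × ℝ × ℝ, H p.1 p.2.1 p.2.2 ∂((volume : Measure ℝ).prod volume) := by
        rw [← this]
        refine lintegral_congr fun w => ?_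
        simp only [← OrthonormalBasis.repr_apply_apply]
        rfl
    _ = _ := by
        rw [lintegral_prod _ hH.aemeasurable]
        refine lintegral_congr fun a => ?_
        exact lintegral_prod _ (hH.comp (by fun_prop :
          Measurable fun q : ℝ × ℝ => (a, q))).aemeasurable

lemma frame_norm_sq (B : OrthonormalBasis (Fin 3) ℝ Space) (w : Space) :
    ‖w‖ ^ 2 = inner ℝ (B 0) w ^ 2 + inner ℝ (B 1) w ^ 2 + inner ℝ (B 2) w ^ 2 := by
  have := B.sum_sq_norm_inner_right w
  simp only [Fin.sum_univ_three, Real.norm_eq_abs, sq_abs] at this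
  exact this.symm

lemma frame_norm (B : OrthonormalBasis (Fin 3) ℝ Space) (w : Space) :
    ‖w‖ = √(inner ℝ (B 0) w ^ 2 + inner ℝ (B 1) w ^ 2 + inner ℝ (B 2) w ^ 2) := by
  rw [← frame_norm_sq, Real.sqrt_sq (norm_nonneg _)]

lemma frame_norm_sub (B : OrthonormalBasis (Fin 3) ℝ Space) {x : Space} (hx : x = ‖x‖ • B 0)
    (w : Space) : ‖x - w‖ =
      √((inner ℝ (B 0) w - ‖x‖) ^ 2 + inner ℝ (B 1) w ^ 2 + inner ℝ (B 2) w ^ 2) := by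
  have h01 : inner ℝ (B 1) (B 0) = 0 := B.orthonormal.2 (by decide)
  have h02 : inner ℝ (B 2) (B 0) = 0 := B.orthonormal.2 (by decide)
  have h00 : inner ℝ (B 0) (B 0) = 1 := by
    rw [real_inner_self_eq_norm_sq, B.orthonormal.1 0]; norm_num
  rw [norm_sub_rev, frame_norm B]
  have e0 : inner ℝ (B 0) x = ‖x‖ := by
    conv_lhs => rw [hx]
    rw [inner_smul_right, h00, mul_one]
  have e1 : inner ℝ (B 1) x = 0 := by rw [hx, inner_smul_right, h01, mul_zero]
  have e2 : inner ℝ (B 2) x = 0 := by rw [hx, inner_smul_right, h02, mul_zero]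
  simp only [inner_sub_right, e0, e1, e2, sub_zero]

lemma exists_unit_orthogonal_pair (x y : Space) :
    ∃ e : Space, ‖e‖ = 1 ∧ inner ℝ e x = 0 ∧ inner ℝ e y = 0 := by
  have h1 : Module.finrank ℝ (Submodule.span ℝ ({x, y} : Set Space)) ≤ 2 := by
    classical
    refine (finrank_span_le_card (R := ℝ) ({x, y} : Set Space)).trans ?_
    rw [Set.toFinset_insert, Set.toFinset_singleton]
    exact Finset.card_le_two
  have h2 : Module.finrank ℝ Space = 3 := by simp
  have h3 := Submodule.finrank_add_finrank_orthogonal (Submodule.span ℝ ({x, y} : Set Space))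
  have h4 : (Submodule.span ℝ ({x, y} : Set Space))ᗮ ≠ ⊥ := fun h => by
    rw [h, finrank_bot] at h3
    omega
  obtain ⟨e, he, hne⟩ := Submodule.exists_mem_ne_zero_of_ne_bot h4
  have hn : ‖e‖ ≠ 0 := norm_ne_zero_iff.2 hne
  rw [Submodule.mem_orthogonal] at he
  have hx := he x (Submodule.subset_span (by simp))
  have hy := he y (Submodule.subset_span (by simp))
  refine ⟨‖e‖⁻¹ • e, ?_, ?_, ?_⟩
  · simp [norm_smul, hn]
  · rw [inner_smul_left, real_inner_comm, hx]; simp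
  · rw [inner_smul_left, real_inner_comm, hy]; simp

lemma lintegral_bipolar_le {x : Space} (hx : x ≠ 0) {F : ℝ × ℝ → ℝ≥0∞} (hF : Measurable F) :
    ENNReal.ofReal ‖x‖ * ∫⁻ w : Space, F (‖w‖, ‖x - w‖) ≤ ENNReal.ofReal (2 * Real.pi) *
      ∫⁻ r in Set.Ioi (0:ℝ), ∫⁻ s in Set.Ioi (0:ℝ), ENNReal.ofReal (r * s) * F (r, s) := by
  obtain ⟨e, he, hex, -⟩ := exists_unit_orthogonal_pair x x
  obtain ⟨B, hB, -⟩ := exists_frame hx he hex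
  set X := ‖x‖ with hXdef
  have hX : 0 < X := norm_pos_iff.2 hx
  set H : ℝ → ℝ → ℝ → ℝ≥0∞ := fun a b c =>
    F (√(a ^ 2 + b ^ 2 + c ^ 2), √((a - X) ^ 2 + b ^ 2 + c ^ 2)) with hH
  have hHm : Measurable fun p : ℝ × ℝ × ℝ => H p.1 p.2.1 p.2.2 := by
    simp only [hH]; fun_prop
  have e1 : ∫⁻ w : Space, F (‖w‖, ‖x - w‖) = ∫⁻ a, ∫⁻ b, ∫⁻ c, H a b c := by
    rw [← lintegral_frame B hHm]
    refine lintegral_congr fun w => ?_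
    rw [frame_norm_sub B hB w, frame_norm B w]
  have e2 : ∀ a, ∫⁻ b, ∫⁻ c, H a b c = ENNReal.ofReal (2 * Real.pi) *
      ∫⁻ t in Set.Ioi (0:ℝ), ENNReal.ofReal t *
        F (√(a ^ 2 + t ^ 2 + 0 ^ 2), √((a - X) ^ 2 + t ^ 2 + 0 ^ 2)) := fun a => by
    have hHa : Measurable fun q : ℝ × ℝ => H a q.1 q.2 :=
      hHm.comp (by fun_prop : Measurable fun q : ℝ × ℝ => (a, q))
    rw [← lintegral_prod (fun q : ℝ × ℝ => H a q.1 q.2) hHa.aemeasurable]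
    have := lintegral_comp_polarCoord_symm (fun q : ℝ × ℝ => H a q.1 q.2)
    rw [show (volume : Measure (ℝ × ℝ)) = (volume : Measure ℝ).prod volume from rfl] at this
    rw [← this]
    have ht : polarCoord.target = Set.Ioi (0:ℝ) ×ˢ Set.Ioo (-Real.pi) Real.pi := rfl
    rw [ht, ← Measure.prod_restrict, lintegral_prod]
    · rw [← lintegral_const_mul _ (by fun_prop)]
      refine lintegral_congr fun t => ?_
      have : ∀ θ, ENNReal.ofReal t • H a (polarCoord.symm (t, θ)).1 (polarCoord.symm (t, θ)).2 =
          ENNReal.ofReal t * F (√(a ^ 2 + t ^ 2 + 0 ^ 2), √((a - X) ^ 2 + t ^ 2 + 0 ^ 2)) :=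
        fun θ => by
          have h1 := Real.cos_sq_add_sin_sq θ
          have e3 : ∀ z : ℝ, z + (t * Real.cos θ) ^ 2 + (t * Real.sin θ) ^ 2 = z + t ^ 2 + 0 ^ 2 :=
            fun z => by linear_combination t ^ 2 * h1
          simp only [polarCoord_symm_apply, hH, smul_eq_mul, e3]
      simp only [this]
      rw [lintegral_const, mul_comm]
      congr 1
      simp [two_mul]
    · have hc : Continuous polarCoord.symm := by
        have : (polarCoord.symm : ℝ × ℝ → ℝ × ℝ) =
          fun p => (p.1 * Real.cos p.2, p.1 * Real.sin p.2) := by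
          ext p <;> simp [polarCoord_symm_apply]
        rw [this]; fun_prop
      have hcm := hc.measurable
      have := hHa.comp hcm
      have h3 : Measurable fun z : ℝ × ℝ => ENNReal.ofReal z.1 * H a (polarCoord.symm z).1
        (polarCoord.symm z).2 := by
        refine Measurable.mul (by fun_prop) this
      exact h3.aemeasurable
  rw [e1]
  simp only [e2]
  have hm0 : Measurable fun p : ℝ × ℝ => ENNReal.ofReal p.2 *
        F (√(p.1 ^ 2 + p.2 ^ 2 + 0 ^ 2), √((p.1 - X) ^ 2 + p.2 ^ 2 + 0 ^ 2)) := by fun_prop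
  have hm1 : Measurable fun a => ∫⁻ t in Set.Ioi (0:ℝ), ENNReal.ofReal t *
        F (√(a ^ 2 + t ^ 2 + 0 ^ 2), √((a - X) ^ 2 + t ^ 2 + 0 ^ 2)) :=
    hm0.lintegral_prod_right'
  rw [lintegral_const_mul _ hm1, ← mul_assoc, mul_comm (ENNReal.ofReal X), mul_assoc]
  gcongr
  refine le_trans (le_of_eq ?_) (lintegral_bipolar_plane_le hX 0 hF)
  rw [← lintegral_const_mul _ hm1]
  refine lintegral_congr fun a => ?_
  rw [← lintegral_const_mul _ (by fun_prop)]

lemma lintegral_abs_eq {G : ℝ → ℝ≥0∞} (hG : Measurable G) :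
    ∫⁻ t, G |t| = 2 * ∫⁻ t in Set.Ioi (0:ℝ), G t := by
  rw [← lintegral_add_compl _ (measurableSet_Ioi (a := (0:ℝ))), two_mul]
  congr 1
  · exact setLIntegral_congr_fun measurableSet_Ioi fun t ht => by rw [abs_of_pos ht]
  · rw [Set.compl_Ioi, setLIntegral_congr (Iio_ae_eq_Iic (a := (0:ℝ))).symm]
    have hmp := (Measure.measurePreserving_neg (volume : Measure ℝ)).restrict_preimage
      (measurableSet_Ioi (a := (0:ℝ)))
    rw [← hmp.lintegral_comp hG]
    rw [show (Neg.neg ⁻¹' Set.Ioi (0:ℝ) : Set ℝ) = Set.Iio 0 by ext; simp]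
    exact setLIntegral_congr_fun measurableSet_Iio fun t ht => by rw [abs_of_neg ht]

set_option maxHeartbeats 800000 in
/-- Integration over a thin slab containing the axis, with the area weight. -/
lemma lintegral_bipolar_slab_le {x e : Space} (hx : x ≠ 0) (he : ‖e‖ = 1)
    (hex : inner ℝ e x = 0) {d : ℝ} (hd : 0 ≤ d) {F : ℝ × ℝ → ℝ≥0∞} (hF : Measurable F) :
    ∫⁻ w : Space in {w | |inner ℝ e w| ≤ d},
        ENNReal.ofReal √(‖w‖ ^ 2 * ‖x‖ ^ 2 - inner ℝ w x ^ 2) * F (‖w‖, ‖x - w‖) ≤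
      ENNReal.ofReal (16 * d) *
      ∫⁻ r in Set.Ioi (0:ℝ), ∫⁻ s in Set.Ioi (0:ℝ), ENNReal.ofReal (r * s) * F (r, s) := by
  obtain ⟨B, hB, hB2⟩ := exists_frame hx he hex
  set X := ‖x‖ with hXdef
  have hX : 0 < X := norm_pos_iff.2 hx
  set I := ∫⁻ r in Set.Ioi (0:ℝ), ∫⁻ s in Set.Ioi (0:ℝ), ENNReal.ofReal (r * s) * F (r, s)
    with hI
  set Φ : ℝ → ℝ → ℝ → ℝ≥0∞ := fun a t c => ENNReal.ofReal X * (ENNReal.ofReal t *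
      F (√(a ^ 2 + t ^ 2 + c ^ 2), √((a - X) ^ 2 + t ^ 2 + c ^ 2))) with hΦ
  have hΦm : Measurable fun p : ℝ × ℝ × ℝ => Φ p.1 p.2.1 p.2.2 := by
    simp only [hΦ]; fun_prop
  set D : Set ℝ := Set.Icc (-d) d with hD
  have hDm : MeasurableSet D := measurableSet_Icc
  set H : ℝ → ℝ → ℝ → ℝ≥0∞ := fun a b c =>
    D.indicator (fun c => 2 * Φ a |b| c) c + D.indicator (fun b => 2 * Φ a |c| b) b with hH
  have hH1 : Measurable fun p : ℝ × ℝ × ℝ => D.indicator (fun c => 2 * Φ p.1 |p.2.1| c) p.2.2 := by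
    have : (fun p : ℝ × ℝ × ℝ => D.indicator (fun c => 2 * Φ p.1 |p.2.1| c) p.2.2) =
        {p : ℝ × ℝ × ℝ | p.2.2 ∈ D}.indicator (fun p => 2 * Φ p.1 |p.2.1| p.2.2) := by
      ext p; simp only [Set.indicator, Set.mem_ofPred_eq]
    rw [this]
    refine Measurable.indicator ?_ (hDm.preimage (by fun_prop))
    exact Measurable.const_mul (hΦm.comp (by fun_prop :
      Measurable fun p : ℝ × ℝ × ℝ => (p.1, |p.2.1|, p.2.2))) _
  have hH2 : Measurable fun p : ℝ × ℝ × ℝ => D.indicator (fun b => 2 * Φ p.1 |p.2.2| b) p.2.1 :=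
    hH1.comp (by fun_prop : Measurable fun p : ℝ × ℝ × ℝ => (p.1, p.2.2, p.2.1))
  have hHm : Measurable fun p : ℝ × ℝ × ℝ => H p.1 p.2.1 p.2.2 := hH1.add hH2
  have hS : MeasurableSet {w : Space | |inner ℝ e w| ≤ d} :=
    measurableSet_le (by fun_prop) measurable_const
  -- the pointwise bound
  have s1 : ∫⁻ w : Space in {w | |inner ℝ e w| ≤ d},
        ENNReal.ofReal √(‖w‖ ^ 2 * X ^ 2 - inner ℝ w x ^ 2) * F (‖w‖, ‖x - w‖) ≤
      ∫⁻ w : Space, H (inner ℝ (B 0) w) (inner ℝ (B 1) w) (inner ℝ (B 2) w) := by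
    rw [← lintegral_indicator hS]
    refine lintegral_mono fun w => ?_
    by_cases hw : |inner ℝ e w| ≤ d
    swap
    · rw [Set.indicator_of_notMem (by exact hw)]; exact zero_le
    rw [Set.indicator_of_mem (by exact hw), frame_norm_sub B hB w, ← hXdef]
    have hwx : inner ℝ w x = X * inner ℝ (B 0) w := by
      conv_lhs => rw [hB]
      rw [inner_smul_right, real_inner_comm]
    have hnw := frame_norm_sq B w
    rw [hwx, frame_norm B w, Real.sq_sqrt (by positivity)]
    set a := inner ℝ (B 0) w
    set b := inner ℝ (B 1) w
    rw [← hB2] at hw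
    set c := inner ℝ (B 2) w
    have e4 : (a ^ 2 + b ^ 2 + c ^ 2) * X ^ 2 - (X * a) ^ 2 = (b ^ 2 + c ^ 2) * X ^ 2 := by ring
    rw [e4, Real.sqrt_mul (by positivity), Real.sqrt_sq hX.le, ENNReal.ofReal_mul (by positivity)]
    have hc : c ∈ D := abs_le.1 hw
    have hle : ∀ b c : ℝ, |c| ≤ |b| → √(b ^ 2 + c ^ 2) ≤ 2 * |b| := fun b c h => by
      refine Real.sqrt_le_iff.2 ⟨by positivity, ?_⟩
      nlinarith [sq_abs b, sq_abs c, abs_nonneg b, abs_nonneg c]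
    rcases le_total |c| |b| with h | h
    · refine le_trans ?_ (le_add_right le_rfl)
      rw [Set.indicator_of_mem hc]
      simp only [hΦ, sq_abs]
      calc _ ≤ ENNReal.ofReal (2 * |b|) * ENNReal.ofReal X * _ := by
            gcongr; exact hle b c h
        _ = _ := by
            rw [ENNReal.ofReal_mul (by norm_num), ENNReal.ofReal_ofNat]; ring
    · refine le_trans ?_ (le_add_left le_rfl)
      have hb : b ∈ D := abs_le.1 (h.trans hw)
      rw [Set.indicator_of_mem hb]
      simp only [hΦ, sq_abs]
      have e5 : ∀ z : ℝ, z + c ^ 2 + b ^ 2 = z + b ^ 2 + c ^ 2 := fun z => by ring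
      rw [e5, e5]
      calc _ ≤ ENNReal.ofReal (2 * |c|) * ENNReal.ofReal X * _ := by
            gcongr
            rw [add_comm]; exact hle c b h
        _ = _ := by
            rw [ENNReal.ofReal_mul (by norm_num), ENNReal.ofReal_ofNat]; ring
  have s2 : ∀ c, ∫⁻ a, ∫⁻ b, 2 * Φ a |b| c ≤ 4 * I := fun c => by
    have hg : ∀ a, Measurable fun t => Φ a t c := fun a =>
      hΦm.comp (by fun_prop : Measurable fun t : ℝ => (a, t, c))
    have hg2 : Measurable fun p : ℝ × ℝ => Φ p.1 p.2 c :=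
      hΦm.comp (by fun_prop : Measurable fun p : ℝ × ℝ => (p.1, p.2, c))
    have : ∀ a, ∫⁻ b, 2 * Φ a |b| c = 4 * ∫⁻ t in Set.Ioi (0:ℝ), Φ a t c := fun a => by
      rw [lintegral_abs_eq (G := fun t => 2 * Φ a t c) ((hg a).const_mul _),
        lintegral_const_mul _ (hg a), ← mul_assoc]
      norm_num
    simp only [this]
    rw [lintegral_const_mul _ hg2.lintegral_prod_right']
    gcongr
    exact lintegral_bipolar_plane_le hX c hF
  have hvol : volume D = ENNReal.ofReal (2 * d) := by
    rw [hD, Real.volume_Icc]; congr 1; ring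
  have s3 : ∫⁻ c, ∫⁻ a, ∫⁻ b, D.indicator (fun c => 2 * Φ a |b| c) c ≤
      ENNReal.ofReal (8 * d) * I := by
    calc _ ≤ ∫⁻ c, D.indicator (fun _ => 4 * I) c := by
          refine lintegral_mono fun c => ?_
          by_cases hc : c ∈ D
          · simp only [Set.indicator_of_mem hc]; exact s2 c
          · simp only [Set.indicator_of_notMem hc]; simp
      _ = _ := by
          rw [lintegral_indicator hDm, setLIntegral_const, hvol,
            show (8:ℝ) * d = 4 * (2 * d) by ring, ENNReal.ofReal_mul (by norm_num : (0:ℝ) ≤ 4),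
            ENNReal.ofReal_ofNat]
          ring
  have s4 : ∫⁻ a, ∫⁻ b, ∫⁻ c, D.indicator (fun c => 2 * Φ a |b| c) c ≤
      ENNReal.ofReal (8 * d) * I := by
    refine le_trans (le_of_eq ?_) s3
    rw [lintegral_lintegral_swap (f := fun c a => ∫⁻ b, D.indicator (fun c => 2 * Φ a |b| c) c)]
    · refine lintegral_congr fun a => lintegral_lintegral_swap ?_
      exact (hH1.comp (by fun_prop : Measurable fun q : ℝ × ℝ => (a, q))).aemeasurable
    · refine Measurable.aemeasurable ?_
      exact Measurable.lintegral_prod_right' (f := fun q : (ℝ × ℝ) × ℝ =>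
        D.indicator (fun c => 2 * Φ q.1.2 |q.2| c) q.1.1)
        (hH1.comp (by fun_prop : Measurable fun q : (ℝ × ℝ) × ℝ => (q.1.2, q.2, q.1.1)))
  have s5 : ∫⁻ a, ∫⁻ b, ∫⁻ c, D.indicator (fun b => 2 * Φ a |c| b) b ≤
      ENNReal.ofReal (8 * d) * I := by
    refine le_trans (le_of_eq ?_) s4
    refine lintegral_congr fun a => lintegral_lintegral_swap ?_
    exact (hH2.comp (by fun_prop : Measurable fun q : ℝ × ℝ => (a, q))).aemeasurable
  refine s1.trans ?_
  rw [lintegral_frame B hHm]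
  calc _ = (∫⁻ a, ∫⁻ b, ∫⁻ c, D.indicator (fun c => 2 * Φ a |b| c) c) +
        ∫⁻ a, ∫⁻ b, ∫⁻ c, D.indicator (fun b => 2 * Φ a |c| b) b := by
        have m1 : Measurable fun q : ℝ × ℝ => ∫⁻ c, D.indicator (fun c => 2 * Φ q.1 |q.2| c) c :=
          Measurable.lintegral_prod_right' (f := fun q : (ℝ × ℝ) × ℝ =>
            D.indicator (fun c => 2 * Φ q.1.1 |q.1.2| c) q.2)
            (hH1.comp (by fun_prop : Measurable fun q : (ℝ × ℝ) × ℝ => (q.1.1, q.1.2, q.2)))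
        rw [← lintegral_add_left m1.lintegral_prod_right']
        refine lintegral_congr fun a => ?_
        have m2 : Measurable fun b : ℝ => ∫⁻ c, D.indicator (fun c => 2 * Φ a |b| c) c :=
          m1.comp (by fun_prop : Measurable fun b : ℝ => (a, b))
        simp only
        rw [← lintegral_add_left m2]
        refine lintegral_congr fun b => ?_
        have m3 : Measurable fun c : ℝ => D.indicator (fun c => 2 * Φ a |b| c) c :=
          hH1.comp (by fun_prop : Measurable fun c : ℝ => (a, b, c))
        rw [← lintegral_add_left m3]
    _ ≤ ENNReal.ofReal (8 * d) * I + ENNReal.ofReal (8 * d) * I := add_le_add s4 s5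
    _ = _ := by
        rw [← add_mul, ← ENNReal.ofReal_add (by positivity) (by positivity)]
        congr 2; ring

/-- Change of variables along an expanding function. -/
lemma lintegral_comp_expanding_le {S : Set ℝ} (hS : MeasurableSet S) {φ : ℝ → ℝ}
    (hφ : Measurable φ) (hexp : ∀ t ∈ S, ∀ t' ∈ S, |t - t'| ≤ |φ t - φ t'|)
    {κ : ℝ → ℝ≥0∞} (hκ : Measurable κ) : ∫⁻ t in S, κ (φ t) ≤ ∫⁻ u, κ u := by
  rw [← lintegral_map hκ hφ]
  refine lintegral_mono' ?_ le_rfl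
  refine Measure.le_iff.2 fun A hA => ?_
  rw [Measure.map_apply hφ hA, Measure.restrict_apply (hφ hA)]
  rcases S.eq_empty_or_nonempty with rfl | ⟨t₀, ht₀⟩
  · simp
  have hinj : Set.InjOn φ S := fun t ht t' ht' h => by
    have := hexp t ht t' ht'
    rw [h, sub_self, abs_zero] at this
    exact sub_eq_zero.1 (abs_eq_zero.1 (le_antisymm this (abs_nonneg _)))
  set g := Function.invFunOn φ S
  have hg : ∀ t ∈ S, g (φ t) = t := fun t ht => hinj.leftInvOn_invFunOn ht
  have hlip : LipschitzOnWith 1 g (φ '' S ∩ A) := by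
    refine LipschitzOnWith.of_dist_le_mul ?_
    rintro _ ⟨⟨t, ht, rfl⟩, -⟩ _ ⟨⟨t', ht', rfl⟩, -⟩
    rw [hg t ht, hg t' ht', Real.dist_eq, Real.dist_eq]
    simpa using hexp t ht t' ht'
  have hsub : φ ⁻¹' A ∩ S ⊆ g '' (φ '' S ∩ A) := fun t ht =>
    ⟨φ t, ⟨⟨t, ht.2, rfl⟩, ht.1⟩, hg t ht.2⟩
  have h1 := hlip.hausdorffMeasure_image_le (d := 1) zero_le_one
  rw [hausdorffMeasure_real] at h1
  calc _ ≤ _ := measure_mono hsub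
    _ ≤ _ := h1
    _ ≤ _ := by simpa using measure_mono Set.inter_subset_right

/-! ## Brackets and convolution estimates -/

lemma jap_pos (x : ℝ) : 0 < jap x := Real.sqrt_pos.2 (by positivity)

lemma one_le_jap (x : ℝ) : 1 ≤ jap x := Real.one_le_sqrt.2 (by nlinarith [sq_nonneg x])

lemma abs_le_jap (x : ℝ) : |x| ≤ jap x := Real.abs_le_sqrt (by linarith)

lemma jap_le_one_add_abs (x : ℝ) : jap x ≤ 1 + |x| :=
  Real.sqrt_le_iff.2 ⟨by positivity, by nlinarith [abs_nonneg x, sq_abs x]⟩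

lemma jap_neg (x : ℝ) : jap (-x) = jap x := by simp [jap]

lemma jap_le_jap {x y : ℝ} (h : |x| ≤ |y|) : jap x ≤ jap y :=
  Real.sqrt_le_sqrt (by nlinarith [sq_abs x, sq_abs y, abs_nonneg x])

lemma continuous_jap : Continuous jap := by unfold jap; fun_prop

@[fun_prop]
lemma measurable_jap : Measurable jap := continuous_jap.measurable

/-- The weight `⟨t⟩^{-p}`. -/
def jp (p t : ℝ) : ℝ≥0∞ := ENNReal.ofReal (jap t ^ (-p))

lemma jp_neg (p t : ℝ) : jp p (-t) = jp p t := by rw [jp, jp, jap_neg]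

@[fun_prop]
lemma measurable_jp (p : ℝ) : Measurable (jp p) := by unfold jp; fun_prop

/-- `∫ ⟨t⟩^{-p} dt`. -/
def jpInt (p : ℝ) : ℝ≥0∞ := ∫⁻ t, jp p t

lemma jpInt_lt_top {p : ℝ} (hp : 1 < p) : jpInt p < ⊤ := by
  have h := integrable_rpow_neg_one_add_norm_sq (E := ℝ) (μ := volume) (r := p) (by simpa using hp)
  have h2 := h.lintegral_lt_top
  refine lt_of_le_of_lt (le_of_eq ?_) h2
  refine lintegral_congr fun t => ?_
  rw [jp, jap, Real.sqrt_eq_rpow, ← Real.rpow_mul (by positivity)]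
  simp only [Real.norm_eq_abs, sq_abs]
  congr 2; ring

lemma lintegral_jp_affine (p c : ℝ) {s : ℝ} (hs : s = 1 ∨ s = -1) :
    ∫⁻ t, jp p (c + s * t) = jpInt p := by
  rcases hs with rfl | rfl
  · simp only [one_mul]
    exact lintegral_add_left_eq_self (jp p) c
  · simp only [neg_one_mul, ← sub_eq_add_neg]
    exact lintegral_sub_left_eq_self (jp p) c

lemma lintegral_ph (f : Ph → ℝ≥0∞) (hf : Measurable f) :
    ∫⁻ z, f z = ∫⁻ w : Space, ∫⁻ τ : ℝ, f (τ, w) :=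
  lintegral_prod_symm _ hf.aemeasurable

/-- The time integral of the product of two cone weights. -/
def coneWeight (p t s s' : ℝ) (q : ℝ × ℝ) : ℝ≥0∞ :=
  ∫⁻ τ, jp p (-τ + s * q.1) * jp p (-(t - τ) + s' * q.2)

@[fun_prop]
lemma measurable_coneWeight (p t s s' : ℝ) : Measurable (coneWeight p t s s') :=
  Measurable.lintegral_prod_right' (f := fun q : (ℝ × ℝ) × ℝ =>
    jp p (-q.2 + s * q.1.1) * jp p (-(t - q.2) + s' * q.1.2)) (by fun_prop)

lemma lintegral_coneWeight_le {p t s s' : ℝ} (hs' : s' = 1 ∨ s' = -1) (r : ℝ) (a : ℝ≥0∞) :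
    ∫⁻ σ in Set.Ioi (0:ℝ), a * coneWeight p t s s' (r, σ) ≤ a * jpInt p ^ 2 := by
  rw [lintegral_const_mul _ (by fun_prop)]
  gcongr
  unfold coneWeight
  calc _ ≤ ∫⁻ σ, ∫⁻ τ, jp p (-τ + s * r) * jp p (-(t - τ) + s' * σ) := setLIntegral_le_lintegral _ _
    _ = ∫⁻ τ, ∫⁻ σ, jp p (-τ + s * r) * jp p (-(t - τ) + s' * σ) :=
        lintegral_lintegral_swap (by fun_prop)
    _ = ∫⁻ τ, jp p (s * r + (-1) * τ) * jpInt p := by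
        refine lintegral_congr fun τ => ?_
        rw [lintegral_const_mul _ (by fun_prop), lintegral_jp_affine p _ hs']
        congr 2; ring
    _ = _ := by
        rw [lintegral_mul_const _ (by fun_prop), lintegral_jp_affine p _ (Or.inr rfl), sq]

/-- Convolution of two thickened cones, with a radial weight, in the range `|w| ≤ 4|x|`. -/
lemma lintegral_conv_radial {p t s s' : ℝ} (hs' : s' = 1 ∨ s' = -1) {x : Space} (hx : x ≠ 0)
    {Φ : ℝ → ℝ≥0∞} (hΦ : Measurable Φ) (hsupp : ∀ r, 4 * ‖x‖ < r → Φ r = 0) :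
    ∫⁻ z : Ph, Φ ‖z.2‖ * (jp p (-z.1 + s * ‖z.2‖) * jp p (-(t - z.1) + s' * ‖x - z.2‖)) ≤
      ENNReal.ofReal (10 * Real.pi) * jpInt p ^ 2 *
        ∫⁻ r in Set.Ioi (0:ℝ), ENNReal.ofReal r * Φ r := by
  have hX : 0 < ‖x‖ := norm_pos_iff.2 hx
  set X := ‖x‖ with hXd
  set W := coneWeight p t s s' with hW
  have hWm : Measurable W := measurable_coneWeight p t s s'
  set F : ℝ × ℝ → ℝ≥0∞ := fun q => (Set.Iic (5 * X)).indicator 1 q.2 * (Φ q.1 * W q) with hF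
  have hone : Measurable ((Set.Iic (5 * X)).indicator (1 : ℝ → ℝ≥0∞)) :=
    measurable_one.indicator measurableSet_Iic
  have hFm : Measurable F := by
    simp only [hF]; fun_prop
  have e1 : ∫⁻ z : Ph, Φ ‖z.2‖ * (jp p (-z.1 + s * ‖z.2‖) * jp p (-(t - z.1) + s' * ‖x - z.2‖))
      ≤ ∫⁻ w : Space, F (‖w‖, ‖x - w‖) := by
    rw [lintegral_ph _ (by fun_prop)]
    refine lintegral_mono fun w => ?_
    simp only
    rw [lintegral_const_mul _ (by fun_prop)]
    by_cases hw : ‖w‖ ≤ 4 * X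
    · have : ‖x - w‖ ∈ Set.Iic (5 * X) := by
        have := norm_sub_le x w
        simp only [Set.mem_Iic]; linarith
      simp only [hF, Set.indicator_of_mem this, Pi.one_apply, one_mul]
      exact le_rfl
    · rw [hsupp _ (not_le.1 hw)]; simp
  have e2 := lintegral_bipolar_le hx hFm
  have e3 : ∫⁻ r in Set.Ioi (0:ℝ), ∫⁻ σ in Set.Ioi (0:ℝ), ENNReal.ofReal (r * σ) * F (r, σ) ≤
      ENNReal.ofReal (5 * X) * jpInt p ^ 2 * ∫⁻ r in Set.Ioi (0:ℝ), ENNReal.ofReal r * Φ r := by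
    rw [← lintegral_const_mul _ (by fun_prop)]
    refine setLIntegral_mono' measurableSet_Ioi fun r hr => ?_
    calc _ ≤ ∫⁻ σ in Set.Ioi (0:ℝ), (ENNReal.ofReal r * ENNReal.ofReal (5 * X) * Φ r) * W (r, σ) := by
          refine setLIntegral_mono' measurableSet_Ioi fun σ hσ => ?_
          by_cases h : σ ∈ Set.Iic (5 * X)
          · simp only [hF, Set.indicator_of_mem h, Pi.one_apply, one_mul]
            rw [ENNReal.ofReal_mul (le_of_lt hr), ← mul_assoc]
            gcongr
            exact h
          · simp [hF, Set.indicator_of_notMem h]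
      _ ≤ (ENNReal.ofReal r * ENNReal.ofReal (5 * X) * Φ r) * jpInt p ^ 2 := by
          exact lintegral_coneWeight_le hs' r _
      _ = _ := by ring
  have e4 : ENNReal.ofReal X * ∫⁻ w : Space, F (‖w‖, ‖x - w‖) ≤ ENNReal.ofReal X *
      (ENNReal.ofReal (10 * Real.pi) * jpInt p ^ 2 *
        ∫⁻ r in Set.Ioi (0:ℝ), ENNReal.ofReal r * Φ r) := by
    refine e2.trans ?_
    calc _ ≤ ENNReal.ofReal (2 * Real.pi) * (ENNReal.ofReal (5 * X) * jpInt p ^ 2 *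
          ∫⁻ r in Set.Ioi (0:ℝ), ENNReal.ofReal r * Φ r) := by gcongr
      _ = _ := by
        rw [show 10 * Real.pi = 2 * Real.pi * 5 by ring, ENNReal.ofReal_mul (p := 2 * Real.pi)
          (by positivity), ENNReal.ofReal_mul (p := 5) (by norm_num)]
        ring
  refine e1.trans ?_
  exact (ENNReal.mul_le_mul_iff_right (by simpa using hX) ENNReal.ofReal_ne_top).1 e4

/-- Convolution of two thickened cones restricted to a slab, with the area weight. -/
lemma lintegral_conv_slab {p t s s' : ℝ} (hs' : s' = 1 ∨ s' = -1) {x e : Space} (hx : x ≠ 0)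
    (he : ‖e‖ = 1) (hex : inner ℝ e x = 0) {d : ℝ} (hd : 0 ≤ d) {G : ℝ × ℝ → ℝ≥0∞}
    (hG : Measurable G) {H : ℝ → ℝ≥0∞} (hH : Measurable H)
    (hGH : ∀ r σ, 0 < r → 0 < σ → ENNReal.ofReal (r * σ) * G (r, σ) ≤ H r) :
    ∫⁻ z : Ph, {w : Space | |inner ℝ e w| ≤ d}.indicator 1 z.2 *
      (ENNReal.ofReal √(‖z.2‖ ^ 2 * ‖x‖ ^ 2 - inner ℝ z.2 x ^ 2) * G (‖z.2‖, ‖x - z.2‖) *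
      (jp p (-z.1 + s * ‖z.2‖) * jp p (-(t - z.1) + s' * ‖x - z.2‖))) ≤
      ENNReal.ofReal (16 * d) * jpInt p ^ 2 * ∫⁻ r in Set.Ioi (0:ℝ), H r := by
  set W := coneWeight p t s s' with hW
  have hWm : Measurable W := measurable_coneWeight p t s s'
  set F : ℝ × ℝ → ℝ≥0∞ := fun q => G q * W q with hF
  have hFm : Measurable F := by simp only [hF]; fun_prop
  have hS : MeasurableSet {w : Space | |inner ℝ e w| ≤ d} :=
    measurableSet_le (by fun_prop) measurable_const
  have hone : Measurable ({w : Space | |inner ℝ e w| ≤ d}.indicator (1 : Space → ℝ≥0∞)) :=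
    measurable_one.indicator hS
  have e1 : ∫⁻ z : Ph, {w : Space | |inner ℝ e w| ≤ d}.indicator 1 z.2 *
      (ENNReal.ofReal √(‖z.2‖ ^ 2 * ‖x‖ ^ 2 - inner ℝ z.2 x ^ 2) * G (‖z.2‖, ‖x - z.2‖) *
      (jp p (-z.1 + s * ‖z.2‖) * jp p (-(t - z.1) + s' * ‖x - z.2‖)))
      = ∫⁻ w : Space in {w | |inner ℝ e w| ≤ d},
        ENNReal.ofReal √(‖w‖ ^ 2 * ‖x‖ ^ 2 - inner ℝ w x ^ 2) * F (‖w‖, ‖x - w‖) := by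
    rw [lintegral_ph _ (by fun_prop), ← lintegral_indicator hS]
    refine lintegral_congr fun w => ?_
    simp only
    rw [lintegral_const_mul _ (by fun_prop), lintegral_const_mul _ (by fun_prop)]
    by_cases hw : w ∈ {w : Space | |inner ℝ e w| ≤ d}
    · rw [Set.indicator_of_mem hw, Set.indicator_of_mem hw]
      simp only [Pi.one_apply, one_mul, hF, hW, mul_assoc]
      rfl
    · rw [Set.indicator_of_notMem hw, Set.indicator_of_notMem hw, zero_mul]
  rw [e1]
  refine (lintegral_bipolar_slab_le hx he hex hd hFm).trans ?_
  rw [mul_assoc]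
  gcongr
  rw [← lintegral_const_mul _ hH]
  refine setLIntegral_mono' measurableSet_Ioi fun r hr => ?_
  calc _ ≤ ∫⁻ σ in Set.Ioi (0:ℝ), H r * W (r, σ) := by
        refine setLIntegral_mono' measurableSet_Ioi fun σ hσ => ?_
        simp only [hF]
        rw [← mul_assoc]
        gcongr
        exact hGH r σ hr hσ
    _ ≤ H r * jpInt p ^ 2 := by
        exact lintegral_coneWeight_le hs' r _
    _ = _ := mul_comm _ _

/-! ## Domination of kernels on regions -/

/-- On the region `E`, the kernel `k` is dominated by a kernel whose trilinear form is bounded. -/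
def Dominated (k : Ph → Ph → ℝ) (E : Ph → Ph → Prop) (C : ℝ≥0∞) : Prop :=
  ∃ M : Ph → Ph → ℝ≥0∞, Measurable (Function.uncurry M) ∧ TriBdd M C ∧
    ∀ a b, E a b → ENNReal.ofReal (k a b) ≤ M a b

namespace Dominated

variable {k k' : Ph → Ph → ℝ} {E E' : Ph → Ph → Prop} {C C' : ℝ≥0∞}

lemma mono (h : Dominated k E C) (hk : ∀ a b, E' a b → E a b ∧ k' a b ≤ k a b) (hC : C ≤ C') :
    Dominated k' E' C' := by
  obtain ⟨M, hM, hT, hkM⟩ := h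
  refine ⟨M, hM, hT.mono (fun _ _ => le_rfl) hC, fun a b hab => ?_⟩
  exact (ENNReal.ofReal_le_ofReal (hk a b hab).2).trans (hkM a b (hk a b hab).1)

lemma union (h : Dominated k E C) (h' : Dominated k E' C') :
    Dominated k (fun a b => E a b ∨ E' a b) (2 * (C + C')) := by
  obtain ⟨M, hM, hT, hkM⟩ := h
  obtain ⟨M', hM', hT', hkM'⟩ := h'
  have m1 : Measurable fun p : Ph × Ph => M p.1 p.2 := hM
  have m2 : Measurable fun p : Ph × Ph => M' p.1 p.2 := hM'
  refine ⟨fun a b => M a b + M' a b, ?_, hT.add hM hT', fun a b hab => ?_⟩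
  · show Measurable fun p : Ph × Ph => M p.1 p.2 + M' p.1 p.2
    fun_prop
  · rcases hab with hab | hab
    · exact (hkM a b hab).trans le_self_add
    · exact (hkM' a b hab).trans le_add_self

lemma swap (h : Dominated (fun a b => k b a) (fun a b => E b a) C) : Dominated k E C := by
  obtain ⟨M, hM, hT, hkM⟩ := h
  have m1 : Measurable (Function.uncurry fun a b => M b a) := hM.comp measurable_swap
  refine ⟨fun a b => M b a, m1, TriBdd.swap m1 hT, fun a b hab => hkM b a hab⟩

lemma of_tsum {kn : ℕ → Ph → Ph → ℝ} {En : ℕ → Ph → Ph → Prop} {ω : ℕ → Ph → ℝ}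
    {D : ℝ≥0∞} (hω : ∀ n, Measurable (ω n)) (hω0 : ∀ n a, 0 ≤ ω n a)
    (h : ∀ n, Dominated (kn n) (En n) C)
    (hsum : ∀ a, ∑' n, ENNReal.ofReal (ω n a) ^ 2 ≤ D)
    (hk : ∀ a b, E a b → ∃ n, En n a b ∧ k a b ≤ ω n a * ω n b * kn n a b) :
    Dominated k E (C * D ^ 2) := by
  choose M hM hT hkM using h
  have m1 : ∀ n, Measurable fun p : Ph × Ph => M n p.1 p.2 := hM
  refine ⟨fun a b => ∑' n, ENNReal.ofReal (ω n a) * ENNReal.ofReal (ω n b) * M n a b, ?_,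
    TriBdd.of_weighted_tsum hM (fun n => by fun_prop) hT hsum, fun a b hab => ?_⟩
  · show Measurable fun p : Ph × Ph =>
      ∑' n, ENNReal.ofReal (ω n p.1) * ENNReal.ofReal (ω n p.2) * M n p.1 p.2
    fun_prop
  · obtain ⟨n, hn, hle⟩ := hk a b hab
    refine le_trans ?_ (ENNReal.le_tsum n)
    rw [← ENNReal.ofReal_mul (hω0 n a)]
    refine (ENNReal.ofReal_le_ofReal hle).trans ?_
    rw [ENNReal.ofReal_mul (mul_nonneg (hω0 n a) (hω0 n b))]
    gcongr
    exact hkM n a b hn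

end Dominated

lemma ofReal_le_of_sq_le {x : ℝ} {y : ℝ≥0∞} (h : ENNReal.ofReal (x ^ 2) ≤ y) :
    ENNReal.ofReal x ≤ y ^ ((1:ℝ) / 2) := by
  rcases le_total x 0 with hx | hx
  · rw [ENNReal.ofReal_of_nonpos hx]; exact zero_le
  · have := ENNReal.rpow_le_rpow h (z := (1:ℝ)/2) (by norm_num)
    rwa [ENNReal.ofReal_pow hx, ← ENNReal.rpow_natCast, ← ENNReal.rpow_mul,
      show ((2:ℕ):ℝ) * (1/2) = 1 by norm_num, ENNReal.rpow_one] at this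

lemma sqrt_ennreal_sq (x : ℝ≥0∞) : (x ^ ((1:ℝ) / 2)) ^ 2 = x := by
  rw [← ENNReal.rpow_natCast, ← ENNReal.rpow_mul]; norm_num

namespace Dominated

variable {k : Ph → Ph → ℝ} {E : Ph → Ph → Prop} {M : ℝ≥0∞} {N : Ph → Ph → ℝ≥0∞}

lemma of_sum (hN : Measurable fun p : Ph × Ph => N p.1 p.2)
    (h : ∀ c, ∫⁻ a, N a (c - a) ≤ M)
    (hk : ∀ a b, E a b → ENNReal.ofReal (k a b ^ 2) ≤ N a b) : Dominated k E M := by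
  have m : Measurable (Function.uncurry fun a b => N a b ^ ((1:ℝ) / 2)) := by
    show Measurable fun p : Ph × Ph => N p.1 p.2 ^ ((1:ℝ) / 2)
    fun_prop
  refine ⟨fun a b => N a b ^ ((1:ℝ) / 2), m, TriBdd.of_sum m fun c => ?_,
    fun a b hab => ofReal_le_of_sq_le (hk a b hab)⟩
  simp only [sqrt_ennreal_sq]
  exact h c

lemma of_left (hN : Measurable fun p : Ph × Ph => N p.1 p.2)
    (h : ∀ a, ∫⁻ b, N a b ≤ M)
    (hk : ∀ a b, E a b → ENNReal.ofReal (k a b ^ 2) ≤ N a b) : Dominated k E M := by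
  have m : Measurable (Function.uncurry fun a b => N a b ^ ((1:ℝ) / 2)) := by
    show Measurable fun p : Ph × Ph => N p.1 p.2 ^ ((1:ℝ) / 2)
    fun_prop
  refine ⟨fun a b => N a b ^ ((1:ℝ) / 2), m, TriBdd.of_left m fun c => ?_,
    fun a b hab => ofReal_le_of_sq_le (hk a b hab)⟩
  simp only [sqrt_ennreal_sq]
  exact h c

variable {T : Set (Ph × Ph)}

lemma of_tt_sum (hN : Measurable fun p : Ph × Ph => N p.1 p.2) (hT : MeasurableSet T)
    (h : ∀ c b', ∫⁻ a, T.indicator 1 (a, c - a) * N a (c - a) * T.indicator 1 (a, b') ≤ M)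
    (hk : ∀ a b, E a b → (a, b) ∈ T ∧ ENNReal.ofReal (k a b ^ 2) ≤ N a b) :
    Dominated k E M := by
  have m1 : Measurable (T.indicator (1 : Ph × Ph → ℝ≥0∞)) := measurable_one.indicator hT
  have m : Measurable (Function.uncurry fun a b => T.indicator 1 (a, b) * N a b ^ ((1:ℝ) / 2)) := by
    show Measurable fun p : Ph × Ph => T.indicator 1 (p.1, p.2) * N p.1 p.2 ^ ((1:ℝ) / 2)
    fun_prop
  have hsq : ∀ q, (T.indicator (1 : Ph × Ph → ℝ≥0∞) q) ^ 2 = T.indicator 1 q := fun q => by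
    by_cases hq : q ∈ T <;> simp [hq]
  refine ⟨fun a b => T.indicator 1 (a, b) * N a b ^ ((1:ℝ) / 2), m,
    TriBdd.of_tt_sum (S := fun a b => T.indicator 1 (a, b)) m m1 (fun a b => ?_) fun c b' => ?_,
    fun a b hab => ?_⟩
  · by_cases hq : (a, b) ∈ T <;> simp [hq]
  · simp only [mul_pow, sqrt_ennreal_sq, hsq]
    exact h c b'
  · simp only [Set.indicator_of_mem (hk a b hab).1, Pi.one_apply, one_mul]
    exact ofReal_le_of_sq_le (hk a b hab).2

lemma of_tt_left (hN : Measurable fun p : Ph × Ph => N p.1 p.2) (hT : MeasurableSet T)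
    (h : ∀ a b', ∫⁻ c, T.indicator 1 (a, c - a) * N a (c - a) * T.indicator 1 (c - b', b') ≤ M)
    (hk : ∀ a b, E a b → (a, b) ∈ T ∧ ENNReal.ofReal (k a b ^ 2) ≤ N a b) :
    Dominated k E M := by
  have m1 : Measurable (T.indicator (1 : Ph × Ph → ℝ≥0∞)) := measurable_one.indicator hT
  have m : Measurable (Function.uncurry fun a b => T.indicator 1 (a, b) * N a b ^ ((1:ℝ) / 2)) := by
    show Measurable fun p : Ph × Ph => T.indicator 1 (p.1, p.2) * N p.1 p.2 ^ ((1:ℝ) / 2)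
    fun_prop
  have hsq : ∀ q, (T.indicator (1 : Ph × Ph → ℝ≥0∞) q) ^ 2 = T.indicator 1 q := fun q => by
    by_cases hq : q ∈ T <;> simp [hq]
  refine ⟨fun a b => T.indicator 1 (a, b) * N a b ^ ((1:ℝ) / 2), m,
    TriBdd.of_tt_left (S := fun a b => T.indicator 1 (a, b)) m m1 (fun a b => ?_) fun c b' => ?_,
    fun a b hab => ?_⟩
  · by_cases hq : (a, b) ∈ T <;> simp [hq]
  · simp only [mul_pow, sqrt_ennreal_sq, hsq]
    exact h c b'
  · simp only [Set.indicator_of_mem (hk a b hab).1, Pi.one_apply, one_mul]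
    exact ofReal_le_of_sq_le (hk a b hab).2

/-- Configurations with a vanishing frequency are negligible. -/
lemma of_zero (hE : ∀ a b, E a b → a.2 = 0 ∨ b.2 = 0 ∨ a.2 + b.2 = 0) : Dominated k E 0 := by
  have ms : MeasurableSet {p : Ph × Ph | p.1.2 = 0 ∨ p.2.2 = 0 ∨ p.1.2 + p.2.2 = 0} := by
    refine (measurableSet_eq_fun (by fun_prop) (by fun_prop)).union
      ((measurableSet_eq_fun (by fun_prop) (by fun_prop)).union
      (measurableSet_eq_fun (by fun_prop) (by fun_prop)))
  have hnull : ∀ v : Space, ∀ᵐ a : Ph, a.2 ≠ v := fun v => by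
    have h1 : ∀ᵐ w : Space, w ≠ v := by simp [ae_iff]
    exact Measure.quasiMeasurePreserving_snd.ae h1
  set M : Ph → Ph → ℝ≥0∞ := fun a b =>
    {p : Ph × Ph | p.1.2 = 0 ∨ p.2.2 = 0 ∨ p.1.2 + p.2.2 = 0}.indicator (fun _ => ⊤) (a, b) with hM
  refine ⟨M, measurable_const.indicator ms, ?_, fun a b hab => ?_⟩
  · intro f₀ f₁ f₂ _ _ _
    have : triForm M f₀ f₁ f₂ = 0 := by
      unfold triForm
      rw [← lintegral_zero (α := Ph) (μ := volume)]
      refine lintegral_congr_ae ?_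
      filter_upwards [hnull 0] with a ha
      show _ = (0 : ℝ≥0∞)
      rw [← lintegral_zero (α := Ph) (μ := volume)]
      refine lintegral_congr_ae ?_
      filter_upwards [hnull 0, hnull (-a.2)] with b hb hb'
      have : (a, b) ∉ {p : Ph × Ph | p.1.2 = 0 ∨ p.2.2 = 0 ∨ p.1.2 + p.2.2 = 0} := by
        rintro (h | h | h)
        · exact ha h
        · exact hb h
        · exact hb' (eq_neg_of_add_eq_zero_right h)
      simp only [hM, Set.indicator_of_notMem this, zero_mul]
    rw [this]; simp
  · have : (a, b) ∈ {p : Ph × Ph | p.1.2 = 0 ∨ p.2.2 = 0 ∨ p.1.2 + p.2.2 = 0} := hE a b hab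
    simp only [hM, Set.indicator_of_mem this]
    exact le_top

end Dominated

/-- `∫_0^∞ r ⟨r⟩^{-2-δ} dr`. -/
def radialMass (δ : ℝ) : ℝ≥0∞ := ∫⁻ r in Set.Ioi (0:ℝ), ENNReal.ofReal r * jp (2 + δ) r

/-- `∫_{ℝ³} ⟨w⟩^{-3-δ} dw`. -/
def spaceMass (δ : ℝ) : ℝ≥0∞ := ∫⁻ w : Space, jp (3 + δ) ‖w‖

lemma jap_rpow (r x : ℝ) : jap x ^ r = (1 + x ^ 2) ^ (r / 2) := by
  rw [jap, Real.sqrt_eq_rpow, ← Real.rpow_mul (by positivity)]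
  congr 1; ring

lemma spaceMass_lt_top {δ : ℝ} (hδ : 0 < δ) : spaceMass δ < ⊤ := by
  have h := integrable_rpow_neg_one_add_norm_sq (E := Space) (μ := volume) (r := 3 + δ)
    (by simpa using hδ)
  refine lt_of_le_of_lt (le_of_eq ?_) h.lintegral_lt_top
  refine lintegral_congr fun t => ?_
  rw [jp, jap_rpow]

lemma radialMass_lt_top {δ : ℝ} (hδ : 0 < δ) : radialMass δ < ⊤ := by
  refine lt_of_le_of_lt ?_ (jpInt_lt_top (p := 1 + δ) (by linarith))
  refine (setLIntegral_le_lintegral _ _).trans (lintegral_mono fun r => ?_)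
  rw [jp, jp, show -(1 + δ) = 1 + -(2 + δ) by ring, Real.rpow_add (jap_pos r), Real.rpow_one,
    ENNReal.ofReal_mul (jap_pos r).le]
  gcongr
  exact (le_abs_self r).trans (abs_le_jap r)

namespace Dominated

variable {k : Ph → Ph → ℝ} {E : Ph → Ph → Prop}

/-- Two thickened cones, with a weight depending on `|ξ₁| ≤ 4|ξ₀|` and `|ξ₀|`. -/
lemma of_radial {p s s' : ℝ} (hs' : s' = 1 ∨ s' = -1) {φ : ℝ → ℝ → ℝ}
    (hφ : Measurable fun q : ℝ × ℝ => φ q.1 q.2) (hφ0 : ∀ x r, 0 ≤ φ x r) {A : ℝ≥0∞}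
    (hA : ∀ x, 0 < x → ∫⁻ r in Set.Ioc 0 (4 * x), ENNReal.ofReal (r * φ x r) ≤ A)
    (hk : ∀ a b, E a b → a.2 + b.2 ≠ 0 ∧ ‖a.2‖ ≤ 4 * ‖a.2 + b.2‖ ∧
      k a b ^ 2 ≤ φ ‖a.2 + b.2‖ ‖a.2‖ *
        (jap (-a.1 + s * ‖a.2‖) ^ (-p) * jap (-b.1 + s' * ‖b.2‖) ^ (-p))) :
    Dominated k E (ENNReal.ofReal (10 * Real.pi) * jpInt p ^ 2 * A) := by
  set U : Set (ℝ × ℝ) := {q | 0 < q.1 ∧ q.2 ≤ 4 * q.1} with hU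
  have hUm : MeasurableSet U := by
    show MeasurableSet ({q : ℝ × ℝ | 0 < q.1} ∩ {q | q.2 ≤ 4 * q.1})
    exact (measurableSet_lt (by fun_prop) (by fun_prop)).inter
      (measurableSet_le (by fun_prop) (by fun_prop))
  set Φ : ℝ × ℝ → ℝ≥0∞ := U.indicator fun q => ENNReal.ofReal (φ q.1 q.2) with hΦ
  have hΦm : Measurable Φ := Measurable.indicator (by fun_prop) hUm
  refine of_sum (N := fun a b => Φ (‖a.2 + b.2‖, ‖a.2‖) *
    (jp p (-a.1 + s * ‖a.2‖) * jp p (-b.1 + s' * ‖b.2‖))) (by fun_prop) (fun c => ?_)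
    fun a b hab => ?_
  · rcases eq_or_ne c.2 0 with hc | hc
    · refine le_trans (le_of_eq ?_) zero_le
      rw [← lintegral_zero (α := Ph) (μ := volume)]
      refine lintegral_congr fun a => ?_
      have : (‖a.2 + (c - a).2‖, ‖a.2‖) ∉ U := by simp [hU, hc]
      simp only [hΦ, Set.indicator_of_notMem this, zero_mul]
    · have hΦc : Measurable fun r => Φ (‖c.2‖, r) := hΦm.comp (by fun_prop)
      have := lintegral_conv_radial (p := p) (t := c.1) (s := s) hs' hc (Φ := fun r => Φ (‖c.2‖, r))
        hΦc (fun r hr => by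
          have : (‖c.2‖, r) ∉ U := fun h => absurd h.2 (not_le.2 hr)
          simp only [hΦ, Set.indicator_of_notMem this])
      simp only [add_sub_cancel, Prod.snd_sub, Prod.fst_sub]
      refine this.trans ?_
      gcongr
      refine le_trans ?_ (hA ‖c.2‖ (norm_pos_iff.2 hc))
      rw [← lintegral_indicator measurableSet_Ioi, ← lintegral_indicator measurableSet_Ioc]
      refine lintegral_mono fun r => ?_
      by_cases hr : r ∈ Set.Ioi (0:ℝ)
      · by_cases hr2 : r ≤ 4 * ‖c.2‖
        · have h1 : r ∈ Set.Ioc 0 (4 * ‖c.2‖) := ⟨hr, hr2⟩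
          have h2 : (‖c.2‖, r) ∈ U := ⟨norm_pos_iff.2 hc, hr2⟩
          rw [Set.indicator_of_mem hr, Set.indicator_of_mem h1]
          simp only [hΦ, Set.indicator_of_mem h2]
          rw [ENNReal.ofReal_mul (le_of_lt hr)]
        · have h2 : (‖c.2‖, r) ∉ U := fun h => hr2 h.2
          rw [Set.indicator_of_mem hr]
          simp only [hΦ, Set.indicator_of_notMem h2, mul_zero]
          exact zero_le
      · rw [Set.indicator_of_notMem hr]
        exact zero_le
  · obtain ⟨h0, h1, h2⟩ := hk a b hab
    have hU' : (‖a.2 + b.2‖, ‖a.2‖) ∈ U := ⟨norm_pos_iff.2 h0, h1⟩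
    simp only [hΦ, Set.indicator_of_mem hU', jp]
    rw [← ENNReal.ofReal_mul (Real.rpow_nonneg (jap_pos _).le _), ← ENNReal.ofReal_mul (hφ0 _ _)]
    exact ENNReal.ofReal_le_ofReal h2

/-- The constant in `Dominated.of_low_right` and `Dominated.of_low_sum`. -/
def lowConst (p δ A : ℝ) : ℝ≥0∞ :=
  ENNReal.ofReal A * (2 * (ENNReal.ofReal (10 * Real.pi) * jpInt p ^ 2 * radialMass δ) +
    jpInt p * spaceMass δ)

lemma lowConst_lt_top {p δ A : ℝ} (hp : 1 < p) (hδ : 0 < δ) : lowConst p δ A < ⊤ := by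
  have h1 := jpInt_lt_top hp
  have h2 := radialMass_lt_top hδ
  have h3 := spaceMass_lt_top hδ
  unfold lowConst
  exact ENNReal.mul_lt_top ENNReal.ofReal_lt_top (ENNReal.add_lt_top.2
    ⟨ENNReal.mul_lt_top (by norm_num) (ENNReal.mul_lt_top (ENNReal.mul_lt_top
      ENNReal.ofReal_lt_top (ENNReal.pow_lt_top h1)) h2), ENNReal.mul_lt_top h1 h3⟩)

lemma truncated_radial_le {x : Space} (hx : x ≠ 0) {p t s s' δ : ℝ} (hs' : s' = 1 ∨ s' = -1) :
    ∫⁻ z : Ph, (Set.Iic (4 * ‖x‖)).indicator (jp (2 + δ)) ‖z.2‖ *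
      (jp p (-z.1 + s * ‖z.2‖) * jp p (-(t - z.1) + s' * ‖x - z.2‖)) ≤
      ENNReal.ofReal (10 * Real.pi) * jpInt p ^ 2 * radialMass δ := by
  refine (lintegral_conv_radial hs' hx ((measurable_jp _).indicator measurableSet_Iic)
    fun r hr => Set.indicator_of_notMem (by simpa using hr) _).trans ?_
  unfold radialMass
  gcongr with r
  exact Set.indicator_le_self _ _ _

lemma lintegral_space_mass (p δ s t : ℝ) (x : Space) :
    ∫⁻ z : Ph, jp (3 + δ) ‖z.2‖ * jp p (-(z.1 - t) + s * ‖x - z.2‖) =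
      jpInt p * spaceMass δ := by
  rw [lintegral_ph _ (by fun_prop), spaceMass, ← lintegral_const_mul _ (by fun_prop)]
  refine lintegral_congr fun w => ?_
  simp only
  rw [lintegral_const_mul _ (by fun_prop), mul_comm]
  congr 1
  rw [← lintegral_jp_affine p (t + s * ‖x - w‖) (Or.inr rfl)]
  refine lintegral_congr fun τ => ?_
  congr 1; ring

lemma measurableSet_low :
    MeasurableSet {q : Space × Space | q.1 ≠ 0 ∧ ‖q.2‖ ≤ 4 * ‖q.1‖} := by
  show MeasurableSet ({q : Space × Space | q.1 = 0}ᶜ ∩ {q | ‖q.2‖ ≤ 4 * ‖q.1‖})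
  exact (measurableSet_eq_fun (by fun_prop) (by fun_prop)).compl.inter
    (measurableSet_le (by fun_prop) (by fun_prop))

/-- A thickened cone and the output cone, with `ξ₂` the low frequency. -/
lemma of_low_right {p s δ A : ℝ} (hA : 0 ≤ A)
    (hk : ∀ a b, E a b → a.2 ≠ 0 ∧ ‖b.2‖ ≤ 4 * ‖a.2‖ ∧
      k a b ^ 2 ≤ A * (jap ‖b.2‖ ^ (-(2 + δ)) * (jap (-b.1 + s * ‖b.2‖) ^ (-p) *
          jap (-(a.1 + b.1) + 1 * ‖a.2 + b.2‖) ^ (-p)) +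
        jap ‖b.2‖ ^ (-(2 + δ)) * (jap (-b.1 + s * ‖b.2‖) ^ (-p) *
          jap (-(a.1 + b.1) + (-1) * ‖a.2 + b.2‖) ^ (-p)) +
        jap ‖b.2‖ ^ (-(3 + δ)) * jap (-b.1 + s * ‖b.2‖) ^ (-p))) :
    Dominated k E (lowConst p δ A) := by
  set U : Set (Space × Space) := {q | q.1 ≠ 0 ∧ ‖q.2‖ ≤ 4 * ‖q.1‖} with hU
  have hUm : MeasurableSet U := measurableSet_low
  have hone : Measurable (U.indicator (1 : Space × Space → ℝ≥0∞)) := measurable_one.indicator hUm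
  have key : ∀ (s0 : ℝ), (s0 = 1 ∨ s0 = -1) → ∀ a : Ph,
      ∫⁻ b : Ph, U.indicator 1 (a.2, b.2) * (jp (2 + δ) ‖b.2‖ * (jp p (-b.1 + s * ‖b.2‖) *
        jp p (-(a.1 + b.1) + s0 * ‖a.2 + b.2‖))) ≤
      ENNReal.ofReal (10 * Real.pi) * jpInt p ^ 2 * radialMass δ := by
    intro s0 hs0 a
    rcases eq_or_ne a.2 0 with ha | ha
    · refine le_trans (le_of_eq ?_) zero_le
      rw [← lintegral_zero (α := Ph) (μ := volume)]
      refine lintegral_congr fun b => ?_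
      have : (a.2, b.2) ∉ U := fun h => h.1 ha
      simp only [Set.indicator_of_notMem this, zero_mul]
    · refine le_trans (le_of_eq (lintegral_congr fun b => ?_)) (truncated_radial_le (x := -a.2)
        (neg_ne_zero.2 ha) (t := -a.1) (s := s) (s' := -s0) (by rcases hs0 with rfl | rfl <;> simp))
      have e1 : jp p (-(a.1 + b.1) + s0 * ‖a.2 + b.2‖) =
          jp p (-(-a.1 - b.1) + -s0 * ‖-a.2 - b.2‖) := by
        rw [← jp_neg, show -a.2 - b.2 = -(a.2 + b.2) by abel, norm_neg]; congr 1; ring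
      rw [e1, norm_neg]
      by_cases hb : ‖b.2‖ ≤ 4 * ‖a.2‖
      · have : (a.2, b.2) ∈ U := ⟨ha, hb⟩
        rw [Set.indicator_of_mem this, Set.indicator_of_mem (by exact hb)]
        simp
      · have : (a.2, b.2) ∉ U := fun h => hb h.2
        rw [Set.indicator_of_notMem this, Set.indicator_of_notMem (by exact hb)]
        simp
  refine of_left (N := fun a b => ENNReal.ofReal A * (
      U.indicator 1 (a.2, b.2) * (jp (2 + δ) ‖b.2‖ * (jp p (-b.1 + s * ‖b.2‖) *
        jp p (-(a.1 + b.1) + 1 * ‖a.2 + b.2‖))) +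
      U.indicator 1 (a.2, b.2) * (jp (2 + δ) ‖b.2‖ * (jp p (-b.1 + s * ‖b.2‖) *
        jp p (-(a.1 + b.1) + (-1) * ‖a.2 + b.2‖))) +
      jp (3 + δ) ‖b.2‖ * jp p (-b.1 + s * ‖b.2‖)))
    (by fun_prop) (fun a => ?_) fun a b hab => ?_
  · rw [lintegral_const_mul _ (by fun_prop), lintegral_add_left (by fun_prop),
      lintegral_add_left (by fun_prop), lowConst, two_mul]
    refine mul_le_mul' le_rfl (add_le_add (add_le_add ?_ ?_) ?_)
    · exact key 1 (Or.inl rfl) a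
    · exact key (-1) (Or.inr rfl) a
    · refine le_of_eq ?_
      rw [← lintegral_space_mass p δ s 0 0]
      refine lintegral_congr fun b => ?_
      simp
  · obtain ⟨h0, h1, h2⟩ := hk a b hab
    have hU' : (a.2, b.2) ∈ U := ⟨h0, h1⟩
    have J0 : ∀ x q : ℝ, 0 ≤ jap x ^ q := fun x q => Real.rpow_nonneg (jap_pos _).le _
    refine (ENNReal.ofReal_le_ofReal h2).trans (le_of_eq ?_)
    have j1 := J0 ‖b.2‖ (-(2 + δ))
    have j2 := J0 (-b.1 + s * ‖b.2‖) (-p)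
    have j3 := J0 (-(a.1 + b.1) + 1 * ‖a.2 + b.2‖) (-p)
    have j4 := J0 (-(a.1 + b.1) + (-1) * ‖a.2 + b.2‖) (-p)
    have j5 := J0 ‖b.2‖ (-(3 + δ))
    simp only [Set.indicator_of_mem hU', jp, Pi.one_apply, one_mul]
    rw [one_mul] at j3
    rw [ENNReal.ofReal_mul hA, ENNReal.ofReal_add, ENNReal.ofReal_add,
      ENNReal.ofReal_mul j1, ENNReal.ofReal_mul j1, ENNReal.ofReal_mul j2, ENNReal.ofReal_mul j2,
      ENNReal.ofReal_mul j5]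
    all_goals positivity

/-- A thickened cone and the output cone, with `ξ₀` the low frequency. -/
lemma of_low_sum {p s δ A : ℝ} (hs : s = 1 ∨ s = -1) (hA : 0 ≤ A)
    (hk : ∀ a b, E a b → a.2 ≠ 0 ∧ ‖a.2 + b.2‖ ≤ 4 * ‖a.2‖ ∧
      k a b ^ 2 ≤ A * (jap ‖a.2 + b.2‖ ^ (-(2 + δ)) * (jap (-(a.1 + b.1) + 1 * ‖a.2 + b.2‖) ^ (-p) *
          jap (-b.1 + s * ‖b.2‖) ^ (-p)) +
        jap ‖a.2 + b.2‖ ^ (-(2 + δ)) * (jap (-(a.1 + b.1) + (-1) * ‖a.2 + b.2‖) ^ (-p) *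
          jap (-b.1 + s * ‖b.2‖) ^ (-p)) +
        jap ‖a.2 + b.2‖ ^ (-(3 + δ)) * jap (-b.1 + s * ‖b.2‖) ^ (-p))) :
    Dominated k E (lowConst p δ A) := by
  set U : Set (Space × Space) := {q | q.1 ≠ 0 ∧ ‖q.2‖ ≤ 4 * ‖q.1‖} with hU
  have hUm : MeasurableSet U := measurableSet_low
  have hone : Measurable (U.indicator (1 : Space × Space → ℝ≥0∞)) := measurable_one.indicator hUm
  have e0 : ∀ a b : Ph, jp p (-b.1 + s * ‖b.2‖) =
      jp p (-(a.1 - (a + b).1) + -s * ‖a.2 - (a + b).2‖) := fun a b => by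
    rw [← jp_neg, show a.2 - (a + b).2 = -b.2 by simp, norm_neg]
    congr 1; simp only [Prod.fst_add]; ring
  have key : ∀ (s0 : ℝ), ∀ a : Ph,
      ∫⁻ b : Ph, U.indicator 1 (a.2, a.2 + b.2) * (jp (2 + δ) ‖a.2 + b.2‖ *
        (jp p (-(a.1 + b.1) + s0 * ‖a.2 + b.2‖) * jp p (-b.1 + s * ‖b.2‖))) ≤
      ENNReal.ofReal (10 * Real.pi) * jpInt p ^ 2 * radialMass δ := by
    intro s0 a
    rcases eq_or_ne a.2 0 with ha | ha
    · refine le_trans (le_of_eq ?_) zero_le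
      rw [← lintegral_zero (α := Ph) (μ := volume)]
      refine lintegral_congr fun b => ?_
      have : (a.2, a.2 + b.2) ∉ U := fun h => h.1 ha
      simp only [Set.indicator_of_notMem this, zero_mul]
    · refine le_trans (le_of_eq ?_) (truncated_radial_le (x := a.2)
        ha (t := a.1) (s := s0) (s' := -s) (by rcases hs with rfl | rfl <;> simp))
      refine Eq.trans ?_ (lintegral_add_left_eq_self _ a)
      refine lintegral_congr fun b => ?_
      rw [e0 a b]
      by_cases hb : ‖a.2 + b.2‖ ≤ 4 * ‖a.2‖
      · have : (a.2, a.2 + b.2) ∈ U := ⟨ha, hb⟩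
        rw [Set.indicator_of_mem this, Set.indicator_of_mem (by exact hb)]
        simp
      · have : (a.2, a.2 + b.2) ∉ U := fun h => hb h.2
        rw [Set.indicator_of_notMem this, Set.indicator_of_notMem (by exact hb)]
        simp
  refine of_left (N := fun a b => ENNReal.ofReal A * (
      U.indicator 1 (a.2, a.2 + b.2) * (jp (2 + δ) ‖a.2 + b.2‖ *
        (jp p (-(a.1 + b.1) + 1 * ‖a.2 + b.2‖) * jp p (-b.1 + s * ‖b.2‖))) +
      U.indicator 1 (a.2, a.2 + b.2) * (jp (2 + δ) ‖a.2 + b.2‖ *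
        (jp p (-(a.1 + b.1) + (-1) * ‖a.2 + b.2‖) * jp p (-b.1 + s * ‖b.2‖))) +
      jp (3 + δ) ‖a.2 + b.2‖ * jp p (-b.1 + s * ‖b.2‖)))
    (by fun_prop) (fun a => ?_) fun a b hab => ?_
  · rw [lintegral_const_mul _ (by fun_prop), lintegral_add_left (by fun_prop),
      lintegral_add_left (by fun_prop), lowConst, two_mul]
    refine mul_le_mul' le_rfl (add_le_add (add_le_add ?_ ?_) ?_)
    · exact key 1 a
    · exact key (-1) a
    · refine le_of_eq ?_
      rw [← lintegral_space_mass p δ s a.1 a.2]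
      refine Eq.trans ?_ (lintegral_add_left_eq_self _ a)
      refine lintegral_congr fun b => ?_
      rw [show a.2 - (a + b).2 = -b.2 by simp, norm_neg]
      simp
  · obtain ⟨h0, h1, h2⟩ := hk a b hab
    have hU' : (a.2, a.2 + b.2) ∈ U := ⟨h0, h1⟩
    have J0 : ∀ x q : ℝ, 0 ≤ jap x ^ q := fun x q => Real.rpow_nonneg (jap_pos _).le _
    refine (ENNReal.ofReal_le_ofReal h2).trans (le_of_eq ?_)
    have j1 := J0 ‖a.2 + b.2‖ (-(2 + δ))
    have j2 := J0 (-b.1 + s * ‖b.2‖) (-p)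
    have j3 := J0 (-(a.1 + b.1) + 1 * ‖a.2 + b.2‖) (-p)
    have j4 := J0 (-(a.1 + b.1) + (-1) * ‖a.2 + b.2‖) (-p)
    have j5 := J0 ‖a.2 + b.2‖ (-(3 + δ))
    simp only [Set.indicator_of_mem hU', jp, Pi.one_apply, one_mul]
    rw [one_mul] at j3
    rw [ENNReal.ofReal_mul hA, ENNReal.ofReal_add, ENNReal.ofReal_add,
      ENNReal.ofReal_mul j1, ENNReal.ofReal_mul j1, ENNReal.ofReal_mul j3, ENNReal.ofReal_mul j4,
      ENNReal.ofReal_mul j5]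
    all_goals positivity

end Dominated

/-! ## Parallelogram areas and slab estimates -/

/-- The area of the parallelogram spanned by two vectors. -/
def par (w y : Space) : ℝ := √(‖w‖ ^ 2 * ‖y‖ ^ 2 - inner ℝ w y ^ 2)

lemma measurableSet_par_window (A : ℝ) : MeasurableSet {q : Ph × Ph |
    A * (‖q.1.2‖ * ‖q.2.2‖) < par q.1.2 q.2.2 ∧ par q.1.2 q.2.2 ≤ 2 * A * (‖q.1.2‖ * ‖q.2.2‖)} := by
  have hp : Measurable fun q : Ph × Ph => par q.1.2 q.2.2 := by unfold par; fun_prop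
  have h1 : Measurable fun q : Ph × Ph => A * (‖q.1.2‖ * ‖q.2.2‖) := by fun_prop
  have h2 : Measurable fun q : Ph × Ph => 2 * A * (‖q.1.2‖ * ‖q.2.2‖) := by fun_prop
  exact (measurableSet_lt h1 hp).inter (measurableSet_le hp h2)

lemma par_comm (w y : Space) : par w y = par y w := by
  rw [par, par, real_inner_comm, mul_comm]

lemma par_add_right (w v : Space) : par w (w + v) = par w v := by
  unfold par
  rw [norm_add_sq_real, inner_add_right, real_inner_self_eq_norm_sq]
  congr 1; ring

lemma par_sub_left (w x : Space) : par w (x - w) = par w x := by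
  rw [← par_add_right w (x - w)]; simp

lemma par_zero_left (y : Space) : par 0 y = 0 := by simp [par]

lemma abs_inner_mul_norm_le_par {e y : Space} (he : ‖e‖ = 1) (hey : inner ℝ e y = 0) (w : Space) :
    |inner ℝ e w| * ‖y‖ ≤ par w y := by
  rcases eq_or_ne y 0 with rfl | hy
  · simp [par]
  obtain ⟨B, hB, hB2⟩ := exists_frame hy he hey
  refine Real.le_sqrt_of_sq_le ?_
  have h1 := frame_norm_sq B w
  have h2 : inner ℝ w y = ‖y‖ * inner ℝ (B 0) w := by
    conv_lhs => rw [hB, inner_smul_right, real_inner_comm]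
  rw [hB2] at h1
  rw [h2, mul_pow, sq_abs, h1]
  nlinarith [mul_nonneg (sq_nonneg (inner ℝ (B 1) w)) (sq_nonneg ‖y‖)]

lemma lintegral_window_le (y n : ℝ) (c : ℝ≥0∞) :
    ∫⁻ r in Set.Ioi (0:ℝ), {r : ℝ | |r - y| ≤ 2 * n}.indicator (fun _ => c) r ≤
      ENNReal.ofReal (4 * n) * c := by
  have e : {r : ℝ | |r - y| ≤ 2 * n} = Set.Icc (y - 2 * n) (y + 2 * n) := by
    ext r
    simp only [Set.mem_ofPred_eq, Set.mem_Icc, abs_le]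
    constructor <;> rintro ⟨h1, h2⟩ <;> constructor <;> linarith
  refine (setLIntegral_le_lintegral _ _).trans ?_
  rw [e, lintegral_indicator_const measurableSet_Icc, Real.volume_Icc, mul_comm]
  refine le_of_eq ?_
  congr 2; ring

namespace Dominated

variable {k : Ph → Ph → ℝ} {E : Ph → Ph → Prop}

/-- Low output frequency, inputs at a fixed dyadic angle. -/
lemma of_slab_sum {p s s' n A B : ℝ} (hs' : s' = 1 ∨ s' = -1) (hn : 0 < n) (hA : 0 < A)
    (hB : 0 ≤ B)
    (hk : ∀ a b, E a b → (a.2 + b.2 ≠ 0 ∧ ‖a.2 + b.2‖ ≤ 2 * n ∧ 4 * ‖a.2 + b.2‖ ≤ ‖b.2‖ ∧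
      A * (‖a.2‖ * ‖b.2‖) < par a.2 b.2 ∧ par a.2 b.2 ≤ 2 * A * (‖a.2‖ * ‖b.2‖)) ∧
      k a b ^ 2 ≤ B * (n * ‖a.2‖)⁻¹ *
        (jap (-a.1 + s * ‖a.2‖) ^ (-p) * jap (-b.1 + s' * ‖b.2‖) ^ (-p))) :
    Dominated k E (ENNReal.ofReal (214 * B) * jpInt p ^ 2) := by
  set T : Set (Ph × Ph) := {q | q.1.2 + q.2.2 ≠ 0 ∧ ‖q.1.2 + q.2.2‖ ≤ 2 * n ∧
    4 * ‖q.1.2 + q.2.2‖ ≤ ‖q.2.2‖ ∧ A * (‖q.1.2‖ * ‖q.2.2‖) < par q.1.2 q.2.2 ∧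
    par q.1.2 q.2.2 ≤ 2 * A * (‖q.1.2‖ * ‖q.2.2‖)} with hT
  have hTm : MeasurableSet T := by
    have h1 : Measurable fun q : Ph × Ph => q.1.2 + q.2.2 := by fun_prop
    have h2 : Measurable fun q : Ph × Ph => ‖q.2.2‖ := by fun_prop
    exact (h1 (measurableSet_singleton 0)).compl.inter
      ((measurableSet_le h1.norm measurable_const).inter
      ((measurableSet_le (h1.norm.const_mul 4) h2).inter (measurableSet_par_window A)))
  refine of_tt_sum (T := T) (N := fun a b => ENNReal.ofReal (B * (n * ‖a.2‖)⁻¹) *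
    (jp p (-a.1 + s * ‖a.2‖) * jp p (-b.1 + s' * ‖b.2‖))) (by fun_prop) hTm (fun c b' => ?_)
    fun a b hab => ⟨(hk a b hab).1, ?_⟩
  swap
  · simp only [jp]
    rw [← ENNReal.ofReal_mul (Real.rpow_nonneg (jap_pos _).le _), ← ENNReal.ofReal_mul (by positivity)]
    exact ENNReal.ofReal_le_ofReal (hk a b hab).2
  set x := c.2 with hx
  set y := b'.2 with hy
  by_cases hxy : x ≠ 0 ∧ y ≠ 0
  swap
  · refine le_trans (le_of_eq ?_) zero_le
    rw [← lintegral_zero (α := Ph) (μ := volume)]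
    refine lintegral_congr fun a => ?_
    rcases not_and_or.1 hxy with h | h
    · have : (a, c - a) ∉ T := fun hq => h (by simpa using hq.1)
      simp only [Set.indicator_of_notMem this, zero_mul]
    · have : (a, b') ∉ T := fun hq => by
        have h0 : b'.2 = 0 := not_not.1 h
        have h1 : ‖a.2 + b'.2‖ ≠ 0 := norm_ne_zero_iff.2 hq.1
        have h2 : 4 * ‖a.2 + b'.2‖ ≤ ‖b'.2‖ := hq.2.2.1
        have h3 : ‖b'.2‖ = 0 := by rw [h0, norm_zero]
        have h4 := norm_nonneg (a.2 + b'.2)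
        exact h1 (by linarith)
      simp only [Set.indicator_of_notMem this, mul_zero]
  obtain ⟨hx0, hy0⟩ := hxy
  have hyn : 0 < ‖y‖ := norm_pos_iff.2 hy0
  obtain ⟨e, he, hex, hey⟩ := exists_unit_orthogonal_pair x y
  set V : Set (ℝ × ℝ) := {q | |q.1 - ‖y‖| ≤ 2 * n ∧ 3 * ‖y‖ ≤ 4 * q.1} with hV
  have hVm : MeasurableSet V := by
    show MeasurableSet ({q : ℝ × ℝ | |q.1 - ‖y‖| ≤ 2 * n} ∩ {q | 3 * ‖y‖ ≤ 4 * q.1})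
    exact (measurableSet_le (by fun_prop) (by fun_prop)).inter
      (measurableSet_le (by fun_prop) (by fun_prop))
  set G : ℝ × ℝ → ℝ≥0∞ := V.indicator fun q =>
    ENNReal.ofReal (B * (n * q.1)⁻¹ * (A * (q.1 * q.2))⁻¹) with hG
  have hGm : Measurable G := Measurable.indicator (by fun_prop) hVm
  set H : ℝ → ℝ≥0∞ := {r : ℝ | |r - ‖y‖| ≤ 2 * n}.indicator
    (fun _ => ENNReal.ofReal (4 * B / (3 * A * n * ‖y‖))) with hH
  have hHm : Measurable H := measurable_const.indicator (measurableSet_le (by fun_prop) (by fun_prop))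
  have hGH : ∀ r σ, 0 < r → 0 < σ → ENNReal.ofReal (r * σ) * G (r, σ) ≤ H r := by
    intro r σ hr hσ
    by_cases hq : (r, σ) ∈ V
    · have h1 : r ∈ {r : ℝ | |r - ‖y‖| ≤ 2 * n} := hq.1
      have h2 : 3 * ‖y‖ ≤ 4 * r := hq.2
      simp only [hG, hH, Set.indicator_of_mem hq, Set.indicator_of_mem h1]
      rw [← ENNReal.ofReal_mul (by positivity)]
      refine ENNReal.ofReal_le_ofReal ?_
      rw [show r * σ * (B * (n * r)⁻¹ * (A * (r * σ))⁻¹) = B / (A * n * r) by field_simp,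
        div_le_div_iff₀ (by positivity) (by positivity)]
      have : 0 ≤ B * A * n := by positivity
      nlinarith
    · simp only [hG, Set.indicator_of_notMem hq, mul_zero]; exact zero_le
  have key := lintegral_conv_slab (p := p) (t := c.1) (s := s) (s' := s') (d := 5 / 2 * A * ‖y‖) hs'
    hx0 he hex (by positivity) hGm hHm hGH
  have hmain : ∫⁻ a : Ph, T.indicator 1 (a, c - a) * (ENNReal.ofReal (B * (n * ‖a.2‖)⁻¹) *
      (jp p (-a.1 + s * ‖a.2‖) * jp p (-(c - a).1 + s' * ‖(c - a).2‖))) * T.indicator 1 (a, b') ≤ _ :=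
    (lintegral_mono fun a => ?_).trans key
  · refine hmain.trans ?_
    calc _ ≤ ENNReal.ofReal (16 * (5 / 2 * A * ‖y‖)) * jpInt p ^ 2 *
          (ENNReal.ofReal (4 * n) * ENNReal.ofReal (4 * B / (3 * A * n * ‖y‖))) := by
          gcongr
          exact lintegral_window_le _ _ _
      _ = ENNReal.ofReal (640 / 3 * B) * jpInt p ^ 2 := by
          rw [mul_right_comm, ← ENNReal.ofReal_mul (by positivity), ← ENNReal.ofReal_mul (by positivity)]
          congr 2; field_simp; ring
      _ ≤ _ := by
          gcongr
          norm_num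
  · by_cases h1 : (a, c - a) ∈ T
    swap
    · simp only [Set.indicator_of_notMem h1, zero_mul]; exact zero_le
    by_cases h2 : (a, b') ∈ T
    swap
    · simp only [Set.indicator_of_notMem h2, mul_zero]; exact zero_le
    have t4 := h1.2.2.2.1
    have u2 := h2.2.1
    have u3 := h2.2.2.1
    have u5 := h2.2.2.2.2
    simp only [Prod.snd_sub] at t4
    have n1 : ‖y‖ - ‖a.2‖ ≤ ‖a.2 + y‖ := by
      have := norm_sub_norm_le y (-a.2); rwa [norm_neg, sub_neg_eq_add, add_comm y] at this
    have n2 : ‖a.2‖ - ‖y‖ ≤ ‖a.2 + y‖ := by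
      have := norm_sub_norm_le a.2 (-y); rwa [norm_neg, sub_neg_eq_add] at this
    have hV' : (‖a.2‖, ‖x - a.2‖) ∈ V := by
      refine ⟨abs_le.2 ⟨?_, ?_⟩, ?_⟩ <;> simp only <;> linarith
    have hsl : a.2 ∈ {w : Space | |inner ℝ e w| ≤ 5 / 2 * A * ‖y‖} := by
      have h5 := abs_inner_mul_norm_le_par he hey a.2
      have : |inner ℝ e a.2| * ‖y‖ ≤ (2 * A * ‖a.2‖) * ‖y‖ := by
        refine h5.trans (u5.trans (le_of_eq (by ring)))
      have h6 := le_of_mul_le_mul_right this hyn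
      show |inner ℝ e a.2| ≤ _
      nlinarith
    have hpar : par a.2 (x - a.2) = par a.2 x := par_sub_left _ _
    have hpos : 0 < A * (‖a.2‖ * ‖x - a.2‖) := by
      have h3 : 0 ≤ ‖a.2‖ * ‖x - a.2‖ := by positivity
      rcases h3.eq_or_lt with h3 | h3
      · have h4 : ‖a.2‖ = 0 ∨ ‖x - a.2‖ = 0 := by simpa [mul_eq_zero] using h3.symm
        rcases h4 with h4 | h4
        · rw [norm_eq_zero.1 h4, par_zero_left, norm_zero] at t4; simp at t4
        · rw [norm_eq_zero.1 h4, par_comm, par_zero_left, norm_zero] at t4; simp at t4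
      · positivity
    simp only [Set.indicator_of_mem h1, Set.indicator_of_mem h2, Set.indicator_of_mem hsl, hG,
      Set.indicator_of_mem hV', Pi.one_apply, one_mul, mul_one, Prod.fst_sub, Prod.snd_sub]
    gcongr
    rw [← ENNReal.ofReal_mul (Real.sqrt_nonneg _)]
    refine ENNReal.ofReal_le_ofReal ?_
    have hle : A * (‖a.2‖ * ‖x - a.2‖) ≤ par a.2 x := by rw [← hpar]; exact t4.le
    have h7 : 1 ≤ par a.2 x * (A * (‖a.2‖ * ‖x - a.2‖))⁻¹ := by
      rw [← div_eq_mul_inv, one_le_div hpos]; exact hle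
    have h8 : 0 ≤ B * (n * ‖a.2‖)⁻¹ := by positivity
    calc B * (n * ‖a.2‖)⁻¹ ≤ B * (n * ‖a.2‖)⁻¹ * (par a.2 x * (A * (‖a.2‖ * ‖x - a.2‖))⁻¹) :=
          le_mul_of_one_le_right h8 h7
      _ = _ := by rw [par]; ring

/-- Low first input, second input and output at a fixed dyadic angle from it. -/
lemma of_slab_left {p s s0 n A B : ℝ} (hs : s = 1 ∨ s = -1) (hn : 0 < n) (hA : 0 < A)
    (hB : 0 ≤ B)
    (hk : ∀ a b, E a b → (n ≤ ‖a.2‖ ∧ ‖a.2‖ ≤ 2 * n ∧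
      A * (‖a.2‖ * ‖b.2‖) < par a.2 b.2 ∧ par a.2 b.2 ≤ 2 * A * (‖a.2‖ * ‖b.2‖)) ∧
      k a b ^ 2 ≤ B * (n * ‖a.2 + b.2‖)⁻¹ *
        (jap (-(a.1 + b.1) + s0 * ‖a.2 + b.2‖) ^ (-p) * jap (-b.1 + s * ‖b.2‖) ^ (-p))) :
    Dominated k E (ENNReal.ofReal (256 * B) * jpInt p ^ 2) := by
  set T : Set (Ph × Ph) := {q | n ≤ ‖q.1.2‖ ∧ ‖q.1.2‖ ≤ 2 * n ∧
    A * (‖q.1.2‖ * ‖q.2.2‖) < par q.1.2 q.2.2 ∧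
    par q.1.2 q.2.2 ≤ 2 * A * (‖q.1.2‖ * ‖q.2.2‖)} with hT
  have hTm : MeasurableSet T := by
    have h1 : Measurable fun q : Ph × Ph => ‖q.1.2‖ := by fun_prop
    exact (measurableSet_le measurable_const h1).inter
      ((measurableSet_le h1 measurable_const).inter (measurableSet_par_window A))
  refine of_tt_left (T := T) (N := fun a b => ENNReal.ofReal (B * (n * ‖a.2 + b.2‖)⁻¹) *
    (jp p (-(a.1 + b.1) + s0 * ‖a.2 + b.2‖) * jp p (-b.1 + s * ‖b.2‖))) (by fun_prop) hTm
    (fun a b' => ?_) fun a b hab => ⟨(hk a b hab).1, ?_⟩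
  swap
  · simp only [jp]
    rw [← ENNReal.ofReal_mul (Real.rpow_nonneg (jap_pos _).le _), ← ENNReal.ofReal_mul (by positivity)]
    exact ENNReal.ofReal_le_ofReal (hk a b hab).2
  set x := a.2 with hx
  set y := b'.2 with hy
  by_cases hxy : n ≤ ‖x‖ ∧ y ≠ 0
  swap
  · refine le_trans (le_of_eq ?_) zero_le
    rw [← lintegral_zero (α := Ph) (μ := volume)]
    refine lintegral_congr fun c => ?_
    rcases not_and_or.1 hxy with h | h
    · have : (a, c - a) ∉ T := fun hq => h hq.1
      simp only [Set.indicator_of_notMem this, zero_mul]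
    · have : (c - b', b') ∉ T := fun hq => by
        have h0 : b'.2 = 0 := not_not.1 h
        have h2 := hq.2.2.1
        simp only [h0, par_comm _ (0 : Space), par_zero_left, norm_zero, mul_zero, lt_irrefl] at h2
      simp only [Set.indicator_of_notMem this, mul_zero]
  obtain ⟨hxn, hy0⟩ := hxy
  have hx0 : x ≠ 0 := norm_pos_iff.1 (hn.trans_le hxn)
  have hxp : 0 < ‖x‖ := norm_pos_iff.2 hx0
  have hyn : 0 < ‖y‖ := norm_pos_iff.2 hy0
  obtain ⟨e, he, hex, hey⟩ := exists_unit_orthogonal_pair x y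
  set V : Set (ℝ × ℝ) := {q | |q.1 - ‖y‖| ≤ 2 * n} with hV
  have hVm : MeasurableSet V := measurableSet_le (by fun_prop) (by fun_prop)
  set G : ℝ × ℝ → ℝ≥0∞ := V.indicator fun q =>
    ENNReal.ofReal (B * (n * q.1)⁻¹ * (A * (‖x‖ * q.2))⁻¹) with hG
  have hGm : Measurable G := Measurable.indicator (by fun_prop) hVm
  set H : ℝ → ℝ≥0∞ := {r : ℝ | |r - ‖y‖| ≤ 2 * n}.indicator
    (fun _ => ENNReal.ofReal (B / (A * n * n))) with hH
  have hHm : Measurable H := measurable_const.indicator (measurableSet_le (by fun_prop) (by fun_prop))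
  have hGH : ∀ r σ, 0 < r → 0 < σ → ENNReal.ofReal (r * σ) * G (r, σ) ≤ H r := by
    intro r σ hr hσ
    by_cases hq : (r, σ) ∈ V
    · have h1 : r ∈ {r : ℝ | |r - ‖y‖| ≤ 2 * n} := hq
      simp only [hG, hH, Set.indicator_of_mem hq, Set.indicator_of_mem h1]
      rw [← ENNReal.ofReal_mul (by positivity)]
      refine ENNReal.ofReal_le_ofReal ?_
      rw [show r * σ * (B * (n * r)⁻¹ * (A * (‖x‖ * σ))⁻¹) = B / (A * ‖x‖ * n) by field_simp,
        div_le_div_iff₀ (by positivity) (by positivity)]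
      have : 0 ≤ B * A * n := by positivity
      nlinarith
    · simp only [hG, Set.indicator_of_notMem hq, mul_zero]; exact zero_le
  have key := lintegral_conv_slab (p := p) (t := a.1) (s := s0) (s' := -s) (d := 4 * n * A)
    (by rcases hs with rfl | rfl <;> simp) hx0 he hex (by positivity) hGm hHm hGH
  have hmain : ∫⁻ c : Ph, T.indicator 1 (a, c - a) * (ENNReal.ofReal (B * (n * ‖x + (c - a).2‖)⁻¹) *
      (jp p (-(a.1 + (c - a).1) + s0 * ‖x + (c - a).2‖) * jp p (-(c - a).1 + s * ‖(c - a).2‖))) *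
      T.indicator 1 (c - b', b') ≤ _ :=
    (lintegral_mono fun c => ?_).trans key
  · refine hmain.trans ?_
    calc _ ≤ ENNReal.ofReal (16 * (4 * n * A)) * jpInt p ^ 2 *
          (ENNReal.ofReal (4 * n) * ENNReal.ofReal (B / (A * n * n))) := by
          gcongr
          exact lintegral_window_le _ _ _
      _ = ENNReal.ofReal (256 * B) * jpInt p ^ 2 := by
          rw [mul_right_comm, ← ENNReal.ofReal_mul (by positivity), ← ENNReal.ofReal_mul (by positivity)]
          congr 2; field_simp; ring
  · by_cases h1 : (a, c - a) ∈ T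
    swap
    · simp only [Set.indicator_of_notMem h1, zero_mul]; exact zero_le
    by_cases h2 : (c - b', b') ∈ T
    swap
    · simp only [Set.indicator_of_notMem h2, mul_zero]; exact zero_le
    have t4 := h1.2.2.1
    have u2 := h2.2.1
    have u5 := h2.2.2.2
    simp only [Prod.snd_sub] at t4 u2 u5
    have n1 : ‖y‖ - ‖c.2‖ ≤ ‖c.2 - y‖ := by
      have := norm_sub_norm_le y c.2; rwa [norm_sub_rev] at this
    have n2 : ‖c.2‖ - ‖y‖ ≤ ‖c.2 - y‖ := norm_sub_norm_le _ _
    have hV' : (‖c.2‖, ‖x - c.2‖) ∈ V := by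
      show |‖c.2‖ - ‖y‖| ≤ 2 * n
      refine abs_le.2 ⟨?_, ?_⟩ <;> linarith
    have hpy : par (c.2 - y) y = par c.2 y := by
      rw [par_comm, par_sub_left, par_comm]
    have hsl : c.2 ∈ {w : Space | |inner ℝ e w| ≤ 4 * n * A} := by
      have h5 := abs_inner_mul_norm_le_par he hey c.2
      have : |inner ℝ e c.2| * ‖y‖ ≤ (2 * A * ‖c.2 - y‖) * ‖y‖ := by
        refine h5.trans ?_
        rw [← hpy]
        exact u5.trans (le_of_eq (by ring))
      have h6 := le_of_mul_le_mul_right this hyn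
      show |inner ℝ e c.2| ≤ _
      nlinarith
    have hpar : par x (c.2 - x) = par c.2 x := by rw [par_sub_left, par_comm]
    have hpos : 0 < A * (‖x‖ * ‖x - c.2‖) := by
      have h3 : 0 ≤ ‖x - c.2‖ := by positivity
      rcases h3.eq_or_lt with h3 | h3
      · have h4 : c.2 - x = 0 := by rw [← neg_sub, norm_eq_zero.1 h3.symm, neg_zero]
        rw [h4, par_comm, par_zero_left, norm_zero] at t4; simp at t4
      · positivity
    simp only [Set.indicator_of_mem h1, Set.indicator_of_mem h2, Set.indicator_of_mem hsl, hG,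
      Set.indicator_of_mem hV', Pi.one_apply, one_mul, mul_one, Prod.fst_sub, Prod.snd_sub]
    have e1 : x + (c.2 - a.2) = c.2 := by rw [hx]; abel
    have e2 : a.1 + (c.1 - a.1) = c.1 := by ring
    have e3 : jp p (-(c.1 - a.1) + s * ‖c.2 - a.2‖) = jp p (-(a.1 - c.1) + -s * ‖x - c.2‖) := by
      rw [← jp_neg, norm_sub_rev]; congr 1; rw [hx]; ring
    rw [e1, e2, e3]
    gcongr
    rw [← ENNReal.ofReal_mul (Real.sqrt_nonneg _)]
    refine ENNReal.ofReal_le_ofReal ?_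
    have hle : A * (‖x‖ * ‖x - c.2‖) ≤ par c.2 x := by
      rw [← hpar, norm_sub_rev]; exact t4.le
    have h7 : 1 ≤ par c.2 x * (A * (‖x‖ * ‖x - c.2‖))⁻¹ := by
      rw [← div_eq_mul_inv, one_le_div hpos]; exact hle
    have h8 : 0 ≤ B * (n * ‖c.2‖)⁻¹ := by positivity
    calc B * (n * ‖c.2‖)⁻¹ ≤ B * (n * ‖c.2‖)⁻¹ * (par c.2 x * (A * (‖x‖ * ‖x - c.2‖))⁻¹) :=
          le_mul_of_one_le_right h8 h7
      _ = _ := by rw [par]; ring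

end Dominated

/-! ## Nearly parallel inputs -/

lemma norm_expanding {e v : Space} {q : ℝ} (hv : q * ‖v‖ ≤ inner ℝ e v) {t : ℝ} (ht : 0 ≤ t) :
    q * t ≤ ‖v + t • e‖ - ‖v‖ ∨ v = 0 := by
  rcases eq_or_ne v 0 with h | h
  · exact Or.inr h
  left
  have hp : 0 < ‖v‖ := norm_pos_iff.2 h
  have h1 : inner ℝ (v + t • e) v ≤ ‖v + t • e‖ * ‖v‖ := real_inner_le_norm _ _
  rw [inner_add_left, real_inner_self_eq_norm_sq, inner_smul_left] at h1
  simp only [conj_trivial] at h1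
  have h2 := mul_le_mul_of_nonneg_left hv ht
  refine le_of_mul_le_mul_right ?_ hp
  nlinarith

lemma norm_add_smul_sub {e v : Space} (he : ‖e‖ = 1) {q : ℝ} (hq : q ≤ 1)
    (hv : q * ‖v‖ ≤ inner ℝ e v) {t : ℝ} (ht : 0 ≤ t) : q * t ≤ ‖v + t • e‖ - ‖v‖ := by
  rcases norm_expanding hv ht with h | rfl
  · exact h
  · rw [zero_add, norm_smul, he, norm_zero, mul_one, sub_zero, Real.norm_of_nonneg ht]
    nlinarith

/-- The directions that open at most moderately wide from `e`, seen from `0` and from `x`. -/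
def tubeCone (e x : Space) : Set Space :=
  {w | 9 / 10 * ‖w‖ ≤ inner ℝ e w ∧ 1 / 10 * ‖w - x‖ ≤ inner ℝ e (w - x)}

lemma measurableSet_tubeCone (e x : Space) : MeasurableSet (tubeCone e x) := by
  have h1 : Measurable fun w : Space => 9 / 10 * ‖w‖ := by fun_prop
  have h2 : Measurable fun w : Space => inner ℝ e w := by fun_prop
  have h3 : Measurable fun w : Space => 1 / 10 * ‖w - x‖ := by fun_prop
  have h4 : Measurable fun w : Space => inner ℝ e (w - x) := by fun_prop
  exact (measurableSet_le h1 h2).inter (measurableSet_le h3 h4)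

lemma lintegral_line_tubeCone_le {e : Space} (he : ‖e‖ = 1) (x v : Space) {κ : ℝ → ℝ≥0∞}
    (hκ : Measurable κ) : ∫⁻ c : ℝ, (tubeCone e x).indicator 1 (v + c • e) *
      κ (‖v + c • e‖ + ‖v + c • e - x‖) ≤ ∫⁻ u, κ u := by
  have hm : Measurable fun c : ℝ => v + c • e := by fun_prop
  have hS : MeasurableSet {c : ℝ | v + c • e ∈ tubeCone e x} := hm (measurableSet_tubeCone e x)
  refine le_trans (le_of_eq ?_) (lintegral_comp_expanding_le hS
    (φ := fun c : ℝ => ‖v + c • e‖ + ‖v + c • e - x‖) (by fun_prop) ?_ hκ)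
  · rw [← lintegral_indicator hS]
    refine lintegral_congr fun c => ?_
    by_cases h : v + c • e ∈ tubeCone e x
    · rw [Set.indicator_of_mem h, Set.indicator_of_mem (s := {c : ℝ | v + c • e ∈ tubeCone e x}) h,
        Pi.one_apply, one_mul]
    · rw [Set.indicator_of_notMem h,
        Set.indicator_of_notMem (s := {c : ℝ | v + c • e ∈ tubeCone e x}) h, zero_mul]
  · have key : ∀ t ∈ {c : ℝ | v + c • e ∈ tubeCone e x}, ∀ t', t ≤ t' → t' - t ≤
        (‖v + t' • e‖ + ‖v + t' • e - x‖) - (‖v + t • e‖ + ‖v + t • e - x‖) := by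
      intro t ht t' htt
      have e1 : v + t' • e = v + t • e + (t' - t) • e := by rw [sub_smul]; abel
      have h1 := norm_add_smul_sub he (by norm_num) ht.1 (sub_nonneg.2 htt)
      have h2 := norm_add_smul_sub he (by norm_num) ht.2 (sub_nonneg.2 htt)
      have e3 : v + t • e + (t' - t) • e - x = v + t • e - x + (t' - t) • e := by abel
      rw [e1, e3]
      linarith
    intro t ht t' ht'
    rcases le_total t t' with h | h
    · have := key t ht t' h
      rw [abs_sub_comm, abs_sub_comm (_ + _), abs_of_nonneg (sub_nonneg.2 h)]
      exact this.trans (le_abs_self _)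
    · have := key t' ht' t h
      rw [abs_of_nonneg (sub_nonneg.2 h)]
      exact this.trans (le_abs_self _)

lemma lintegral_tube_le (B : OrthonormalBasis (Fin 3) ℝ Space) (x : Space) {d : ℝ}
    {κ : ℝ → ℝ≥0∞} (hκ : Measurable κ) :
    ∫⁻ w : Space, (Set.Icc (-d) d).indicator 1 (inner ℝ (B 0) w) *
      ((Set.Icc (-d) d).indicator 1 (inner ℝ (B 1) w) *
      ((tubeCone (B 2) x).indicator 1 w * κ (‖w‖ + ‖w - x‖))) ≤
      ENNReal.ofReal (2 * d) * (ENNReal.ofReal (2 * d) * ∫⁻ u, κ u) := by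
  have hLw : ∀ w, inner ℝ (B 0) w • B 0 + inner ℝ (B 1) w • B 1 + inner ℝ (B 2) w • B 2 = w :=
    fun w => by
      have := B.sum_repr' w
      rwa [Fin.sum_univ_three] at this
  have hI1 : Measurable ((Set.Icc (-d) d).indicator (1 : ℝ → ℝ≥0∞)) :=
    measurable_one.indicator measurableSet_Icc
  have hR1 : Measurable fun w : Space => (tubeCone (B 2) x).indicator (1 : Space → ℝ≥0∞) w *
      κ (‖w‖ + ‖w - x‖) := by
    have := (measurable_one (α := ℝ≥0∞) (β := Space)).indicator (measurableSet_tubeCone (B 2) x)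
    fun_prop
  have hvol : ∀ A : ℝ≥0∞, ∫⁻ a, (Set.Icc (-d) d).indicator 1 a * A ≤ ENNReal.ofReal (2 * d) * A :=
    fun A => by
      rw [lintegral_mul_const _ hI1, lintegral_indicator_one measurableSet_Icc, Real.volume_Icc,
        sub_neg_eq_add, ← two_mul]
  generalize hP : (fun w : Space => (tubeCone (B 2) x).indicator (1 : Space → ℝ≥0∞) w *
      κ (‖w‖ + ‖w - x‖)) = P at hR1
  have hP' : ∀ w, (tubeCone (B 2) x).indicator (1 : Space → ℝ≥0∞) w * κ (‖w‖ + ‖w - x‖) = P w :=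
    fun w => congrFun hP w
  have hline : ∀ v, ∫⁻ c : ℝ, P (v + c • B 2) ≤ ∫⁻ u, κ u := fun v => by
    simp only [← hP']
    exact lintegral_line_tubeCone_le (B.orthonormal.1 2) x v hκ
  simp only [hP']
  generalize hJ : (Set.Icc (-d) d).indicator (1 : ℝ → ℝ≥0∞) = J at hI1 hvol ⊢
  have hf := lintegral_frame B (H := fun a b c => J a * (J b * P (a • B 0 + b • B 1 + c • B 2)))
    (by fun_prop)
  simp only [hLw] at hf
  rw [hf]
  calc _ ≤ ∫⁻ a, J a * (ENNReal.ofReal (2 * d) * ∫⁻ u, κ u) := by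
        refine lintegral_mono fun a => ?_
        calc _ = ∫⁻ b, J a * (J b * ∫⁻ c, P (a • B 0 + b • B 1 + c • B 2)) := by
              refine lintegral_congr fun b => ?_
              rw [lintegral_const_mul _ (by fun_prop), lintegral_const_mul _ (by fun_prop)]
          _ ≤ ∫⁻ b, J a * (J b * ∫⁻ u, κ u) := by
              exact lintegral_mono fun b => mul_le_mul' le_rfl (mul_le_mul' le_rfl (hline _))
          _ = J a * ∫⁻ b, J b * ∫⁻ u, κ u := lintegral_const_mul _ (by fun_prop)
          _ ≤ _ := by
              gcongr
              exact hvol _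
    _ ≤ _ := hvol _

lemma lintegral_cone_pair_le {p t s : ℝ} (x : Space) {W : Space → ℝ≥0∞}
    (hW : Measurable W) {A : ℝ≥0∞}
    (h : ∀ u, ∫⁻ w, W w * jp p (u + s * (‖w‖ + ‖w - x‖)) ≤ A) :
    ∫⁻ z : Ph, W z.2 *
      (jp p (-z.1 + s * ‖z.2‖) * jp p (-(t - z.1) + s * ‖x - z.2‖)) ≤ jpInt p * A := by
  calc _ = ∫⁻ w : Space, ∫⁻ τ, W w *
        (jp p (-τ + s * ‖w‖) * jp p (-(t - τ) + s * ‖x - w‖)) := lintegral_ph _ (by fun_prop)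
    _ = ∫⁻ w : Space, ∫⁻ u, W w *
        (jp p u * jp p ((u - t) + s * (‖w‖ + ‖w - x‖))) := by
        refine lintegral_congr fun w => ?_
        rw [← lintegral_add_left_eq_self (μ := (volume : Measure ℝ)) _ (s * ‖w‖)]
        refine lintegral_congr fun u => ?_
        rw [← jp_neg p u, norm_sub_rev x w]
        congr 3 <;> ring
    _ = ∫⁻ u, ∫⁻ w : Space, W w *
        (jp p u * jp p ((u - t) + s * (‖w‖ + ‖w - x‖))) := lintegral_lintegral_swap (by fun_prop)
    _ ≤ ∫⁻ u, jp p u * A := by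
        refine lintegral_mono fun u => ?_
        calc _ = jp p u * ∫⁻ w, W w * jp p ((u - t) + s * (‖w‖ + ‖w - x‖)) := by
              rw [← lintegral_const_mul _ (by fun_prop)]
              refine lintegral_congr fun w => ?_
              ring
          _ ≤ _ := by gcongr; exact h _
    _ = _ := by rw [lintegral_mul_const _ (by fun_prop), jpInt]

lemma parallel_of_close {e d w : Space} (he : ‖e‖ = 1) {Y : ℝ} (hY : 0 ≤ Y) (hw : w = Y • e + d)
    (hd : 4 * ‖d‖ ≤ Y) : 9 / 10 * ‖w‖ ≤ inner ℝ e w := by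
  have h1 : |inner ℝ e d| ≤ ‖d‖ := by
    have := abs_real_inner_le_norm e d; rwa [he, one_mul] at this
  have h2 : inner ℝ e w = Y + inner ℝ e d := by
    rw [hw, inner_add_right, inner_smul_right, real_inner_self_eq_norm_sq, he]; ring
  have h3 : ‖w‖ ^ 2 = Y ^ 2 + 2 * Y * inner ℝ e d + ‖d‖ ^ 2 := by
    rw [hw, norm_add_sq_real, norm_smul, he, inner_smul_left, Real.norm_of_nonneg hY]
    simp only [conj_trivial]; ring
  have h4 := abs_le.1 h1
  have h5 : 0 ≤ inner ℝ e w := by rw [h2]; linarith [norm_nonneg d]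
  refine abs_le_of_sq_le_sq' ?_ h5 |>.2
  have h6 : (3 / 4 * Y) ^ 2 ≤ (Y + inner ℝ e d) ^ 2 := by
    apply pow_le_pow_left₀ (by positivity); linarith
  have h7 : (4 * ‖d‖) ^ 2 ≤ Y ^ 2 := pow_le_pow_left₀ (by positivity) hd 2
  rw [mul_pow, h3, h2]
  nlinarith [sq_nonneg (inner ℝ e d), sq_nonneg Y]

namespace Dominated

variable {k : Ph → Ph → ℝ} {E : Ph → Ph → Prop}

/-- Low output frequency, inputs with opposite wave directions. -/
lemma of_parallel_sum {p s n B : ℝ} (hs : s = 1 ∨ s = -1) (hn : 0 < n) (hB : 0 ≤ B)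
    (hk : ∀ a b, E a b → (b.2 ≠ 0 ∧ ‖a.2 + b.2‖ ≤ 2 * n ∧ 4 * ‖a.2 + b.2‖ ≤ ‖a.2‖ ∧
      4 * ‖a.2 + b.2‖ ≤ ‖b.2‖) ∧ k a b ^ 2 ≤ B * (n ^ 2)⁻¹ *
        (jap (-a.1 + s * ‖a.2‖) ^ (-p) * jap (-b.1 + s * ‖b.2‖) ^ (-p))) :
    Dominated k E (ENNReal.ofReal (16 * B) * jpInt p ^ 2) := by
  set T : Set (Ph × Ph) := {q | q.2.2 ≠ 0 ∧ ‖q.1.2 + q.2.2‖ ≤ 2 * n ∧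
    4 * ‖q.1.2 + q.2.2‖ ≤ ‖q.1.2‖ ∧ 4 * ‖q.1.2 + q.2.2‖ ≤ ‖q.2.2‖} with hT
  have hTm : MeasurableSet T := by
    have h1 : Measurable fun q : Ph × Ph => q.1.2 + q.2.2 := by fun_prop
    have h2 : Measurable fun q : Ph × Ph => q.2.2 := by fun_prop
    have h3 : Measurable fun q : Ph × Ph => ‖q.1.2‖ := by fun_prop
    exact (h2 (measurableSet_singleton 0)).compl.inter
      ((measurableSet_le h1.norm measurable_const).inter
      ((measurableSet_le (h1.norm.const_mul 4) h3).inter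
        (measurableSet_le (h1.norm.const_mul 4) h2.norm)))
  refine of_tt_sum (T := T) (N := fun a b => ENNReal.ofReal (B * (n ^ 2)⁻¹) *
    (jp p (-a.1 + s * ‖a.2‖) * jp p (-b.1 + s * ‖b.2‖))) (by fun_prop) hTm (fun c b' => ?_)
    fun a b hab => ⟨(hk a b hab).1, ?_⟩
  swap
  · simp only [jp]
    rw [← ENNReal.ofReal_mul (Real.rpow_nonneg (jap_pos _).le _), ← ENNReal.ofReal_mul (by positivity)]
    exact ENNReal.ofReal_le_ofReal (hk a b hab).2
  set x := c.2 with hx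
  set y := b'.2 with hy
  by_cases hy0 : y = 0
  · refine le_trans (le_of_eq ?_) zero_le
    rw [← lintegral_zero (α := Ph) (μ := volume)]
    refine lintegral_congr fun a => ?_
    have : (a, b') ∉ T := fun hq => hq.1 hy0
    simp only [Set.indicator_of_notMem this, mul_zero]
  have hyn : 0 < ‖y‖ := norm_pos_iff.2 hy0
  obtain ⟨f, hf, hfy, -⟩ := exists_unit_orthogonal_pair y y
  set e : Space := -(‖y‖⁻¹ • y) with he
  have hen : ‖e‖ = 1 := by
    rw [he, norm_neg, norm_smul, norm_inv, norm_norm, inv_mul_cancel₀ hyn.ne']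
  have hef : inner ℝ e f = 0 := by
    rw [he, inner_neg_left, inner_smul_left, real_inner_comm, hfy]; simp
  obtain ⟨F, -, hF2⟩ := exists_frame (norm_pos_iff.1 (by rw [hf]; norm_num)) hen hef
  have hye : y = -(‖y‖ • e) := by
    rw [he, smul_neg, neg_neg, smul_smul, mul_inv_cancel₀ hyn.ne', one_smul]
  set W : Space → ℝ≥0∞ := fun w => (Set.Icc (-(2 * n)) (2 * n)).indicator 1 (inner ℝ (F 0) w) *
    ((Set.Icc (-(2 * n)) (2 * n)).indicator 1 (inner ℝ (F 1) w) *
      (tubeCone (F 2) x).indicator 1 w) with hW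
  have hWm : Measurable W := by
    have h1 : Measurable ((Set.Icc (-(2 * n)) (2 * n)).indicator (1 : ℝ → ℝ≥0∞)) :=
      measurable_one.indicator measurableSet_Icc
    have h2 := (measurable_one (α := ℝ≥0∞) (β := Space)).indicator (measurableSet_tubeCone (F 2) x)
    simp only [hW]; fun_prop
  have key := lintegral_cone_pair_le (p := p) (t := c.1) x hWm
    (A := ENNReal.ofReal (2 * (2 * n)) * (ENNReal.ofReal (2 * (2 * n)) * jpInt p)) fun u => by
      have := lintegral_tube_le F x (d := 2 * n) (κ := fun v => jp p (u + s * v)) (by fun_prop)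
      rw [lintegral_jp_affine p u hs] at this
      simpa only [hW, mul_assoc] using this
  calc _ ≤ ∫⁻ z : Ph, ENNReal.ofReal (B * (n ^ 2)⁻¹) * (W z.2 *
        (jp p (-z.1 + s * ‖z.2‖) * jp p (-(c.1 - z.1) + s * ‖x - z.2‖))) := ?_
    _ = ENNReal.ofReal (B * (n ^ 2)⁻¹) * ∫⁻ z : Ph, (W z.2 *
        (jp p (-z.1 + s * ‖z.2‖) * jp p (-(c.1 - z.1) + s * ‖x - z.2‖))) :=
        lintegral_const_mul _ (by fun_prop)
    _ ≤ ENNReal.ofReal (B * (n ^ 2)⁻¹) * (jpInt p * (ENNReal.ofReal (2 * (2 * n)) *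
        (ENNReal.ofReal (2 * (2 * n)) * jpInt p))) := by gcongr
    _ = (ENNReal.ofReal (B * (n ^ 2)⁻¹) * ENNReal.ofReal (2 * (2 * n)) *
        ENNReal.ofReal (2 * (2 * n))) * jpInt p ^ 2 := by ring
    _ = _ := by
        rw [← ENNReal.ofReal_mul (by positivity), ← ENNReal.ofReal_mul (by positivity)]
        congr 2; field_simp; ring
  refine lintegral_mono fun a => ?_
  by_cases h1 : (a, c - a) ∈ T
  swap
  · simp only [Set.indicator_of_notMem h1, zero_mul]; exact zero_le
  by_cases h2 : (a, b') ∈ T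
  swap
  · simp only [Set.indicator_of_notMem h2, mul_zero]; exact zero_le
  have t3 := h1.2.2.1
  have u2 : ‖a.2 + y‖ ≤ 2 * n := h2.2.1
  have u4 : 4 * ‖a.2 + y‖ ≤ ‖y‖ := h2.2.2.2
  simp only [Prod.snd_sub, add_sub_cancel] at t3
  have hpar : 9 / 10 * ‖a.2‖ ≤ inner ℝ e a.2 := by
    refine parallel_of_close hen hyn.le (d := a.2 + y) ?_ u4
    nth_rewrite 2 [hye]; abel
  have hi : ∀ i, i ≠ 2 → inner ℝ (F i) a.2 ∈ Set.Icc (-(2 * n)) (2 * n) := fun i hi => by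
    have h0 : inner ℝ (F i) e = 0 := by rw [← hF2]; exact F.orthonormal.2 hi
    have h3 : inner ℝ (F i) y = 0 := by rw [hye, inner_neg_right, inner_smul_right, h0]; simp
    have h4 : inner ℝ (F i) a.2 = inner ℝ (F i) (a.2 + y) := by rw [inner_add_right, h3, add_zero]
    rw [h4]
    have := abs_real_inner_le_norm (F i) (a.2 + y)
    rw [F.orthonormal.1 i, one_mul] at this
    exact abs_le.1 (this.trans u2)
  have hmem : a.2 ∈ tubeCone (F 2) x := by
    refine ⟨?_, ?_⟩
    · rw [hF2]; exact hpar
    · rw [hF2, inner_sub_right]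
      have h3 := abs_real_inner_le_norm e x
      rw [hen, one_mul] at h3
      have h4 := norm_sub_le a.2 x
      have h5 := (le_abs_self _).trans h3
      have h6 : 4 * ‖x‖ ≤ ‖a.2‖ := t3
      have := norm_nonneg a.2
      linarith
  simp only [hW, Set.indicator_of_mem h1, Set.indicator_of_mem h2, Set.indicator_of_mem hmem,
    Set.indicator_of_mem (hi 0 (by decide)), Set.indicator_of_mem (hi 1 (by decide)),
    Pi.one_apply, one_mul, mul_one, Prod.fst_sub, Prod.snd_sub]
  exact le_rfl

/-- Nearly collinear inputs. -/
lemma of_small_angle {p s B : ℝ} (hB : 0 ≤ B)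
    (hk : ∀ a b, E a b → (a.2 + b.2 ≠ 0 ∧ ‖b.2‖ ≤ 2 * ‖a.2 + b.2‖ ∧
      par a.2 b.2 ≤ ‖a.2‖ * ‖b.2‖ * (jap ‖a.2‖ ^ 5)⁻¹) ∧
      k a b ^ 2 ≤ B * jap (-b.1 + s * ‖b.2‖) ^ (-p)) :
    Dominated k E (ENNReal.ofReal B * (jpInt p * (4 * jpInt 2 ^ 2))) := by
  set T : Set (Ph × Ph) := {q | q.1.2 + q.2.2 ≠ 0 ∧ ‖q.2.2‖ ≤ 2 * ‖q.1.2 + q.2.2‖ ∧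
    par q.1.2 q.2.2 ≤ ‖q.1.2‖ * ‖q.2.2‖ * (jap ‖q.1.2‖ ^ 5)⁻¹} with hT
  have hTm : MeasurableSet T := by
    have h1 : Measurable fun q : Ph × Ph => q.1.2 + q.2.2 := by fun_prop
    have h2 : Measurable fun q : Ph × Ph => ‖q.2.2‖ := by fun_prop
    have hp : Measurable fun q : Ph × Ph => par q.1.2 q.2.2 := by unfold par; fun_prop
    have h3 : Measurable fun q : Ph × Ph => ‖q.1.2‖ * ‖q.2.2‖ * (jap ‖q.1.2‖ ^ 5)⁻¹ := by fun_prop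
    exact (h1 (measurableSet_singleton 0)).compl.inter
      ((measurableSet_le h2 (h1.norm.const_mul 2)).inter (measurableSet_le hp h3))
  have hT1 : Measurable (T.indicator (1 : Ph × Ph → ℝ≥0∞)) := measurable_one.indicator hTm
  refine of_sum (N := fun a b => T.indicator 1 (a, b) * (ENNReal.ofReal B *
    jp p (-b.1 + s * ‖b.2‖))) (by fun_prop) (fun c => ?_) fun a b hab => ?_
  swap
  · have : (a, b) ∈ T := (hk a b hab).1
    simp only [Set.indicator_of_mem this, jp, Pi.one_apply, one_mul]
    rw [← ENNReal.ofReal_mul hB]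
    exact ENNReal.ofReal_le_ofReal (hk a b hab).2
  set x := c.2 with hx
  by_cases hx0 : x = 0
  · refine le_trans (le_of_eq ?_) zero_le
    rw [← lintegral_zero (α := Ph) (μ := volume)]
    refine lintegral_congr fun a => ?_
    have : (a, c - a) ∉ T := fun hq => hq.1 (by simpa using hx0)
    simp only [Set.indicator_of_notMem this, zero_mul]
  have hxp : 0 < ‖x‖ := norm_pos_iff.2 hx0
  obtain ⟨f, hf, hfx, -⟩ := exists_unit_orthogonal_pair x x
  obtain ⟨F, hF, hF2⟩ := exists_frame hx0 hf hfx
  set D : ℝ → ℝ → ℝ := fun a b => 2 * (jap a ^ (-2:ℝ) * jap b ^ (-2:ℝ)) with hD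
  set Q : Set (ℝ × ℝ × ℝ) := {q | |q.2.2| ≤ D q.1 q.2.1} with hQ
  have hQm : MeasurableSet Q := by
    have h1 : Measurable fun q : ℝ × ℝ × ℝ => |q.2.2| := by fun_prop
    have h2 : Measurable fun q : ℝ × ℝ × ℝ => D q.1 q.2.1 := by simp only [hD]; fun_prop
    exact measurableSet_le h1 h2
  have hQ1 : Measurable (Q.indicator (1 : ℝ × ℝ × ℝ → ℝ≥0∞)) := measurable_one.indicator hQm
  set H : ℝ → ℝ → ℝ → ℝ≥0∞ := fun a b c => Q.indicator 1 (a, b, c) with hH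
  have hHm : Measurable fun p : ℝ × ℝ × ℝ => H p.1 p.2.1 p.2.2 := by simp only [hH]; fun_prop
  have hHint : ∫⁻ a, ∫⁻ b, ∫⁻ c, H a b c = 4 * jpInt 2 ^ 2 := by
    have e1 : ∀ a b, ∫⁻ c, H a b c = 4 * jp 2 a * jp 2 b := fun a b => by
      have hset : MeasurableSet (Set.Icc (-(D a b)) (D a b)) := measurableSet_Icc
      have : ∀ c, H a b c = (Set.Icc (-(D a b)) (D a b)).indicator 1 c := fun c => by
        simp only [hH]
        by_cases h : |c| ≤ D a b
        · have h' : c ∈ Set.Icc (-(D a b)) (D a b) := abs_le.1 h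
          have h'' : (a, b, c) ∈ Q := h
          rw [Set.indicator_of_mem h', Set.indicator_of_mem h'']; rfl
        · have h' : c ∉ Set.Icc (-(D a b)) (D a b) := fun hh => h (abs_le.2 hh)
          have h'' : (a, b, c) ∉ Q := h
          rw [Set.indicator_of_notMem h', Set.indicator_of_notMem h'']
      simp only [this]
      rw [lintegral_indicator_one hset, Real.volume_Icc, sub_neg_eq_add, ← two_mul]
      simp only [hD, jp]
      have h0 : ∀ t : ℝ, 0 ≤ jap t ^ (-2:ℝ) := fun t => Real.rpow_nonneg (jap_pos t).le _
      rw [show (4 : ℝ≥0∞) = ENNReal.ofReal 4 by simp, ← ENNReal.ofReal_mul (by norm_num),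
        ← ENNReal.ofReal_mul (by have := h0 a; positivity)]
      congr 1; ring
    simp only [e1]
    have e2 : ∀ a, ∫⁻ b, 4 * jp 2 a * jp 2 b = 4 * jp 2 a * jpInt 2 := fun a => by
      rw [lintegral_const_mul _ (by fun_prop), jpInt]
    simp only [e2]
    rw [lintegral_mul_const _ (by fun_prop), lintegral_const_mul _ (by fun_prop), ← jpInt]
    ring
  calc _ ≤ ∫⁻ z : Ph, H (inner ℝ (F 0) z.2) (inner ℝ (F 1) z.2) (inner ℝ (F 2) z.2) *
        (ENNReal.ofReal B * jp p (-(c.1 - z.1) + s * ‖x - z.2‖)) := ?_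
    _ = ∫⁻ w : Space, ∫⁻ τ, H (inner ℝ (F 0) w) (inner ℝ (F 1) w) (inner ℝ (F 2) w) *
        (ENNReal.ofReal B * jp p (-(c.1 - τ) + s * ‖x - w‖)) := lintegral_ph _ (by fun_prop)
    _ = ∫⁻ w : Space, H (inner ℝ (F 0) w) (inner ℝ (F 1) w) (inner ℝ (F 2) w) *
        (ENNReal.ofReal B * jpInt p) := by
        refine lintegral_congr fun w => ?_
        rw [lintegral_const_mul _ (by fun_prop), lintegral_const_mul _ (by fun_prop)]
        congr 2
        rw [← lintegral_jp_affine p (-c.1 + s * ‖x - w‖) (Or.inl rfl)]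
        refine lintegral_congr fun τ => ?_
        congr 1; ring
    _ = (4 * jpInt 2 ^ 2) * (ENNReal.ofReal B * jpInt p) := by
        rw [lintegral_mul_const _ (by fun_prop), lintegral_frame F hHm, hHint]
    _ = _ := by ring
  refine lintegral_mono fun a => ?_
  by_cases h1 : (a, c - a) ∈ T
  swap
  · simp only [Set.indicator_of_notMem h1, zero_mul]; exact zero_le
  have t2 := h1.2.1
  have t3 := h1.2.2
  simp only [Prod.snd_sub, add_sub_cancel] at t2 t3
  have hmem : (inner ℝ (F 0) a.2, inner ℝ (F 1) a.2, inner ℝ (F 2) a.2) ∈ Q := by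
    show |inner ℝ (F 2) a.2| ≤ D _ _
    rw [hF2]
    have h3 := abs_inner_mul_norm_le_par hf hfx a.2
    rw [← par_sub_left] at h3
    have hJ := jap_pos ‖a.2‖
    have h4 : |inner ℝ f a.2| * ‖x‖ ≤ (2 * (jap ‖a.2‖ ^ 4)⁻¹) * ‖x‖ := by
      refine h3.trans (t3.trans ?_)
      have h5 : ‖a.2‖ ≤ jap ‖a.2‖ := (le_abs_self _).trans (abs_le_jap _)
      calc _ ≤ jap ‖a.2‖ * (2 * ‖x‖) * (jap ‖a.2‖ ^ 5)⁻¹ := by gcongr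
        _ = _ := by field_simp
    refine (le_of_mul_le_mul_right h4 hxp).trans ?_
    simp only [hD]
    have hj2 : ∀ t : ℝ, jap t ^ (-2:ℝ) = (1 + t ^ 2)⁻¹ := fun t => by
      rw [jap_rpow]; norm_num [Real.rpow_neg_one]
    have hj4 : jap ‖a.2‖ ^ 4 = (1 + ‖a.2‖ ^ 2) ^ 2 := by
      rw [jap, show (4:ℕ) = 2 * 2 by norm_num, pow_mul, Real.sq_sqrt (by positivity)]
    rw [hj2, hj2, hj4, ← mul_inv]
    gcongr
    rw [frame_norm_sq F a.2, sq (1 + _)]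
    have q0 := sq_nonneg (inner ℝ (F 0) a.2)
    have q1 := sq_nonneg (inner ℝ (F 1) a.2)
    have q2 := sq_nonneg (inner ℝ (F 2) a.2)
    gcongr <;> linarith
  simp only [hH, Set.indicator_of_mem h1, Set.indicator_of_mem hmem, Pi.one_apply, one_mul,
    Prod.fst_sub, Prod.snd_sub]
  exact le_rfl

end Dominated

/-! ## Boundedness criteria in logarithmic form -/

/-- The kernel `k` is dominated on `E` with some finite constant. -/
def Dom (k : Ph → Ph → ℝ) (E : Ph → Ph → Prop) : Prop := ∃ C < ⊤, Dominated k E C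

/-- The logarithm of the bracket of the frequency. -/
def nu (a : Ph) : ℝ := Real.log (jap ‖a.2‖)

/-- The logarithm of the modulation bracket relative to the cone of sign `s`. -/
def lam (s : ℝ) (a : Ph) : ℝ := Real.log (jap (-a.1 + s * ‖a.2‖))

lemma log_jap_nonneg (x : ℝ) : 0 ≤ Real.log (jap x) := Real.log_nonneg (one_le_jap x)

lemma nu_nonneg (a : Ph) : 0 ≤ nu a := log_jap_nonneg _

lemma lam_nonneg (s : ℝ) (a : Ph) : 0 ≤ lam s a := log_jap_nonneg _

lemma jap_rpow_eq_exp (x q : ℝ) : jap x ^ q = Real.exp (q * Real.log (jap x)) := by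
  rw [Real.rpow_def_of_pos (jap_pos x), mul_comm]

lemma exp_lam (s q : ℝ) (a : Ph) : Real.exp (q * lam s a) = jap (-a.1 + s * ‖a.2‖) ^ q :=
  (jap_rpow_eq_exp _ _).symm

lemma exp_nu (q : ℝ) (a : Ph) : Real.exp (q * nu a) = jap ‖a.2‖ ^ q :=
  (jap_rpow_eq_exp _ _).symm

lemma jap_mul_le {c x : ℝ} (hc : 1 ≤ c) : jap (c * x) ≤ c * jap x := by
  refine Real.sqrt_le_iff.2 ⟨mul_nonneg (by linarith) (jap_pos x).le, ?_⟩
  have h : jap x ^ 2 = 1 + x ^ 2 := Real.sq_sqrt (by positivity)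
  rw [mul_pow, mul_pow, h]
  nlinarith

lemma nu_le_of_le {a b : Ph} {c : ℝ} (hc : 1 ≤ c) (h : ‖a.2‖ ≤ c * ‖b.2‖) :
    nu a ≤ Real.log c + nu b := by
  rw [nu, nu, ← Real.log_mul (by linarith) (jap_pos _).ne']
  refine Real.log_le_log (jap_pos _) (le_trans (jap_le_jap ?_) (jap_mul_le hc))
  rw [abs_of_nonneg (norm_nonneg _), abs_of_nonneg (by positivity)]
  exact h

lemma nu_mono {a b : Ph} (h : ‖a.2‖ ≤ ‖b.2‖) : nu a ≤ nu b := by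
  simpa using nu_le_of_le le_rfl (by simpa using h)

namespace Dom

variable {k k' : Ph → Ph → ℝ} {E E' : Ph → Ph → Prop}

lemma mono (h : Dom k E) (hk : ∀ a b, E' a b → E a b ∧ k' a b ≤ k a b) : Dom k' E' := by
  obtain ⟨C, hC, h⟩ := h
  exact ⟨C, hC, h.mono hk le_rfl⟩

lemma union (h : Dom k E) (h' : Dom k E') : Dom k fun a b => E a b ∨ E' a b := by
  obtain ⟨C, hC, h⟩ := h
  obtain ⟨C', hC', h'⟩ := h'
  exact ⟨_, ENNReal.mul_lt_top (by simp) (ENNReal.add_lt_top.2 ⟨hC, hC'⟩), h.union h'⟩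

lemma swap (h : Dom (fun a b => k b a) fun a b => E b a) : Dom k E := by
  obtain ⟨C, hC, h⟩ := h
  exact ⟨C, hC, h.swap⟩

lemma of_zero (hE : ∀ a b, E a b → a.2 = 0 ∨ b.2 = 0 ∨ a.2 + b.2 = 0) : Dom k E :=
  ⟨0, by simp, Dominated.of_zero hE⟩

lemma radial_neg {p s s' α γ D : ℝ} (hp : 1 < p) (hs' : s' = 1 ∨ s' = -1) (hα : α < 0)
    (hαγ : α + γ + 2 ≤ 0)
    (hk : ∀ a b, E a b → a.2 + b.2 ≠ 0 ∧ ‖a.2‖ ≤ 4 * ‖a.2 + b.2‖ ∧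
      k a b ^ 2 ≤ Real.exp (D + α * nu (a + b) + γ * nu a + -p * lam s a + -p * lam s' b)) :
    Dom k E := by
  set η := min (-α) 1 with hη
  have hη0 : 0 < η := lt_min (by linarith) one_pos
  have hη1 : η ≤ 1 := min_le_right _ _
  have hηα : α + η ≤ 0 := by linarith [min_le_left (-α) 1]
  set B := Real.exp (D - (α + η) * Real.log 4)
  refine ⟨_, ?_, Dominated.of_radial (p := p) (s := s) hs'
    (φ := fun x r => B * (jap x ^ (-η) * jap r ^ (η - 2)))
    (A := ENNReal.ofReal (B * (4 ^ η / η))) (by fun_prop)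
    (fun x r => mul_nonneg (Real.exp_pos _).le
      (mul_nonneg (Real.rpow_nonneg (jap_pos _).le _) (Real.rpow_nonneg (jap_pos _).le _)))
    (fun x hx => ?_) fun a b hab => ⟨(hk a b hab).1, (hk a b hab).2.1, (hk a b hab).2.2.trans ?_⟩⟩
  · exact ENNReal.mul_lt_top (ENNReal.mul_lt_top ENNReal.ofReal_lt_top
      (ENNReal.pow_lt_top (jpInt_lt_top hp))) ENNReal.ofReal_lt_top
  · have h1 : ∫⁻ r in Set.Ioc 0 (4 * x), ENNReal.ofReal (B * jap x ^ (-η) * r ^ (η - 1)) =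
        ENNReal.ofReal (B * jap x ^ (-η) * ((4 * x) ^ η / η)) := by
      have hi : IntervalIntegrable (fun r : ℝ => B * jap x ^ (-η) * r ^ (η - 1)) volume 0 (4 * x) :=
        (intervalIntegral.intervalIntegrable_rpow' (by linarith)).const_mul _
      rw [intervalIntegrable_iff_integrableOn_Ioc_of_le (by linarith)] at hi
      rw [← ofReal_integral_eq_lintegral_ofReal hi ?_,
        ← intervalIntegral.integral_of_le (by linarith), intervalIntegral.integral_const_mul,
        integral_rpow (Or.inl (by linarith)), sub_add_cancel, Real.zero_rpow hη0.ne', sub_zero]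
      refine (ae_restrict_iff' measurableSet_Ioc).2 (Filter.Eventually.of_forall fun r hr => ?_)
      exact mul_nonneg (mul_nonneg (Real.exp_pos _).le (Real.rpow_nonneg (jap_pos _).le _))
        (Real.rpow_nonneg hr.1.le _)
    calc _ ≤ ∫⁻ r in Set.Ioc 0 (4 * x), ENNReal.ofReal (B * jap x ^ (-η) * r ^ (η - 1)) := by
          refine setLIntegral_mono (by fun_prop) fun r hr => ENNReal.ofReal_le_ofReal ?_
          have hr0 : 0 < r := hr.1
          have h2 : r * jap r ^ (η - 2) ≤ r ^ (η - 1) := by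
            rw [show η - 1 = 1 + (η - 2) by ring, Real.rpow_add hr0, Real.rpow_one]
            refine mul_le_mul_of_nonneg_left ?_ hr0.le
            exact Real.rpow_le_rpow_of_nonpos hr0 ((le_abs_self r).trans (abs_le_jap r))
              (by linarith)
          calc _ = B * jap x ^ (-η) * (r * jap r ^ (η - 2)) := by ring
            _ ≤ _ := mul_le_mul_of_nonneg_left h2
                (mul_nonneg (Real.exp_pos _).le (Real.rpow_nonneg (jap_pos _).le _))
      _ = _ := h1
      _ ≤ _ := by
          refine ENNReal.ofReal_le_ofReal ?_
          rw [mul_assoc]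
          refine mul_le_mul_of_nonneg_left ?_ (Real.exp_pos _).le
          rw [Real.mul_rpow (by norm_num) hx.le, Real.rpow_neg (jap_pos _).le, mul_div_assoc',
            ← mul_assoc, inv_mul_eq_div]
          refine div_le_div_of_nonneg_right ?_ hη0.le
          rw [div_mul_eq_mul_div, div_le_iff₀ (Real.rpow_pos_of_pos (jap_pos _) _)]
          exact mul_le_mul_of_nonneg_left (Real.rpow_le_rpow hx.le
            ((le_abs_self x).trans (abs_le_jap x)) hη0.le) (by positivity)
  · have h4 : nu a ≤ Real.log 4 + nu (a + b) := nu_le_of_le (by norm_num) (hk a b hab).2.1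
    have e : B * (jap ‖a.2 + b.2‖ ^ (-η) * jap ‖a.2‖ ^ (η - 2)) *
        (jap (-a.1 + s * ‖a.2‖) ^ (-p) * jap (-b.1 + s' * ‖b.2‖) ^ (-p)) =
        Real.exp (D - (α + η) * Real.log 4 + (-η * nu (a + b) + (η - 2) * nu a) +
          (-p * lam s a + -p * lam s' b)) := by
      simp only [Real.exp_add, exp_nu, exp_lam]; rfl
    rw [e, Real.exp_le_exp]
    nlinarith [mul_nonneg (neg_nonneg.2 hαγ) (nu_nonneg a),
      mul_nonneg (neg_nonneg.2 hηα) (sub_nonneg.2 h4)]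

lemma radial_zero {p s s' γ D : ℝ} (hp : 1 < p) (hs' : s' = 1 ∨ s' = -1) (hγ : γ + 2 < 0)
    (hk : ∀ a b, E a b → a.2 + b.2 ≠ 0 ∧ ‖a.2‖ ≤ 4 * ‖a.2 + b.2‖ ∧
      k a b ^ 2 ≤ Real.exp (D + γ * nu a + -p * lam s a + -p * lam s' b)) :
    Dom k E := by
  refine ⟨_, ?_, Dominated.of_radial (p := p) (s := s) hs'
    (φ := fun x r => Real.exp D * jap r ^ γ)
    (A := ENNReal.ofReal (Real.exp D) * radialMass (-γ - 2)) (by fun_prop)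
    (fun x r => mul_nonneg (Real.exp_pos _).le (Real.rpow_nonneg (jap_pos _).le _))
    (fun x hx => ?_) fun a b hab => ⟨(hk a b hab).1, (hk a b hab).2.1, (hk a b hab).2.2.trans ?_⟩⟩
  · exact ENNReal.mul_lt_top (ENNReal.mul_lt_top ENNReal.ofReal_lt_top
      (ENNReal.pow_lt_top (jpInt_lt_top hp)))
      (ENNReal.mul_lt_top ENNReal.ofReal_lt_top (radialMass_lt_top (by linarith)))
  · rw [radialMass, ← lintegral_const_mul _ (by fun_prop)]
    refine (lintegral_mono_set Set.Ioc_subset_Ioi_self).trans ?_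
    refine setLIntegral_mono (by fun_prop) fun r hr => ?_
    have hr0 : (0:ℝ) < r := hr
    rw [jp, ← ENNReal.ofReal_mul hr0.le, ← ENNReal.ofReal_mul (Real.exp_pos _).le,
      show -(2 + (-γ - 2)) = γ by ring]
    exact ENNReal.ofReal_le_ofReal (le_of_eq (by ring))
  · refine le_of_eq ?_
    simp only [Real.exp_add, exp_nu, exp_lam]; ring

/-- Two thickened cones, `|ξ₁| ≤ 4|ξ₀|`, with power weights. -/
lemma radial {p s s' α γ D : ℝ} (hp : 1 < p) (hs' : s' = 1 ∨ s' = -1) (hα : α ≤ 0)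
    (hαγ : α + γ + 2 ≤ 0) (hne : ¬ (α + γ + 2 = 0 ∧ α = 0))
    (hk : ∀ a b, E a b → a.2 + b.2 ≠ 0 ∧ ‖a.2‖ ≤ 4 * ‖a.2 + b.2‖ ∧
      k a b ^ 2 ≤ Real.exp (D + α * nu (a + b) + γ * nu a + -p * lam s a + -p * lam s' b)) :
    Dom k E := by
  rcases hα.lt_or_eq with h | rfl
  · exact radial_neg hp hs' h hαγ hk
  · refine radial_zero (s := s) hp hs' (γ := γ) (D := D) (lt_of_le_of_ne (by linarith) fun h => hne ?_) ?_
    · constructor <;> linarith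
    · simpa using hk

end Dom

lemma le_exp_half {x R : ℝ} (h : x ^ 2 ≤ Real.exp R) : x ≤ Real.exp (R / 2) := by
  have e : Real.exp R = Real.exp (R / 2) ^ 2 := by rw [← Real.exp_nat_mul]; congr 1; push_cast; ring
  exact (le_abs_self x).trans (abs_le_of_sq_le_sq (e ▸ h) (Real.exp_pos _).le)

lemma exp_sq (x : ℝ) : Real.exp x ^ 2 = Real.exp (2 * x) := by
  rw [← Real.exp_nat_mul]; congr 1

/-- `∑ₙ e^{-ρ n}`. -/
def geo (ρ : ℝ) : ℝ≥0∞ := ∑' n : ℕ, ENNReal.ofReal (Real.exp (-ρ)) ^ n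

lemma geo_lt_top {ρ : ℝ} (hρ : 0 < ρ) : geo ρ < ⊤ := by
  have h : ENNReal.ofReal (Real.exp (-ρ)) < 1 :=
    ENNReal.ofReal_lt_one.2 (by rw [← Real.exp_zero]; exact Real.exp_lt_exp.2 (by linarith))
  rw [geo, ENNReal.tsum_geometric, ENNReal.inv_lt_top]
  exact tsub_pos_of_lt h

lemma ofReal_exp_pow (ρ : ℝ) (n : ℕ) :
    ENNReal.ofReal (Real.exp (-ρ)) ^ n = ENNReal.ofReal (Real.exp (-(ρ * n))) := by
  rw [← ENNReal.ofReal_pow (Real.exp_pos _).le, ← Real.exp_nat_mul]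
  congr 2; ring

lemma tsum_geometric_le_geo {ρ L : ℝ} (hρ : 0 < ρ) (hL : 0 < L) (x : ℝ) :
    ∑' j : ℕ, ENNReal.ofReal (if j * L ≤ x then Real.exp (ρ * (j * L - x)) else 0) ≤
      geo (ρ * L) := by
  set J := ⌊x / L⌋₊ with hJ
  calc _ ≤ ∑' j : ℕ, if j ∈ Finset.range (J + 1) then
          ENNReal.ofReal (Real.exp (-(ρ * L))) ^ (J - j) else 0 := by
        refine ENNReal.tsum_le_tsum fun j => ?_
        split_ifs with h1 h2 h2
        · rw [ofReal_exp_pow]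
          have hj : j ≤ J := Nat.lt_succ_iff.1 (Finset.mem_range.1 h2)
          have hx : 0 ≤ x := le_trans (by positivity) h1
          have h3 : (J : ℝ) * L ≤ x := (le_div_iff₀ hL).1 (Nat.floor_le (by positivity))
          refine ENNReal.ofReal_le_ofReal (Real.exp_le_exp.2 ?_)
          rw [Nat.cast_sub hj]
          nlinarith
        · exact absurd (Finset.mem_range.2 (Nat.lt_succ_iff.2
            (Nat.le_floor ((le_div_iff₀ hL).2 h1)))) h2
        · simp
        · simp
    _ = ∑ j ∈ Finset.range (J + 1), ENNReal.ofReal (Real.exp (-(ρ * L))) ^ (J - j) := by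
        rw [tsum_eq_sum (s := Finset.range (J + 1)) fun j hj => if_neg hj]
        exact Finset.sum_congr rfl fun j hj => if_pos hj
    _ = ∑ j ∈ Finset.range (J + 1), ENNReal.ofReal (Real.exp (-(ρ * L))) ^ j := by
        rw [← Finset.sum_range_reflect]
        refine Finset.sum_congr rfl fun j hj => ?_
        congr 1
        have := Finset.mem_range.1 hj
        omega
    _ ≤ _ := ENNReal.sum_le_tsum _

namespace Dominated

variable {k : Ph → Ph → ℝ} {E : Ph → Ph → Prop} {C : ℝ≥0∞}

/-- Summation of pieces with geometrically decaying bounds. -/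
lemma of_geometric {kn : ℕ → Ph → Ph → ℝ} {En : ℕ → Ph → Ph → Prop} {ρ : ℝ}
    (h : ∀ n, Dominated (kn n) (En n) C)
    (hk : ∀ a b, E a b → ∃ n, En n a b ∧ k a b ≤ Real.exp (-(ρ * n)) * kn n a b) :
    Dominated k E (C * geo ρ ^ 2) := by
  refine of_tsum (ω := fun n _ => Real.exp (-(ρ * n) / 2)) (fun n => measurable_const)
    (fun n a => (Real.exp_pos _).le) h (fun a => le_of_eq ?_) fun a b hab => ?_
  · refine tsum_congr fun n => ?_
    rw [ofReal_exp_pow, ← ENNReal.ofReal_pow (Real.exp_pos _).le, exp_sq]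
    congr 2; ring
  · obtain ⟨n, hn, hle⟩ := hk a b hab
    refine ⟨n, hn, hle.trans (le_of_eq ?_)⟩
    rw [← Real.exp_add, add_halves]

/-- Summation of dyadic pieces in `|ξ₀|`, with off-diagonal gain. -/
lemma of_nested {kn : ℕ → Ph → Ph → ℝ} {En : ℕ → Ph → Ph → Prop} {ρ L c : ℝ} (hρ : 0 < ρ)
    (hL : 0 < L) (h : ∀ n, Dominated (kn n) (En n) C) (hkn : ∀ n a b, 0 ≤ kn n a b)
    (hk : ∀ a b, E a b → ∃ n : ℕ, En n a b ∧ n * L ≤ nu a ∧ |nu a - nu b| ≤ c ∧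
      k a b ≤ Real.exp (ρ * (n * L - nu a)) * kn n a b) :
    Dominated k E (C * (ENNReal.ofReal (Real.exp (2 * (ρ * c))) * geo (ρ * L)) ^ 2) := by
  set ω : ℕ → Ph → ℝ := fun n a =>
    if n * L ≤ nu a + c then Real.exp (ρ / 2 * (n * L - nu a) + ρ * c / 2) else 0 with hω
  have hnu : Measurable nu := by unfold nu; fun_prop
  refine of_tsum (ω := ω) (fun n => ?_) (fun n a => ?_) h (fun a => ?_) fun a b hab => ?_
  · exact Measurable.ite (measurableSet_le measurable_const (by fun_prop)) (by fun_prop)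
      measurable_const
  · simp only [hω]; split_ifs
    · exact (Real.exp_pos _).le
    · exact le_rfl
  · rw [geo, ← geo]
    refine le_trans (le_of_eq ?_) (mul_le_mul' le_rfl (tsum_geometric_le_geo hρ hL (nu a + c)))
    rw [← ENNReal.tsum_mul_left]
    refine tsum_congr fun n => ?_
    simp only [hω]
    split_ifs
    · rw [← ENNReal.ofReal_pow (Real.exp_pos _).le, ← ENNReal.ofReal_mul (Real.exp_pos _).le,
        exp_sq, ← Real.exp_add]
      congr 2; ring
    · simp
  · obtain ⟨n, hn, hna, hc, hle⟩ := hk a b hab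
    have hc1 := abs_le.1 hc
    have hc0 : 0 ≤ c := (abs_nonneg _).trans hc
    refine ⟨n, hn, hle.trans ?_⟩
    refine mul_le_mul_of_nonneg_right ?_ (hkn n a b)
    simp only [hω]
    rw [if_pos (by linarith), if_pos (by linarith), ← Real.exp_add, Real.exp_le_exp]
    nlinarith

end Dominated

/-- The logarithm of the sine of the angle between two frequencies. -/
def sn (a b : Ph) : ℝ := Real.log (par a.2 b.2 / (‖a.2‖ * ‖b.2‖))

lemma par_le (w y : Space) : par w y ≤ ‖w‖ * ‖y‖ := by
  rw [par]
  refine Real.sqrt_le_iff.2 ⟨by positivity, ?_⟩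
  nlinarith [sq_nonneg ⟪w, y⟫]

lemma exists_window {a b : Ph} (h : 0 < par a.2 b.2) : ∃ m : ℕ,
    (1 / 2 : ℝ) ^ (m + 1) * (‖a.2‖ * ‖b.2‖) < par a.2 b.2 ∧
    par a.2 b.2 ≤ 2 * (1 / 2 : ℝ) ^ (m + 1) * (‖a.2‖ * ‖b.2‖) ∧ sn a b ≤ -(Real.log 2 * m) := by
  have hpos : 0 < ‖a.2‖ * ‖b.2‖ := h.trans_le (par_le _ _)
  obtain ⟨m, h1, h2⟩ := exists_nat_pow_near_of_lt_one (x := par a.2 b.2 / (‖a.2‖ * ‖b.2‖))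
    (y := (1 / 2 : ℝ)) (by positivity) ((div_le_one hpos).2 (par_le _ _)) (by norm_num)
    (by norm_num)
  refine ⟨m, (lt_div_iff₀ hpos).1 h1, ?_, ?_⟩
  · rw [pow_succ, show 2 * ((1 / 2 : ℝ) ^ m * (1 / 2)) = (1 / 2) ^ m by ring]
    exact (div_le_iff₀ hpos).1 h2
  · have := Real.log_le_log (by positivity) h2
    rw [Real.log_pow, one_div, Real.log_inv] at this
    rw [sn]; linarith

lemma exists_dyadic {x : ℝ} (hx : 1 ≤ x) : ∃ j : ℕ, (2:ℝ) ^ j ≤ x ∧ x < 2 ^ (j + 1) ∧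
    j * Real.log 2 ≤ Real.log x ∧ Real.log x ≤ Real.log 2 + j * Real.log 2 := by
  obtain ⟨j, h1, h2⟩ := exists_nat_pow_near hx (y := (2:ℝ)) (by norm_num)
  refine ⟨j, h1, h2, ?_, ?_⟩
  · rw [← Real.log_pow]; exact Real.log_le_log (by positivity) h1
  · have := Real.log_le_log (by linarith) h2.le
    rw [Real.log_pow] at this
    push_cast at this; linarith

lemma exp_neg_natCast_mul_log_two (j : ℕ) : Real.exp (-(j * Real.log 2)) = ((2:ℝ) ^ j)⁻¹ := by
  rw [Real.exp_neg, Real.exp_nat_mul, Real.exp_log (by norm_num)]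

namespace Dom

variable {k : Ph → Ph → ℝ} {E : Ph → Ph → Prop} {p s s' s₀ D δ : ℝ}

lemma small_angle (hp : 1 < p)
    (hk : ∀ a b, E a b → (a.2 + b.2 ≠ 0 ∧ ‖b.2‖ ≤ 2 * ‖a.2 + b.2‖ ∧
      par a.2 b.2 ≤ ‖a.2‖ * ‖b.2‖ * (jap ‖a.2‖ ^ 5)⁻¹) ∧
      k a b ^ 2 ≤ Real.exp (D + -p * lam s b)) : Dom k E := by
  refine ⟨_, ?_, Dominated.of_small_angle (p := p) (s := s) (Real.exp_pos D).le
    fun a b hab => ⟨(hk a b hab).1, (hk a b hab).2.trans (le_of_eq ?_)⟩⟩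
  · have h1 := jpInt_lt_top hp
    have h2 := jpInt_lt_top (p := 2) (by norm_num)
    exact ENNReal.mul_lt_top ENNReal.ofReal_lt_top (ENNReal.mul_lt_top h1
      (ENNReal.mul_lt_top (by simp) (ENNReal.pow_lt_top h2)))
  · rw [Real.exp_add, exp_lam]

lemma low_right (hp : 1 < p) (hδ : 0 < δ) (hs₀ : s₀ = 1 ∨ s₀ = -1)
    (hk : ∀ a b, E a b → a.2 ≠ 0 ∧ ‖b.2‖ ≤ 4 * ‖a.2‖ ∧
      (k a b ^ 2 ≤ Real.exp (D + -(2 + δ) * nu b + -p * lam s b + -p * lam s₀ (a + b)) ∨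
       k a b ^ 2 ≤ Real.exp (D + -(3 + δ) * nu b + -p * lam s b))) : Dom k E := by
  refine ⟨_, Dominated.lowConst_lt_top hp hδ, Dominated.of_low_right (s := s) (A := Real.exp D)
    (Real.exp_pos D).le fun a b hab => ⟨(hk a b hab).1, (hk a b hab).2.1, ?_⟩⟩
  have J0 : ∀ x q : ℝ, 0 ≤ jap x ^ q := fun x q => Real.rpow_nonneg (jap_pos _).le _
  have hD := (Real.exp_pos D).le
  have m1 := mul_nonneg (J0 ‖b.2‖ (-(2 + δ))) (mul_nonneg (J0 (-b.1 + s * ‖b.2‖) (-p))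
    (J0 (-(a.1 + b.1) + 1 * ‖a.2 + b.2‖) (-p)))
  have m2 := mul_nonneg (J0 ‖b.2‖ (-(2 + δ))) (mul_nonneg (J0 (-b.1 + s * ‖b.2‖) (-p))
    (J0 (-(a.1 + b.1) + (-1) * ‖a.2 + b.2‖) (-p)))
  have m3 := mul_nonneg (J0 ‖b.2‖ (-(3 + δ))) (J0 (-b.1 + s * ‖b.2‖) (-p))
  rcases (hk a b hab).2.2 with h | h
  · refine h.trans ?_
    rw [Real.exp_add, Real.exp_add, Real.exp_add, exp_nu, exp_lam, exp_lam, mul_assoc, mul_assoc]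
    refine mul_le_mul_of_nonneg_left ?_ hD
    rcases hs₀ with rfl | rfl
    · simp only [Prod.fst_add, Prod.snd_add] at *
      linarith
    · simp only [Prod.fst_add, Prod.snd_add] at *
      linarith
  · refine h.trans ?_
    rw [Real.exp_add, Real.exp_add, exp_nu, exp_lam, mul_assoc]
    refine mul_le_mul_of_nonneg_left ?_ hD
    linarith

lemma low_sum (hp : 1 < p) (hδ : 0 < δ) (hs : s = 1 ∨ s = -1) (hs₀ : s₀ = 1 ∨ s₀ = -1)
    (hk : ∀ a b, E a b → a.2 ≠ 0 ∧ ‖a.2 + b.2‖ ≤ 4 * ‖a.2‖ ∧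
      (k a b ^ 2 ≤ Real.exp (D + -(2 + δ) * nu (a + b) + -p * lam s b + -p * lam s₀ (a + b)) ∨
       k a b ^ 2 ≤ Real.exp (D + -(3 + δ) * nu (a + b) + -p * lam s b))) : Dom k E := by
  refine ⟨_, Dominated.lowConst_lt_top hp hδ, Dominated.of_low_sum hs (A := Real.exp D)
    (Real.exp_pos D).le fun a b hab => ⟨(hk a b hab).1, (hk a b hab).2.1, ?_⟩⟩
  have J0 : ∀ x q : ℝ, 0 ≤ jap x ^ q := fun x q => Real.rpow_nonneg (jap_pos _).le _
  have hD := (Real.exp_pos D).le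
  have m1 := mul_nonneg (J0 ‖a.2 + b.2‖ (-(2 + δ))) (mul_nonneg
    (J0 (-(a.1 + b.1) + 1 * ‖a.2 + b.2‖) (-p)) (J0 (-b.1 + s * ‖b.2‖) (-p)))
  have m2 := mul_nonneg (J0 ‖a.2 + b.2‖ (-(2 + δ))) (mul_nonneg
    (J0 (-(a.1 + b.1) + (-1) * ‖a.2 + b.2‖) (-p)) (J0 (-b.1 + s * ‖b.2‖) (-p)))
  have m3 := mul_nonneg (J0 ‖a.2 + b.2‖ (-(3 + δ))) (J0 (-b.1 + s * ‖b.2‖) (-p))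
  rcases (hk a b hab).2.2 with h | h
  · refine h.trans ?_
    rw [Real.exp_add, Real.exp_add, Real.exp_add, exp_nu, exp_lam, exp_lam, mul_assoc, mul_assoc,
      mul_comm (jap _ ^ (-p))]
    refine mul_le_mul_of_nonneg_left ?_ hD
    rcases hs₀ with rfl | rfl
    · simp only [Prod.fst_add, Prod.snd_add] at *
      linarith
    · simp only [Prod.fst_add, Prod.snd_add] at *
      linarith
  · refine h.trans ?_
    rw [Real.exp_add, Real.exp_add, exp_nu, exp_lam, mul_assoc]
    refine mul_le_mul_of_nonneg_left ?_ hD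
    simp only [Prod.snd_add] at *
    linarith

/-- Summation over dyadic sizes of `ξ₀`, for `|ξ₁| ∼ |ξ₂|`. -/
lemma nested {ρ α c : ℝ} (hα : 0 ≤ α) (hρα : ρ ≤ α) (hne : ¬ (α = 0 ∧ ρ = 0))
    {C : ℝ≥0∞} (hC : C < ⊤) {m : ℕ → Ph → Ph → ℝ} (hm : ∀ j a b, 0 ≤ m j a b)
    (h : ∀ j : ℕ, Dominated (m j) (fun a b => E a b ∧ (2:ℝ) ^ j ≤ jap ‖a.2 + b.2‖ ∧
      jap ‖a.2 + b.2‖ < 2 ^ (j + 1)) C)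
    (hk : ∀ a b, E a b → nu (a + b) ≤ nu a ∧ |nu a - nu b| ≤ c ∧
      ∀ j : ℕ, (2:ℝ) ^ j ≤ jap ‖a.2 + b.2‖ → jap ‖a.2 + b.2‖ < 2 ^ (j + 1) →
        k a b ≤ Real.exp (ρ * (j * Real.log 2) - α * nu a) * m j a b) : Dom k E := by
  have hL : 0 < Real.log 2 := Real.log_pos (by norm_num)
  rcases hα.lt_or_eq with hα | rfl
  · refine ⟨_, ?_, Dominated.of_nested (c := c) hα hL h hm fun a b hab => ?_⟩
    · exact ENNReal.mul_lt_top hC (ENNReal.pow_lt_top (ENNReal.mul_lt_top ENNReal.ofReal_lt_top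
        (geo_lt_top (mul_pos hα hL))))
    · obtain ⟨h1, h2, h3⟩ := hk a b hab
      obtain ⟨j, hj1, hj2, hj3, hj4⟩ := exists_dyadic (one_le_jap ‖a.2 + b.2‖)
      refine ⟨j, ⟨hab, hj1, hj2⟩, hj3.trans h1, h2, (h3 j hj1 hj2).trans ?_⟩
      refine mul_le_mul_of_nonneg_right (Real.exp_le_exp.2 ?_) (hm _ _ _)
      have : (0:ℝ) ≤ j * Real.log 2 := by positivity
      nlinarith
  · have hρ : ρ < 0 := lt_of_le_of_ne hρα fun h => hne ⟨rfl, h⟩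
    refine ⟨_, ?_, Dominated.of_geometric (ρ := -ρ * Real.log 2) h fun a b hab => ?_⟩
    · exact ENNReal.mul_lt_top hC (ENNReal.pow_lt_top (geo_lt_top (mul_pos (by linarith) hL)))
    · obtain ⟨h1, h2, h3⟩ := hk a b hab
      obtain ⟨j, hj1, hj2, hj3, hj4⟩ := exists_dyadic (one_le_jap ‖a.2 + b.2‖)
      refine ⟨j, ⟨hab, hj1, hj2⟩, (h3 j hj1 hj2).trans (le_of_eq ?_)⟩
      congr 2; ring

lemma mul_abs_bound {β x y L : ℝ} (hL : 0 ≤ L) (h1 : y ≤ x) (h2 : x ≤ L + y) :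
    β * x ≤ |β| * L + β * y := by
  have : β * (x - y) ≤ |β| * L := by
    refine (le_abs_self _).trans ?_
    rw [abs_mul]
    exact mul_le_mul_of_nonneg_left (abs_le.2 ⟨by linarith, by linarith⟩) (abs_nonneg _)
  linarith

lemma parallel {β α c : ℝ} (hp : 1 < p) (hs : s = 1 ∨ s = -1) (hα : 0 ≤ α) (hβα : β ≤ α)
    (hne : ¬ (α = 0 ∧ β = 0))
    (hk : ∀ a b, E a b → (b.2 ≠ 0 ∧ 4 * ‖a.2 + b.2‖ ≤ ‖a.2‖ ∧ 4 * ‖a.2 + b.2‖ ≤ ‖b.2‖ ∧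
      |nu a - nu b| ≤ c) ∧
      k a b ^ 2 ≤ Real.exp (2 * (D + β * nu (a + b) - α * nu a - nu (a + b)) +
        -p * lam s a + -p * lam s b)) : Dom k E := by
  refine nested (c := c) (ρ := β) (α := α) hα hβα hne
    (C := ENNReal.ofReal (16 * Real.exp (2 * (D + |β| * Real.log 2))) * jpInt p ^ 2) ?_
    (m := fun j a b => Real.exp (D + |β| * Real.log 2 - j * Real.log 2 +
      -p / 2 * lam s a + -p / 2 * lam s b)) (fun j a b => (Real.exp_pos _).le)
    (fun j => Dominated.of_parallel_sum (n := 2 ^ j) hs (by positivity) (Real.exp_pos _).le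
      fun a b hab => ⟨⟨(hk a b hab.1).1.1, ?_, (hk a b hab.1).1.2.1, (hk a b hab.1).1.2.2.1⟩, ?_⟩)
    fun a b hab => ?_
  · exact ENNReal.mul_lt_top ENNReal.ofReal_lt_top (ENNReal.pow_lt_top (jpInt_lt_top hp))
  · have := (le_abs_self _).trans (abs_le_jap ‖a.2 + b.2‖)
    have h2 := hab.2.2
    rw [pow_succ] at h2
    linarith
  · rw [exp_sq, ← exp_lam, ← exp_lam, ← inv_pow, ← exp_neg_natCast_mul_log_two, exp_sq,
      ← Real.exp_add, ← Real.exp_add, ← Real.exp_add]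
    exact le_of_eq (by congr 1; ring)
  · obtain ⟨⟨h1, h2, h3, h4⟩, h5⟩ := hk a b hab
    refine ⟨nu_mono ?_, h4, fun j hj1 hj2 => (le_exp_half h5).trans ?_⟩
    · show ‖a.2 + b.2‖ ≤ _
      linarith [norm_nonneg (a.2 + b.2)]
    · rw [← Real.exp_add, Real.exp_le_exp]
      have e1 := Real.log_le_log (by positivity) hj1
      have e2 := Real.log_le_log (jap_pos _) hj2.le
      rw [Real.log_pow] at e1 e2
      push_cast at e2
      have e3 := mul_abs_bound (β := β) (Real.log_pos one_lt_two).le (x := nu (a + b)) e1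
        (show nu (a + b) ≤ _ by rw [nu, Prod.snd_add]; linarith)
      have e4 : j * Real.log 2 ≤ nu (a + b) := e1
      linarith

lemma inv_norm_bound {n : ℝ} (hn : 0 < n) {a : Ph} (ha : a.2 ≠ 0) :
    n⁻¹ * Real.exp (-nu a) ≤ (n * ‖a.2‖)⁻¹ := by
  rw [nu, Real.exp_neg, Real.exp_log (jap_pos _), ← mul_inv]
  have h0 := norm_pos_iff.2 ha
  exact inv_anti₀ (by positivity)
    (mul_le_mul_of_nonneg_left ((le_abs_self _).trans (abs_le_jap _)) hn.le)

lemma slab_sum {β α ε c : ℝ} (hp : 1 < p) (hε : 0 < ε) (hs' : s' = 1 ∨ s' = -1) (hα : 0 < α)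
    (hβα : β ≤ α)
    (hk : ∀ a b, E a b → (a.2 + b.2 ≠ 0 ∧ 4 * ‖a.2 + b.2‖ ≤ ‖a.2‖ ∧ 4 * ‖a.2 + b.2‖ ≤ ‖b.2‖ ∧
      |nu a - nu b| ≤ c ∧ 0 < par a.2 b.2) ∧
      k a b ^ 2 ≤ Real.exp (2 * (D + ε * sn a b + β * nu (a + b) - α * nu a) - nu (a + b) - nu a +
        -p * lam s a + -p * lam s' b)) : Dom k E := by
  have hL : 0 < Real.log 2 := Real.log_pos one_lt_two
  set D' := D + |β| * Real.log 2 with hD'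
  refine nested (c := c) (ρ := β) (α := α) hα.le hβα (fun h => hα.ne' h.1)
    (C := ENNReal.ofReal (214 * Real.exp (2 * D')) * jpInt p ^ 2 * geo (ε * Real.log 2) ^ 2) ?_
    (m := fun j a b => Real.exp (D' + ε * sn a b - j * Real.log 2 / 2 - nu a / 2 +
      -p / 2 * lam s a + -p / 2 * lam s' b)) (fun j a b => (Real.exp_pos _).le)
    (fun j => Dominated.of_geometric (kn := fun m a b => Real.exp (D' - j * Real.log 2 / 2 -
      nu a / 2 + -p / 2 * lam s a + -p / 2 * lam s' b)) (En := fun m a b =>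
      (E a b ∧ (2:ℝ) ^ j ≤ jap ‖a.2 + b.2‖ ∧ jap ‖a.2 + b.2‖ < 2 ^ (j + 1)) ∧
      (1 / 2 : ℝ) ^ (m + 1) * (‖a.2‖ * ‖b.2‖) < par a.2 b.2 ∧
      par a.2 b.2 ≤ 2 * (1 / 2 : ℝ) ^ (m + 1) * (‖a.2‖ * ‖b.2‖))
      (fun m => Dominated.of_slab_sum (s := s) (n := 2 ^ j) (A := (1 / 2 : ℝ) ^ (m + 1)) hs'
        (by positivity) (by positivity) (Real.exp_pos _).le
        fun a b hab => ?_) fun a b hab => ?_) fun a b hab => ?_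
  · exact ENNReal.mul_lt_top (ENNReal.mul_lt_top ENNReal.ofReal_lt_top
      (ENNReal.pow_lt_top (jpInt_lt_top hp))) (ENNReal.pow_lt_top (geo_lt_top (mul_pos hε hL)))
  · obtain ⟨⟨h1, h2, h3, h4, h5⟩, -⟩ := hk a b hab.1.1
    have ha : a.2 ≠ 0 := by
      have := norm_pos_iff.2 h1
      exact norm_pos_iff.1 (by linarith)
    refine ⟨⟨h1, ?_, h3, hab.2⟩, ?_⟩
    · have := (le_abs_self _).trans (abs_le_jap ‖a.2 + b.2‖)
      have h2 := hab.1.2.2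
      rw [pow_succ] at h2
      linarith
    · rw [exp_sq, ← exp_lam, ← exp_lam]
      refine le_trans (le_of_eq ?_) (mul_le_mul_of_nonneg_right (mul_le_mul_of_nonneg_left
        (inv_norm_bound (by positivity) ha) (Real.exp_pos _).le) (by positivity))
      rw [← exp_neg_natCast_mul_log_two]
      simp only [← Real.exp_add]
      congr 1; ring
  · obtain ⟨⟨h1, h2, h3, h4, h5⟩, -⟩ := hk a b hab.1
    obtain ⟨m, hm1, hm2, hm3⟩ := exists_window h5
    refine ⟨m, ⟨hab, hm1, hm2⟩, ?_⟩
    rw [← Real.exp_add, Real.exp_le_exp]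
    nlinarith
  · obtain ⟨⟨h1, h2, h3, h4, h5⟩, h6⟩ := hk a b hab
    refine ⟨nu_mono ?_, h4, fun j hj1 hj2 => (le_exp_half h6).trans ?_⟩
    · show ‖a.2 + b.2‖ ≤ _
      linarith [norm_nonneg (a.2 + b.2)]
    · rw [← Real.exp_add, Real.exp_le_exp]
      have e1 := Real.log_le_log (by positivity) hj1
      have e2 := Real.log_le_log (jap_pos _) hj2.le
      rw [Real.log_pow] at e1 e2
      push_cast at e2
      have e3 := mul_abs_bound (β := β) hL.le (x := nu (a + b)) e1
        (show nu (a + b) ≤ _ by rw [nu, Prod.snd_add]; linarith)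
      have e4 : j * Real.log 2 ≤ nu (a + b) := e1
      linarith

lemma slab_left {ε ρ : ℝ} (hp : 1 < p) (hε : 0 < ε) (hρ : 0 < ρ) (hs : s = 1 ∨ s = -1)
    (hk : ∀ a b, E a b → (a.2 + b.2 ≠ 0 ∧ 1 ≤ ‖a.2‖ ∧ 0 < par a.2 b.2) ∧
      k a b ^ 2 ≤ Real.exp (2 * (D + ε * sn a b - ρ * nu a) - nu (a + b) - nu a +
        -p * lam s₀ (a + b) + -p * lam s b)) : Dom k E := by
  have hL : 0 < Real.log 2 := Real.log_pos one_lt_two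
  refine ⟨_, ?_, Dominated.of_geometric (ρ := ρ * Real.log 2) (C :=
    ENNReal.ofReal (256 * Real.exp (2 * D)) * jpInt p ^ 2 * geo (ε * Real.log 2) ^ 2)
    (kn := fun j a b => Real.exp (D + ε * sn a b - j * Real.log 2 / 2 - nu (a + b) / 2 +
      -p / 2 * lam s₀ (a + b) + -p / 2 * lam s b))
    (En := fun j a b => E a b ∧ (2:ℝ) ^ j ≤ ‖a.2‖ ∧ ‖a.2‖ < 2 ^ (j + 1))
    (fun j => Dominated.of_geometric (kn := fun m a b => Real.exp (D - j * Real.log 2 / 2 -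
      nu (a + b) / 2 + -p / 2 * lam s₀ (a + b) + -p / 2 * lam s b)) (En := fun m a b =>
      (E a b ∧ (2:ℝ) ^ j ≤ ‖a.2‖ ∧ ‖a.2‖ < 2 ^ (j + 1)) ∧
      (1 / 2 : ℝ) ^ (m + 1) * (‖a.2‖ * ‖b.2‖) < par a.2 b.2 ∧
      par a.2 b.2 ≤ 2 * (1 / 2 : ℝ) ^ (m + 1) * (‖a.2‖ * ‖b.2‖))
      (fun m => Dominated.of_slab_left (s0 := s₀) (n := 2 ^ j) (A := (1 / 2 : ℝ) ^ (m + 1)) hs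
        (by positivity) (by positivity) (Real.exp_pos _).le
        fun a b hab => ?_) fun a b hab => ?_) fun a b hab => ?_⟩
  · exact ENNReal.mul_lt_top (ENNReal.mul_lt_top (ENNReal.mul_lt_top ENNReal.ofReal_lt_top
      (ENNReal.pow_lt_top (jpInt_lt_top hp))) (ENNReal.pow_lt_top (geo_lt_top (mul_pos hε hL))))
      (ENNReal.pow_lt_top (geo_lt_top (mul_pos hρ hL)))
  · obtain ⟨⟨h1, h2, h3⟩, -⟩ := hk a b hab.1.1
    refine ⟨⟨hab.1.2.1, ?_, hab.2⟩, ?_⟩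
    · have h2 := hab.1.2.2
      rw [pow_succ] at h2
      linarith
    · rw [exp_sq, ← exp_lam]
      have e : jap (-(a.1 + b.1) + s₀ * ‖a.2 + b.2‖) ^ (-p) = Real.exp (-p * lam s₀ (a + b)) := by
        rw [exp_lam]; rfl
      rw [e]
      refine le_trans (le_of_eq ?_) (mul_le_mul_of_nonneg_right (mul_le_mul_of_nonneg_left
        (inv_norm_bound (a := a + b) (by positivity) h1) (Real.exp_pos _).le) (by positivity))
      rw [← exp_neg_natCast_mul_log_two]
      simp only [← Real.exp_add]
      congr 1; ring
  · obtain ⟨⟨h1, h2, h3⟩, -⟩ := hk a b hab.1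
    obtain ⟨m, hm1, hm2, hm3⟩ := exists_window h3
    refine ⟨m, ⟨hab, hm1, hm2⟩, ?_⟩
    rw [← Real.exp_add, Real.exp_le_exp]
    nlinarith
  · obtain ⟨⟨h1, h2, h3⟩, h6⟩ := hk a b hab
    obtain ⟨j, hj1, hj2, hj3, hj4⟩ := exists_dyadic h2
    refine ⟨j, ⟨hab, hj1, hj2⟩, (le_exp_half h6).trans ?_⟩
    rw [← Real.exp_add, Real.exp_le_exp]
    have e1 : j * Real.log 2 ≤ nu a := hj3.trans
      (Real.log_le_log (by linarith) ((le_abs_self _).trans (abs_le_jap _)))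
    nlinarith

end Dom

/-! ## Pointwise bounds for the angle -/

/-- The angle between the signed spatial frequencies. -/
def ang (s₁ s₂ : ℝ) (a b : Ph) : ℝ := InnerProductGeometry.angle (s₁ • a.2) (s₂ • b.2)

/-- The largest of the three modulation exponents. -/
def lamMax (s₀ s₁ s₂ : ℝ) (a b : Ph) : ℝ := max (lam s₀ (a + b)) (max (lam s₁ a) (lam s₂ b))

section Angle

variable {s₀ s₁ s₂ : ℝ} {a b : Ph}

lemma ang_nonneg : 0 ≤ ang s₁ s₂ a b := InnerProductGeometry.angle_nonneg _ _

lemma ang_sq_le : ang s₁ s₂ a b ^ 2 ≤ 10 := by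
  have h := InnerProductGeometry.angle_le_pi (s₁ • a.2) (s₂ • b.2)
  have h0 : 0 ≤ ang s₁ s₂ a b := ang_nonneg
  have h1 : ang s₁ s₂ a b ≤ 3.15 := h.trans Real.pi_lt_d2.le
  nlinarith

lemma ang_comm : ang s₁ s₂ a b = ang s₂ s₁ b a := InnerProductGeometry.angle_comm _ _

lemma ang_sq_le_cos : ang s₁ s₂ a b ^ 2 / 5 ≤ 1 - Real.cos (ang s₁ s₂ a b) := by
  have h0 : 0 ≤ ang s₁ s₂ a b := ang_nonneg
  have h := InnerProductGeometry.angle_le_pi (s₁ • a.2) (s₂ • b.2)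
  have h1 := Real.cos_le_one_sub_mul_cos_sq (x := ang s₁ s₂ a b) (by rwa [abs_of_nonneg h0])
  have h2 : (1:ℝ) / 5 ≤ 2 / Real.pi ^ 2 := by
    rw [div_le_div_iff₀ (by norm_num) (by positivity)]
    nlinarith [Real.pi_lt_d2, Real.pi_pos]
  nlinarith [mul_le_mul_of_nonneg_right h2 (sq_nonneg (ang s₁ s₂ a b))]

lemma cos_ang (h₁ : s₁ = 1 ∨ s₁ = -1) (h₂ : s₂ = 1 ∨ s₂ = -1) :
    Real.cos (ang s₁ s₂ a b) * (‖a.2‖ * ‖b.2‖) = s₁ * s₂ * ⟪a.2, b.2⟫ := by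
  have h := InnerProductGeometry.cos_angle_mul_norm_mul_norm (s₁ • a.2) (s₂ • b.2)
  rw [inner_smul_left, inner_smul_right, norm_smul, norm_smul] at h
  rcases h₁ with rfl | rfl <;> rcases h₂ with rfl | rfl <;> simp_all [ang]

lemma sin_ang (h₁ : s₁ = 1 ∨ s₁ = -1) (h₂ : s₂ = 1 ∨ s₂ = -1) :
    Real.sin (ang s₁ s₂ a b) * (‖a.2‖ * ‖b.2‖) = par a.2 b.2 := by
  have h := InnerProductGeometry.sin_angle_mul_norm_mul_norm (s₁ • a.2) (s₂ • b.2)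
  rw [real_inner_self_eq_norm_sq, real_inner_self_eq_norm_sq, inner_smul_left, inner_smul_right,
    norm_smul, norm_smul] at h
  rcases h₁ with rfl | rfl <;> rcases h₂ with rfl | rfl <;> simp_all [ang, par, sq]

lemma abs_le_jap_lamMax :
    |s₁ * ‖a.2‖ + s₂ * ‖b.2‖ - s₀ * ‖a.2 + b.2‖| ≤ 3 * Real.exp (lamMax s₀ s₁ s₂ a b) := by
  have e : ∀ (s : ℝ) (c : Ph), lam s c ≤ lamMax s₀ s₁ s₂ a b →
      |-c.1 + s * ‖c.2‖| ≤ Real.exp (lamMax s₀ s₁ s₂ a b) := fun s c h =>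
    (abs_le_jap _).trans ((Real.exp_log (jap_pos _)).symm.le.trans (Real.exp_le_exp.2 h))
  have e0 := e s₀ (a + b) (le_max_left _ _)
  have e1 := e s₁ a ((le_max_left _ _).trans (le_max_right _ _))
  have e2 := e s₂ b ((le_max_right _ _).trans (le_max_right _ _))
  simp only [Prod.fst_add, Prod.snd_add] at e0
  rw [abs_le] at *
  constructor <;> linarith [e0.1, e0.2, e1.1, e1.2, e2.1, e2.2]

lemma one_le_exp_lamMax : 1 ≤ Real.exp (lamMax s₀ s₁ s₂ a b) :=
  Real.one_le_exp ((lam_nonneg s₀ (a + b)).trans (le_max_left _ _))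

lemma one_sub_cos_mul_le_of_opp (h₀ : s₀ = 1 ∨ s₀ = -1) (h₁ : s₁ = 1 ∨ s₁ = -1)
    (h₂ : s₂ = -s₁) :
    (1 - Real.cos (ang s₁ s₂ a b)) * (‖a.2‖ * ‖b.2‖) ≤
      3 * Real.exp (lamMax s₀ s₁ s₂ a b) * ‖a.2 + b.2‖ := by
  have hc := cos_ang (a := a) (b := b) h₁ (show s₂ = 1 ∨ s₂ = -1 by rcases h₁ with rfl | rfl <;> simp [h₂])
  have hss : s₁ * s₂ = -1 := by rcases h₁ with rfl | rfl <;> simp [h₂]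
  have hL := abs_le_jap_lamMax (s₀ := s₀) (s₁ := s₁) (s₂ := s₂) (a := a) (b := b)
  have hR := norm_add_sq_real a.2 b.2
  have hd := abs_norm_sub_norm_le a.2 (-b.2)
  rw [norm_neg, sub_neg_eq_add] at hd
  have n0 := norm_nonneg (a.2 + b.2)
  rw [sub_mul, hc, one_mul, hss]
  have hL0 := Real.exp_pos (lamMax s₀ s₁ s₂ a b)
  generalize Real.exp (lamMax s₀ s₁ s₂ a b) = L at *
  generalize ⟪a.2, b.2⟫ = i at *
  generalize ‖a.2 + b.2‖ = R at *
  generalize ‖a.2‖ = x at *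
  generalize ‖b.2‖ = y at *
  have h : R - |x - y| ≤ 3 * L := by
    rw [abs_le] at hL
    have e1 := le_abs_self (x - y)
    have e2 := neg_le_abs (x - y)
    subst h₂
    rcases h₀ with rfl | rfl <;> rcases h₁ with rfl | rfl <;> linarith [hL.1, hL.2]
  have h0 := abs_nonneg (x - y)
  have hsq := sq_abs (x - y)
  generalize |x - y| = d at *
  nlinarith [mul_nonneg (sub_nonneg.2 h) (add_nonneg n0 h0), mul_nonneg hL0.le (sub_nonneg.2 hd)]

lemma one_sub_cos_mul_le (h₀ : s₀ = 1 ∨ s₀ = -1) (h₁ : s₁ = 1 ∨ s₁ = -1)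
    (h₂ : s₂ = 1 ∨ s₂ = -1) :
    (1 - Real.cos (ang s₁ s₂ a b)) * (‖a.2‖ * ‖b.2‖) ≤
      3 * Real.exp (lamMax s₀ s₁ s₂ a b) * (‖a.2‖ + ‖b.2‖) := by
  have ht := norm_add_le a.2 b.2
  have hL0 := Real.exp_pos (lamMax s₀ s₁ s₂ a b)
  by_cases hs : s₂ = -s₁
  · exact (one_sub_cos_mul_le_of_opp h₀ h₁ hs).trans
      (mul_le_mul_of_nonneg_left ht (by positivity))
  have hss : s₁ = s₂ := by rcases h₁ with rfl | rfl <;> rcases h₂ with rfl | rfl <;> simp_all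
  subst hss
  have hc := cos_ang (a := a) (b := b) h₁ h₁
  have hss : s₁ * s₁ = 1 := by rcases h₁ with rfl | rfl <;> simp
  have hL := abs_le_jap_lamMax (s₀ := s₀) (s₁ := s₁) (s₂ := s₁) (a := a) (b := b)
  have hR := norm_add_sq_real a.2 b.2
  have n1 := norm_nonneg a.2
  have n2 := norm_nonneg b.2
  have n0 := norm_nonneg (a.2 + b.2)
  rw [sub_mul, hc, one_mul, hss]
  generalize Real.exp (lamMax s₀ s₁ s₁ a b) = L at *
  generalize ⟪a.2, b.2⟫ = i at *
  generalize ‖a.2 + b.2‖ = R at *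
  generalize ‖a.2‖ = x at *
  generalize ‖b.2‖ = y at *
  have h : x + y - R ≤ 3 * L := by
    rw [abs_le] at hL
    rcases h₀ with rfl | rfl <;> rcases h₁ with rfl | rfl <;> linarith [hL.1, hL.2]
  nlinarith [mul_nonneg (sub_nonneg.2 h) (add_nonneg (add_nonneg n1 n2) n0),
    mul_nonneg hL0.le (sub_nonneg.2 ht)]

lemma ang_sq_mul_min_le (h₀ : s₀ = 1 ∨ s₀ = -1) (h₁ : s₁ = 1 ∨ s₁ = -1)
    (h₂ : s₂ = 1 ∨ s₂ = -1) :
    ang s₁ s₂ a b ^ 2 * min ‖a.2‖ ‖b.2‖ ≤ 30 * Real.exp (lamMax s₀ s₁ s₂ a b) := by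
  have hc := one_sub_cos_mul_le (a := a) (b := b) h₀ h₁ h₂
  have hq := ang_sq_le_cos (s₁ := s₁) (s₂ := s₂) (a := a) (b := b)
  have hθ := sq_nonneg (ang s₁ s₂ a b)
  have n1 := norm_nonneg a.2
  have n2 := norm_nonneg b.2
  have hL0 := Real.exp_pos (lamMax s₀ s₁ s₂ a b)
  generalize Real.exp (lamMax s₀ s₁ s₂ a b) = L at *
  generalize Real.cos (ang s₁ s₂ a b) = c at *
  generalize ang s₁ s₂ a b ^ 2 = q at *
  generalize ‖a.2‖ = x at *
  generalize ‖b.2‖ = y at *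
  have hm : min x y * (x + y) ≤ 2 * (x * y) := by
    rcases le_total x y with h | h
    · rw [min_eq_left h]; nlinarith
    · rw [min_eq_right h]; nlinarith
  rcases (add_nonneg n1 n2).eq_or_lt with h0 | h0
  · have h1 : x = 0 := by linarith
    have h2 : y = 0 := by linarith
    simp only [h1, h2, min_self, mul_zero]
    positivity
  refine le_of_mul_le_mul_right ?_ h0
  nlinarith [mul_le_mul_of_nonneg_left hm hθ, mul_le_mul_of_nonneg_right hq (mul_nonneg n1 n2)]

lemma two_log_ang_add_min_le (h₀ : s₀ = 1 ∨ s₀ = -1) (h₁ : s₁ = 1 ∨ s₁ = -1)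
    (h₂ : s₂ = 1 ∨ s₂ = -1) (hθ : 0 < ang s₁ s₂ a b) :
    2 * Real.log (ang s₁ s₂ a b) + min (nu a) (nu b) ≤
      Real.log 40 + lamMax s₀ s₁ s₂ a b := by
  have key : ang s₁ s₂ a b ^ 2 * min (jap ‖a.2‖) (jap ‖b.2‖) ≤
      40 * Real.exp (lamMax s₀ s₁ s₂ a b) := by
    have h := ang_sq_mul_min_le (a := a) (b := b) h₀ h₁ h₂
    have hq := ang_sq_le (s₁ := s₁) (s₂ := s₂) (a := a) (b := b)
    have hL := one_le_exp_lamMax (s₀ := s₀) (s₁ := s₁) (s₂ := s₂) (a := a) (b := b)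
    have hj : min (jap ‖a.2‖) (jap ‖b.2‖) ≤ 1 + min ‖a.2‖ ‖b.2‖ := by
      rw [← min_add_add_left]
      have := jap_le_one_add_abs ‖a.2‖
      have := jap_le_one_add_abs ‖b.2‖
      simp only [abs_norm] at *
      exact min_le_min (by assumption) (by assumption)
    nlinarith [mul_le_mul_of_nonneg_left hj (sq_nonneg (ang s₁ s₂ a b))]
  have hl := Real.log_le_log (mul_pos (pow_pos hθ 2) (lt_min (jap_pos _) (jap_pos _))) key
  rw [Real.log_mul (by positivity) (lt_min (jap_pos _) (jap_pos _)).ne', Real.log_pow,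
    Real.log_mul (by norm_num) (Real.exp_pos _).ne', Real.log_exp] at hl
  refine le_trans (le_of_eq ?_) hl
  rcases le_total (jap ‖a.2‖) (jap ‖b.2‖) with h | h
  · rw [min_eq_left h, min_eq_left (show nu a ≤ nu b from Real.log_le_log (jap_pos _) h)]
    simp [nu]
  · rw [min_eq_right h, min_eq_right (show nu b ≤ nu a from Real.log_le_log (jap_pos _) h)]
    simp [nu]

lemma two_log_ang_le (hθ : 0 < ang s₁ s₂ a b) : 2 * Real.log (ang s₁ s₂ a b) ≤ Real.log 40 := by
  have := Real.log_le_log (pow_pos hθ 2) (ang_sq_le.trans (by norm_num : (10:ℝ) ≤ 40))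
  rwa [Real.log_pow, Nat.cast_ofNat] at this

lemma par_pos_of_ang (h₁ : s₁ = 1 ∨ s₁ = -1) (h₂ : s₂ = 1 ∨ s₂ = -1)
    (ha : a.2 ≠ 0) (hb : b.2 ≠ 0) (hθ : 0 < ang s₁ s₂ a b) (hπ : ang s₁ s₂ a b < Real.pi) :
    0 < par a.2 b.2 := by
  rw [← sin_ang h₁ h₂]
  exact mul_pos (Real.sin_pos_of_pos_of_lt_pi hθ hπ)
    (mul_pos (norm_pos_iff.2 ha) (norm_pos_iff.2 hb))

/-- For opposite signs and a relatively low output frequency the angle is acute, and it is small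
relative to the output frequency and modulations. -/
lemma log_ang_bounds_of_opp (h₀ : s₀ = 1 ∨ s₀ = -1) (h₁ : s₁ = 1 ∨ s₁ = -1) (h₂ : s₂ = -s₁)
    (ha : 4 * ‖a.2 + b.2‖ ≤ ‖a.2‖) (hb : 4 * ‖a.2 + b.2‖ ≤ ‖b.2‖)
    (ha0 : a.2 ≠ 0) (hb0 : b.2 ≠ 0) (hθ : 0 < ang s₁ s₂ a b) :
    0 < par a.2 b.2 ∧ Real.log (ang s₁ s₂ a b) ≤ Real.log 40 + sn a b ∧
    2 * Real.log (ang s₁ s₂ a b) + nu a + nu b ≤ Real.log 80 + 2 * nu (a + b) ∧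
    2 * Real.log (ang s₁ s₂ a b) + nu a + nu b ≤
      Real.log 80 + nu (a + b) + lamMax s₀ s₁ s₂ a b := by
  have h₂' : s₂ = 1 ∨ s₂ = -1 := by rcases h₁ with rfl | rfl <;> simp [h₂]
  have hss : s₁ * s₂ = -1 := by rcases h₁ with rfl | rfl <;> simp [h₂]
  have hc := cos_ang (a := a) (b := b) h₁ h₂'
  rw [hss] at hc
  have hs := sin_ang (a := a) (b := b) h₁ h₂'
  have hR := norm_add_sq_real a.2 b.2
  have n1 : 0 < ‖a.2‖ := norm_pos_iff.2 ha0
  have n2 : 0 < ‖b.2‖ := norm_pos_iff.2 hb0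
  have n0 := norm_nonneg (a.2 + b.2)
  have hcos : 0 < Real.cos (ang s₁ s₂ a b) := by
    refine pos_of_mul_pos_left (b := ‖a.2‖ * ‖b.2‖) ?_ (mul_pos n1 n2).le
    rw [hc]
    nlinarith [sq_nonneg (‖a.2‖ - ‖b.2‖), mul_pos n1 n2]
  have hπ : ang s₁ s₂ a b < Real.pi / 2 := by
    by_contra! h
    exact absurd hcos (not_lt.2 (Real.cos_nonpos_of_pi_div_two_le_of_le h
      ((InnerProductGeometry.angle_le_pi _ _).trans (by linarith [Real.pi_pos]))))
  have hsin : ang s₁ s₂ a b / 2 ≤ Real.sin (ang s₁ s₂ a b) := by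
    refine le_trans ?_ (Real.mul_le_sin hθ.le hπ.le)
    rw [div_eq_inv_mul]
    refine mul_le_mul_of_nonneg_right ?_ hθ.le
    rw [inv_eq_one_div, div_le_div_iff₀ (by norm_num) Real.pi_pos]
    linarith [Real.pi_le_four]
  have hj : jap ‖a.2‖ * jap ‖b.2‖ ≤ 2 + 9 / 4 * (‖a.2‖ * ‖b.2‖) := by
    have j1 := jap_le_one_add_abs ‖a.2‖
    have j2 := jap_le_one_add_abs ‖b.2‖
    rw [abs_norm] at j1 j2
    have hd := abs_norm_sub_norm_le a.2 (-b.2)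
    rw [norm_neg, sub_neg_eq_add, abs_le] at hd
    have := mul_le_mul j1 j2 (jap_pos _).le (by linarith)
    nlinarith [sq_nonneg (‖a.2‖ - 1), sq_nonneg (‖b.2‖ - 1), hd.1, hd.2]
  have hq := ang_sq_le_cos (s₁ := s₁) (s₂ := s₂) (a := a) (b := b)
  have hq' := ang_sq_le (s₁ := s₁) (s₂ := s₂) (a := a) (b := b)
  have hL := one_le_exp_lamMax (s₀ := s₀) (s₁ := s₁) (s₂ := s₂) (a := a) (b := b)
  have hopp := one_sub_cos_mul_le_of_opp (a := a) (b := b) h₀ h₁ h₂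
  have hd := abs_norm_sub_norm_le a.2 (-b.2)
  rw [norm_neg, sub_neg_eq_add] at hd
  have j0 : ‖a.2 + b.2‖ ≤ jap ‖a.2 + b.2‖ := (le_abs_self _).trans (abs_le_jap _)
  have j1 := one_le_jap ‖a.2 + b.2‖
  have hqj := mul_le_mul_of_nonneg_left hj (sq_nonneg (ang s₁ s₂ a b))
  have hqc := mul_le_mul_of_nonneg_right hq (mul_pos n1 n2).le
  have b1 : ang s₁ s₂ a b ^ 2 * (jap ‖a.2‖ * jap ‖b.2‖) ≤ 80 * jap ‖a.2 + b.2‖ ^ 2 := by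
    have : (1 - Real.cos (ang s₁ s₂ a b)) * (‖a.2‖ * ‖b.2‖) ≤ ‖a.2 + b.2‖ ^ 2 / 2 := by
      rw [sub_mul, hc]
      nlinarith [sq_nonneg (‖a.2‖ - ‖b.2‖)]
    nlinarith
  have b2 : ang s₁ s₂ a b ^ 2 * (jap ‖a.2‖ * jap ‖b.2‖) ≤
      80 * (jap ‖a.2 + b.2‖ * Real.exp (lamMax s₀ s₁ s₂ a b)) := by
    have h1 : 1 ≤ jap ‖a.2 + b.2‖ * Real.exp (lamMax s₀ s₁ s₂ a b) := one_le_mul_of_one_le_of_one_le j1 hL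
    have h2 := mul_le_mul_of_nonneg_right j0 (zero_le_one.trans hL)
    nlinarith
  have hpos : 0 < ang s₁ s₂ a b ^ 2 * (jap ‖a.2‖ * jap ‖b.2‖) :=
    mul_pos (pow_pos hθ 2) (mul_pos (jap_pos _) (jap_pos _))
  have hlog : Real.log (ang s₁ s₂ a b ^ 2 * (jap ‖a.2‖ * jap ‖b.2‖)) =
      2 * Real.log (ang s₁ s₂ a b) + nu a + nu b := by
    rw [Real.log_mul (by positivity) (mul_pos (jap_pos _) (jap_pos _)).ne', Real.log_pow,
      Real.log_mul (jap_pos _).ne' (jap_pos _).ne', ← add_assoc]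
    rfl
  have hpar : 0 < par a.2 b.2 :=
    par_pos_of_ang h₁ h₂' ha0 hb0 hθ (hπ.trans (by linarith [Real.pi_pos]))
  refine ⟨hpar, ?_, ?_, ?_⟩
  · have e : par a.2 b.2 / (‖a.2‖ * ‖b.2‖) = Real.sin (ang s₁ s₂ a b) := by
      rw [← hs, mul_div_cancel_right₀ _ (mul_pos n1 n2).ne']
    rw [sn, e, ← Real.log_mul (by norm_num) (by linarith)]
    exact Real.log_le_log hθ (by linarith)
  · rw [← hlog]
    refine (Real.log_le_log hpos b1).trans (le_of_eq ?_)
    rw [Real.log_mul (by norm_num) (pow_pos (jap_pos _) 2).ne', Real.log_pow]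
    rfl
  · rw [← hlog]
    refine (Real.log_le_log hpos b2).trans (le_of_eq ?_)
    rw [Real.log_mul (by norm_num) (mul_pos (jap_pos _) (Real.exp_pos _)).ne',
      Real.log_mul (jap_pos _).ne' (Real.exp_pos _).ne', Real.log_exp, ← add_assoc]
    rfl

end Angle

/-! ## The null form kernel -/

/-- The weighted kernel of the null form, relative to the cones of signs `s₀`, `s₁`, `s₂`. -/
def ker (σ₀ σ₁ σ₂ β₀ β₁ β₂ s₀ s₁ s₂ : ℝ) (a b : Ph) : ℝ :=
  ang s₁ s₂ a b * Real.exp (-(σ₀ * nu (a + b) + σ₁ * nu a + σ₂ * nu b +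
    β₀ * lam s₀ (a + b) + β₁ * lam s₁ a + β₂ * lam s₂ b))

/-- Non-degenerate pairs of frequencies. -/
def Reg (s₁ s₂ : ℝ) (a b : Ph) : Prop :=
  a.2 ≠ 0 ∧ b.2 ≠ 0 ∧ a.2 + b.2 ≠ 0 ∧ 0 < ang s₁ s₂ a b

/-- Admissible exponents, together with a modulation exponent `p`. -/
structure Adm (σ₀ σ₁ σ₂ β₀ β₁ β₂ p : ℝ) : Prop where
  one_lt : 1 < p
  b0 : 0 ≤ β₀
  b0' : 2 * β₀ < 1
  b1 : p < 2 * β₁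
  b1' : β₁ < 1
  b2 : p < 2 * β₂
  b2' : β₂ < 1
  sum_pos : p < 2 * (σ₀ + σ₁ + σ₂)
  mod1 : 2 + p < 2 * (σ₀ + σ₁ + σ₂) + 2 * β₀ + 2 * β₁
  mod2 : 2 + p < 2 * (σ₀ + σ₁ + σ₂) + 2 * β₀ + 2 * β₂
  far1 : 2 + p < 4 * (σ₀ + σ₂) + 2 * σ₁ + 2 * β₁
  far2 : 2 + p < 4 * (σ₀ + σ₁) + 2 * σ₂ + 2 * β₂
  one_le : 1 ≤ σ₀ + σ₁ + σ₂ + β₀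
  s01 : 0 ≤ σ₀ + σ₁
  s02 : 0 ≤ σ₀ + σ₂
  s12 : 0 ≤ β₀ + σ₁ + σ₂
  ne01 : ¬(σ₀ + σ₁ + σ₂ + β₀ = 1 ∧ σ₀ + σ₁ = 0)
  ne02 : ¬(σ₀ + σ₁ + σ₂ + β₀ = 1 ∧ σ₀ + σ₂ = 0)
  ne12 : ¬(σ₀ + σ₁ + σ₂ + β₀ = 1 ∧ β₀ + σ₁ + σ₂ = 0)

section

variable {σ₀ σ₁ σ₂ β₀ β₁ β₂ p s₀ s₁ s₂ : ℝ} {a b : Ph}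

lemma Adm.swap (h : Adm σ₀ σ₁ σ₂ β₀ β₁ β₂ p) : Adm σ₀ σ₂ σ₁ β₀ β₂ β₁ p := by
  have e : σ₀ + σ₂ + σ₁ = σ₀ + σ₁ + σ₂ := by ring
  have e' : β₀ + σ₂ + σ₁ = β₀ + σ₁ + σ₂ := by ring
  obtain ⟨⟩ := h
  constructor <;> (try rw [e]) <;> (try rw [e']) <;> assumption

lemma ker_swap : ker σ₀ σ₁ σ₂ β₀ β₁ β₂ s₀ s₁ s₂ b a = ker σ₀ σ₂ σ₁ β₀ β₂ β₁ s₀ s₂ s₁ a b := by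
  rw [ker, ker, ang_comm, add_comm b a]
  congr 3
  ring

lemma Reg.swap (h : Reg s₁ s₂ b a) : Reg s₂ s₁ a b :=
  ⟨h.2.1, h.1, by rw [add_comm]; exact h.2.2.1, by rw [ang_comm]; exact h.2.2.2⟩

lemma ker_sq_le {R : ℝ} (hR : Reg s₁ s₂ a b)
    (h : 2 * Real.log (ang s₁ s₂ a b) - 2 * (σ₀ * nu (a + b) + σ₁ * nu a + σ₂ * nu b +
      β₀ * lam s₀ (a + b) + β₁ * lam s₁ a + β₂ * lam s₂ b) ≤ R) :
    ker σ₀ σ₁ σ₂ β₀ β₁ β₂ s₀ s₁ s₂ a b ^ 2 ≤ Real.exp R := by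
  rw [ker]
  nth_rw 1 [← Real.exp_log hR.2.2.2]
  rw [← Real.exp_add, ← Real.exp_nat_mul, Real.exp_le_exp]
  push_cast
  linarith

lemma neg_mul_le_abs_mul {q x y c : ℝ} (h : |x - y| ≤ c) : -(q * x) ≤ -(q * y) + |q| * c := by
  have h1 := mul_le_mul_of_nonneg_left h (abs_nonneg q)
  rw [← abs_mul] at h1
  linarith [neg_abs_le (q * (x - y))]

lemma convex_bound {u v x y δ : ℝ} (h1 : x ≤ y) (h2 : y ≤ 2 * x) (huv : u + v ≤ -δ)
    (huv' : 2 * u + v ≤ -δ) : u * y + v * x ≤ -δ * x := by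
  have hx : 0 ≤ x := by linarith
  rcases le_total u 0 with hu | hu
  · nlinarith [mul_nonneg (neg_nonneg.2 hu) (sub_nonneg.2 h1)]
  · nlinarith [mul_nonneg hu (sub_nonneg.2 h2)]

lemma abs_nu_sub_le {a b : Ph} {c : ℝ} (hc : 1 ≤ c) (h : ‖a.2‖ ≤ c * ‖b.2‖)
    (h' : ‖b.2‖ ≤ c * ‖a.2‖) : |nu a - nu b| ≤ Real.log c := by
  rw [abs_le]
  have := nu_le_of_le hc h
  have := nu_le_of_le hc h'
  constructor <;> linarith

lemma norm_triangle (a b : Ph) : ‖a.2 + b.2‖ ≤ ‖a.2‖ + ‖b.2‖ ∧ ‖a.2‖ ≤ ‖a.2 + b.2‖ + ‖b.2‖ ∧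
    ‖b.2‖ ≤ ‖a.2 + b.2‖ + ‖a.2‖ := by
  refine ⟨norm_add_le _ _, ?_, ?_⟩
  · simpa using norm_sub_le (a.2 + b.2) b.2
  · simpa using norm_sub_le (a.2 + b.2) a.2

end

namespace Dom

variable {σ₀ σ₁ σ₂ β₀ β₁ β₂ p s₀ s₁ s₂ : ℝ}

lemma of_nonpos {k : Ph → Ph → ℝ} {E : Ph → Ph → Prop} (h : ∀ a b, E a b → k a b ≤ 0) : Dom k E := by
  refine ⟨0, by simp, fun _ _ => 0, measurable_const, fun f₀ f₁ f₂ _ _ _ => by simp [triForm], ?_⟩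
  exact fun a b hab => (ENNReal.ofReal_eq_zero.2 (h a b hab)).le

lemma of_reg (h : Dom (ker σ₀ σ₁ σ₂ β₀ β₁ β₂ s₀ s₁ s₂) (Reg s₁ s₂)) :
    Dom (ker σ₀ σ₁ σ₂ β₀ β₁ β₂ s₀ s₁ s₂) fun _ _ => True := by
  refine ((h.union (of_zero fun _ _ h => h)).union
    (of_nonpos (E := fun a b => ang s₁ s₂ a b = 0) fun a b h => ?_)).mono fun a b _ => ⟨?_, le_rfl⟩
  · rw [ker, h, zero_mul]
  · rw [Reg]
    have := (ang_nonneg (s₁ := s₁) (s₂ := s₂) (a := a) (b := b)).eq_or_lt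
    tauto

/-- The output modulation dominates, and the first frequency is low. -/
lemma ker_out_low (hA : Adm σ₀ σ₁ σ₂ β₀ β₁ β₂ p) (h₀ : s₀ = 1 ∨ s₀ = -1)
    (h₁ : s₁ = 1 ∨ s₁ = -1) (h₂ : s₂ = 1 ∨ s₂ = -1) :
    Dom (ker σ₀ σ₁ σ₂ β₀ β₁ β₂ s₀ s₁ s₂) fun a b => Reg s₁ s₂ a b ∧
      (lam s₁ a ≤ lam s₀ (a + b) ∧ lam s₂ b ≤ lam s₀ (a + b)) ∧
      ‖a.2‖ ≤ ‖b.2‖ ∧ ‖a.2‖ ≤ 4 * ‖a.2 + b.2‖ := by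
  refine radial (p := p) (s := s₁) (s' := s₂) (α := -2 * (σ₀ + σ₂)) (γ := -2 * σ₁ - 2 * β₀)
    (D := Real.log 40 + 2 * |σ₂| * Real.log 5) hA.one_lt h₂ (by linarith [hA.s02])
    (by linarith [hA.one_le]) (fun h => hA.ne02 ⟨by linarith [h.1], by linarith [h.2]⟩) ?_
  rintro a b ⟨hr, ⟨hl1, hl2⟩, hab, ha⟩
  refine ⟨hr.2.2.1, ha, ker_sq_le hr ?_⟩
  have ht := norm_triangle a b
  have hm := two_log_ang_add_min_le (a := a) (b := b) h₀ h₁ h₂ hr.2.2.2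
  rw [lamMax, max_eq_left (max_le hl1 hl2), min_eq_left (nu_mono hab)] at hm
  have hm' := two_log_ang_le hr.2.2.2
  have hn : |nu b - nu (a + b)| ≤ Real.log 5 :=
    abs_nu_sub_le (by norm_num) (by simp only [Prod.snd_add]; linarith)
      (by simp only [Prod.snd_add]; linarith [norm_nonneg (a.2 + b.2)])
  have h1 := mul_nonneg (by linarith [hA.b0'] : 0 ≤ 1 - 2 * β₀) (sub_nonneg.2 hm')
  have h2 := mul_nonneg (by linarith [hA.b0] : 0 ≤ 2 * β₀) (sub_nonneg.2 hm)
  have h3 := mul_nonneg (sub_nonneg.2 hA.b1.le) (lam_nonneg s₁ a)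
  have h4 := mul_nonneg (sub_nonneg.2 hA.b2.le) (lam_nonneg s₂ b)
  have h5 := neg_mul_le_abs_mul (q := σ₂) hn
  linarith

/-- The output modulation dominates, the output frequency is low and the signs agree. -/
lemma ker_out_parallel (hA : Adm σ₀ σ₁ σ₂ β₀ β₁ β₂ p) (h₀ : s₀ = 1 ∨ s₀ = -1)
    (h₁ : s₁ = 1 ∨ s₁ = -1) :
    Dom (ker σ₀ σ₁ σ₂ β₀ β₁ β₂ s₀ s₁ s₁) fun a b => Reg s₁ s₁ a b ∧
      (lam s₁ a ≤ lam s₀ (a + b) ∧ lam s₁ b ≤ lam s₀ (a + b)) ∧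
      4 * ‖a.2 + b.2‖ ≤ ‖a.2‖ ∧ 4 * ‖a.2 + b.2‖ ≤ ‖b.2‖ := by
  refine parallel (p := p) (s := s₁) (α := β₀ + σ₁ + σ₂) (β := 1 - σ₀) (c := Real.log 2)
    (D := (Real.log 40 + (2 * |σ₂| + 2 * β₀) * Real.log 2) / 2) hA.one_lt h₁ hA.s12
    (by linarith [hA.one_le]) (fun h => hA.ne12 ⟨by linarith [h.1, h.2], h.1⟩) ?_
  rintro a b ⟨hr, ⟨hl1, hl2⟩, ha, hb⟩
  have ht := norm_triangle a b
  have hn : |nu b - nu a| ≤ Real.log 2 :=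
    abs_nu_sub_le (by norm_num) (by linarith) (by linarith)
  refine ⟨⟨hr.2.1, ha, hb, by rwa [abs_sub_comm]⟩, ker_sq_le hr ?_⟩
  have hm := two_log_ang_add_min_le (a := a) (b := b) h₀ h₁ h₁ hr.2.2.2
  rw [lamMax, max_eq_left (max_le hl1 hl2)] at hm
  have hmin : nu a - Real.log 2 ≤ min (nu a) (nu b) := by
    rw [abs_le] at hn
    exact le_min (by linarith [Real.log_nonneg (x := 2) (by norm_num)]) (by linarith [hn.1])
  have hm' := two_log_ang_le hr.2.2.2
  have h1 := mul_nonneg (by linarith [hA.b0'] : 0 ≤ 1 - 2 * β₀) (sub_nonneg.2 hm')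
  have h2 := mul_nonneg (by linarith [hA.b0] : 0 ≤ 2 * β₀)
    (sub_nonneg.2 ((add_le_add le_rfl hmin).trans hm))
  have h3 := mul_nonneg (sub_nonneg.2 hA.b1.le) (lam_nonneg s₁ a)
  have h4 := mul_nonneg (sub_nonneg.2 hA.b2.le) (lam_nonneg s₁ b)
  have h5 := neg_mul_le_abs_mul (q := σ₂) hn
  linarith

/-- The output modulation dominates, the output frequency is low and the signs are opposite. -/
lemma ker_out_opp (hA : Adm σ₀ σ₁ σ₂ β₀ β₁ β₂ p) (h₀ : s₀ = 1 ∨ s₀ = -1)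
    (h₁ : s₁ = 1 ∨ s₁ = -1) (h₂ : s₂ = -s₁) :
    Dom (ker σ₀ σ₁ σ₂ β₀ β₁ β₂ s₀ s₁ s₂) fun a b => Reg s₁ s₂ a b ∧
      (lam s₁ a ≤ lam s₀ (a + b) ∧ lam s₂ b ≤ lam s₀ (a + b)) ∧
      4 * ‖a.2 + b.2‖ ≤ ‖a.2‖ ∧ 4 * ‖a.2 + b.2‖ ≤ ‖b.2‖ := by
  have h₂' : s₂ = 1 ∨ s₂ = -1 := by rcases h₁ with rfl | rfl <;> simp [h₂]
  obtain ⟨ε, hε⟩ : ∃ ε, ε = (1 - 2 * β₀) / 4 := ⟨_, rfl⟩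
  have hε0 : 0 < ε := by linarith [hA.b0']
  refine slab_sum (p := p) (s := s₁) (s' := s₂) (α := (1 - 2 * ε + 2 * σ₁ + 2 * σ₂) / 2)
    (β := (3 - 2 * ε - 2 * β₀ - 2 * σ₀) / 2) (ε := ε) (c := Real.log 2)
    (D := (2 * ε * Real.log 40 + (1 - ε) * Real.log 80 + (2 * |σ₂| + (1 - ε)) * Real.log 2) / 2)
    hA.one_lt hε0 h₂' (by linarith [hA.s12]) (by linarith [hA.one_le]) ?_
  rintro a b ⟨hr, ⟨hl1, hl2⟩, ha, hb⟩
  have ht := norm_triangle a b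
  have hn : |nu b - nu a| ≤ Real.log 2 :=
    abs_nu_sub_le (by norm_num) (by linarith) (by linarith)
  obtain ⟨g1, g2, g3, g4⟩ := log_ang_bounds_of_opp h₀ h₁ h₂ ha hb hr.1 hr.2.1 hr.2.2.2
  refine ⟨⟨hr.2.2.1, ha, hb, by rwa [abs_sub_comm], g1⟩, ker_sq_le hr ?_⟩
  rw [lamMax, max_eq_left (max_le hl1 hl2)] at g4
  have hn' : nu a - Real.log 2 ≤ nu b := by rw [abs_le] at hn; linarith [hn.1]
  have h0 := mul_nonneg hε0.le (sub_nonneg.2 g2)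
  have h1 := mul_nonneg (by linarith [hA.b0'] : 0 ≤ 1 - ε - 2 * β₀)
    (sub_nonneg.2 ((add_le_add le_rfl hn').trans g3))
  have h2 := mul_nonneg (by linarith [hA.b0] : 0 ≤ 2 * β₀)
    (sub_nonneg.2 ((add_le_add le_rfl hn').trans g4))
  have h3 := mul_nonneg (sub_nonneg.2 hA.b1.le) (lam_nonneg s₁ a)
  have h4 := mul_nonneg (sub_nonneg.2 hA.b2.le) (lam_nonneg s₂ b)
  have h5 := neg_mul_le_abs_mul (q := σ₂) hn
  linarith

/-- The output modulation dominates. -/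
lemma ker_out (hA : Adm σ₀ σ₁ σ₂ β₀ β₁ β₂ p) (h₀ : s₀ = 1 ∨ s₀ = -1)
    (h₁ : s₁ = 1 ∨ s₁ = -1) (h₂ : s₂ = 1 ∨ s₂ = -1) :
    Dom (ker σ₀ σ₁ σ₂ β₀ β₁ β₂ s₀ s₁ s₂) fun a b => Reg s₁ s₂ a b ∧
      lam s₁ a ≤ lam s₀ (a + b) ∧ lam s₂ b ≤ lam s₀ (a + b) := by
  have hlow : Dom (ker σ₀ σ₁ σ₂ β₀ β₁ β₂ s₀ s₁ s₂) fun a b => Reg s₁ s₂ a b ∧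
      (lam s₁ a ≤ lam s₀ (a + b) ∧ lam s₂ b ≤ lam s₀ (a + b)) ∧
      4 * ‖a.2 + b.2‖ ≤ ‖a.2‖ ∧ 4 * ‖a.2 + b.2‖ ≤ ‖b.2‖ := by
    by_cases hs : s₂ = -s₁
    · exact ker_out_opp hA h₀ h₁ hs
    · have hss : s₂ = s₁ := by rcases h₁ with rfl | rfl <;> rcases h₂ with rfl | rfl <;> simp_all
      rw [hss]
      exact ker_out_parallel hA h₀ h₁
  have hsw : Dom (ker σ₀ σ₁ σ₂ β₀ β₁ β₂ s₀ s₁ s₂) fun a b => Reg s₁ s₂ a b ∧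
      (lam s₁ a ≤ lam s₀ (a + b) ∧ lam s₂ b ≤ lam s₀ (a + b)) ∧
      ‖b.2‖ ≤ ‖a.2‖ ∧ ‖b.2‖ ≤ 4 * ‖a.2 + b.2‖ := by
    refine swap ((ker_out_low hA.swap h₀ h₂ h₁).mono fun a b h => ?_)
    rw [ker_swap, add_comm a b, add_comm a.2 b.2]
    rw [add_comm b a, add_comm b.2 a.2] at *
    exact ⟨⟨h.1.swap, ⟨h.2.1.2, h.2.1.1⟩, h.2.2⟩, le_rfl⟩
  refine ((hlow.union hsw).union (ker_out_low hA h₀ h₁ h₂)).mono fun a b h => ⟨?_, le_rfl⟩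
  rcases le_total ‖a.2‖ ‖b.2‖ with h1 | h1 <;>
  by_cases h2 : 4 * ‖a.2 + b.2‖ ≤ min ‖a.2‖ ‖b.2‖
  · exact Or.inl (Or.inl ⟨h.1, h.2, le_min_iff.1 h2⟩)
  · exact Or.inr ⟨h.1, h.2, h1, by rw [min_eq_left h1] at h2; linarith⟩
  · exact Or.inl (Or.inl ⟨h.1, h.2, le_min_iff.1 h2⟩)
  · exact Or.inl (Or.inr ⟨h.1, h.2, h1, by rw [min_eq_right h1] at h2; linarith⟩)

end Dom

/-- A linear form with nonpositive slope in the output modulation, split at `l = n`. -/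
lemma modulation_dichotomy {σ β₀ β₁ p δ n l l' t : ℝ} (hn : 0 ≤ n) (hl' : l ≤ l')
    (hb : 1 ≤ 2 * β₁) (hb' : 0 ≤ 2 * β₀)
    (hl : 0 ≤ l) (h1 : δ ≤ 2 * σ + 2 * β₀ + 2 * β₁ - 3) (h2 : δ ≤ 2 * σ - 1)
    (h3 : δ ≤ 2 * σ + 2 * β₀ + 2 * β₁ - 2 - p)
    (ht : t ≤ -(1 + 2 * σ) * n + (1 - 2 * β₁) * l' - 2 * β₀ * l) :
    t ≤ -(2 + δ) * n - p * l ∨ t ≤ -(3 + δ) * n := by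
  have h4 := mul_nonneg (sub_nonneg.2 hb) (sub_nonneg.2 hl')
  rcases le_total n l with h | h
  · right
    have := mul_nonneg (by linarith : 0 ≤ 2 * β₀ + (2 * β₁ - 1)) (sub_nonneg.2 h)
    have := mul_nonneg (sub_nonneg.2 h1) hn
    linarith
  · left
    rcases le_total (p + 1 - 2 * β₀ - 2 * β₁) 0 with he | he
    · have := mul_nonneg (neg_nonneg.2 he) hl
      have := mul_nonneg (sub_nonneg.2 h2) hn
      linarith
    · have := mul_nonneg he (sub_nonneg.2 h)
      have := mul_nonneg (sub_nonneg.2 h3) hn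
      linarith

namespace Dom

variable {σ₀ σ₁ σ₂ β₀ β₁ β₂ p s₀ s₁ s₂ : ℝ}

/-- The first modulation dominates, and the second frequency is the lowest. -/
lemma ker_left_low_right (hA : Adm σ₀ σ₁ σ₂ β₀ β₁ β₂ p) (h₀ : s₀ = 1 ∨ s₀ = -1)
    (h₁ : s₁ = 1 ∨ s₁ = -1) (h₂ : s₂ = 1 ∨ s₂ = -1) :
    Dom (ker σ₀ σ₁ σ₂ β₀ β₁ β₂ s₀ s₁ s₂) fun a b => Reg s₁ s₂ a b ∧
      (lam s₀ (a + b) ≤ lam s₁ a ∧ lam s₂ b ≤ lam s₁ a) ∧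
      ‖b.2‖ ≤ ‖a.2‖ ∧ ‖b.2‖ ≤ ‖a.2 + b.2‖ := by
  obtain ⟨δ, hδ⟩ : ∃ δ, δ = min (2 * (σ₀ + σ₁ + σ₂) + 2 * β₀ + 2 * β₁ - 3)
    (min (2 * (σ₀ + σ₁ + σ₂) - 1) (2 * (σ₀ + σ₁ + σ₂) + 2 * β₀ + 2 * β₁ - 2 - p)) := ⟨_, rfl⟩
  have hp := hA.one_lt
  have hδ0 : 0 < δ := by
    rw [hδ]
    exact lt_min (by linarith [hA.mod1]) (lt_min (by linarith [hA.sum_pos]) (by linarith [hA.mod1]))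
  refine low_right (p := p) (s := s₂) (s₀ := s₀) (δ := δ)
    (D := Real.log 40 + 2 * |σ₀| * Real.log 2) hp hδ0 h₀ ?_
  rintro a b ⟨hr, ⟨hl0, hl2⟩, hba, hb0⟩
  have ht := norm_triangle a b
  refine ⟨hr.1, by linarith [norm_nonneg a.2], ?_⟩
  have hm := two_log_ang_add_min_le (a := a) (b := b) h₀ h₁ h₂ hr.2.2.2
  rw [lamMax, max_eq_left hl2, max_eq_right hl0, min_eq_right (nu_mono hba)] at hm
  have hn : |nu (a + b) - nu a| ≤ Real.log 2 :=
    abs_nu_sub_le (by norm_num) (by simp only [Prod.snd_add]; linarith)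
      (by simp only [Prod.snd_add]; linarith)
  have h4 := mul_nonneg (sub_nonneg.2 hA.b2.le) (lam_nonneg s₂ b)
  have h5 := neg_mul_le_abs_mul (q := σ₀) hn
  have h6 := mul_nonneg hA.s01 (sub_nonneg.2 (nu_mono hba))
  have := modulation_dichotomy (σ := σ₀ + σ₁ + σ₂) (β₀ := β₀) (β₁ := β₁) (p := p) (δ := δ)
    (n := nu b) (l := lam s₀ (a + b)) (l' := lam s₁ a)
    (t := 2 * Real.log (ang s₁ s₂ a b) - 2 * (σ₀ * nu (a + b) + σ₁ * nu a + σ₂ * nu b +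
      β₀ * lam s₀ (a + b) + β₁ * lam s₁ a + β₂ * lam s₂ b) -
      (Real.log 40 + 2 * |σ₀| * Real.log 2) + p * lam s₂ b)
    (nu_nonneg _) hl0 (by linarith [hA.b1]) (by linarith [hA.b0]) (lam_nonneg _ _)
    (hδ.le.trans (min_le_left _ _)) (hδ.le.trans ((min_le_right _ _).trans (min_le_left _ _)))
    (hδ.le.trans ((min_le_right _ _).trans (min_le_right _ _))) (by linarith)
  rcases this with h | h
  · exact Or.inl (ker_sq_le hr (by linarith))
  · exact Or.inr (ker_sq_le hr (by linarith))

/-- The first modulation dominates, and the output frequency is the lowest. -/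
lemma ker_left_low_sum (hA : Adm σ₀ σ₁ σ₂ β₀ β₁ β₂ p) (h₀ : s₀ = 1 ∨ s₀ = -1)
    (h₁ : s₁ = 1 ∨ s₁ = -1) (h₂ : s₂ = 1 ∨ s₂ = -1) :
    Dom (ker σ₀ σ₁ σ₂ β₀ β₁ β₂ s₀ s₁ s₂) fun a b => Reg s₁ s₂ a b ∧
      (lam s₀ (a + b) ≤ lam s₁ a ∧ lam s₂ b ≤ lam s₁ a) ∧
      ‖a.2 + b.2‖ ≤ ‖a.2‖ ∧ ‖a.2 + b.2‖ ≤ ‖b.2‖ := by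
  obtain ⟨δ, hδ⟩ : ∃ δ, δ = min (2 * (σ₀ + σ₁ + σ₂) + 2 * β₀ + 2 * β₁ - 3)
    (min (2 * (σ₀ + σ₁ + σ₂) - 1) (2 * (σ₀ + σ₁ + σ₂) + 2 * β₀ + 2 * β₁ - 2 - p)) := ⟨_, rfl⟩
  have hp := hA.one_lt
  have hδ0 : 0 < δ := by
    rw [hδ]
    exact lt_min (by linarith [hA.mod1]) (lt_min (by linarith [hA.sum_pos]) (by linarith [hA.mod1]))
  refine low_sum (p := p) (s := s₂) (s₀ := s₀) (δ := δ)
    (D := Real.log 40 + (2 * |σ₂| + 1) * Real.log 2) hp hδ0 h₂ h₀ ?_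
  rintro a b ⟨hr, ⟨hl0, hl2⟩, h0a, h0b⟩
  have ht := norm_triangle a b
  refine ⟨hr.1, by linarith [norm_nonneg a.2], ?_⟩
  have hm := two_log_ang_add_min_le (a := a) (b := b) h₀ h₁ h₂ hr.2.2.2
  rw [lamMax, max_eq_left hl2, max_eq_right hl0] at hm
  have hn : |nu b - nu a| ≤ Real.log 2 :=
    abs_nu_sub_le (by norm_num) (by linarith) (by linarith)
  have hmin : nu a - Real.log 2 ≤ min (nu a) (nu b) := by
    rw [abs_le] at hn
    exact le_min (by linarith [Real.log_nonneg (x := 2) (by norm_num)]) (by linarith [hn.1])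
  have hn0 : nu (a + b) ≤ nu a := nu_mono h0a
  have h4 := mul_nonneg (sub_nonneg.2 hA.b2.le) (lam_nonneg s₂ b)
  have h5 := neg_mul_le_abs_mul (q := σ₂) hn
  have h6 := mul_nonneg (by linarith [hA.s12, hA.b0'] : 0 ≤ 1 + 2 * σ₁ + 2 * σ₂) (sub_nonneg.2 hn0)
  have := modulation_dichotomy (σ := σ₀ + σ₁ + σ₂) (β₀ := β₀) (β₁ := β₁) (p := p) (δ := δ)
    (n := nu (a + b)) (l := lam s₀ (a + b)) (l' := lam s₁ a)
    (t := 2 * Real.log (ang s₁ s₂ a b) - 2 * (σ₀ * nu (a + b) + σ₁ * nu a + σ₂ * nu b +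
      β₀ * lam s₀ (a + b) + β₁ * lam s₁ a + β₂ * lam s₂ b) -
      (Real.log 40 + (2 * |σ₂| + 1) * Real.log 2) + p * lam s₂ b)
    (nu_nonneg _) hl0 (by linarith [hA.b1]) (by linarith [hA.b0]) (lam_nonneg _ _)
    (hδ.le.trans (min_le_left _ _)) (hδ.le.trans ((min_le_right _ _).trans (min_le_left _ _)))
    (hδ.le.trans ((min_le_right _ _).trans (min_le_right _ _))) (by linarith)
  rcases this with h | h
  · exact Or.inl (ker_sq_le hr (by linarith))
  · exact Or.inr (ker_sq_le hr (by linarith))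

end Dom

/-- The first modulation dominates, and the first frequency is the lowest. -/
def LeftLow (s₀ s₁ s₂ : ℝ) (a b : Ph) : Prop :=
  Reg s₁ s₂ a b ∧ (lam s₀ (a + b) ≤ lam s₁ a ∧ lam s₂ b ≤ lam s₁ a) ∧
    ‖a.2‖ ≤ ‖b.2‖ ∧ ‖a.2‖ ≤ ‖a.2 + b.2‖

section

variable {σ₀ σ₁ σ₂ β₀ β₁ β₂ p s₀ s₁ s₂ : ℝ} {a b : Ph}

/-- The basic exponent bounds when the first frequency is the lowest. -/
lemma LeftLow.bounds (h₀ : s₀ = 1 ∨ s₀ = -1)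
    (h₁ : s₁ = 1 ∨ s₁ = -1) (h₂ : s₂ = 1 ∨ s₂ = -1) (h : LeftLow s₀ s₁ s₂ a b) :
    2 * Real.log (ang s₁ s₂ a b) ≤ Real.log 40 ∧
    2 * Real.log (ang s₁ s₂ a b) + nu a ≤ Real.log 40 + lam s₁ a ∧
    nu a ≤ nu (a + b) ∧
    -(σ₂ * nu b) ≤ -(σ₂ * nu (a + b)) + |σ₂| * Real.log 2 := by
  obtain ⟨hr, ⟨hl0, hl2⟩, hab, ha0⟩ := h
  have ht := norm_triangle a b
  have hm := two_log_ang_add_min_le (a := a) (b := b) h₀ h₁ h₂ hr.2.2.2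
  rw [lamMax, max_eq_left hl2, max_eq_right hl0, min_eq_left (nu_mono hab)] at hm
  have hn : |nu b - nu (a + b)| ≤ Real.log 2 :=
    abs_nu_sub_le (by norm_num) (by simp only [Prod.snd_add]; linarith)
      (by simp only [Prod.snd_add]; linarith)
  exact ⟨two_log_ang_le hr.2.2.2, hm, nu_mono ha0, neg_mul_le_abs_mul hn⟩

end

namespace Dom

variable {σ₀ σ₁ σ₂ β₀ β₁ β₂ p s₀ s₁ s₂ : ℝ}

/-- The lowest input frequency is below the square root of the output frequency. -/
lemma ker_left_very_low (hA : Adm σ₀ σ₁ σ₂ β₀ β₁ β₂ p) (h₀ : s₀ = 1 ∨ s₀ = -1)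
    (h₁ : s₁ = 1 ∨ s₁ = -1) (h₂ : s₂ = 1 ∨ s₂ = -1) :
    Dom (ker σ₀ σ₁ σ₂ β₀ β₁ β₂ s₀ s₁ s₂) fun a b => LeftLow s₀ s₁ s₂ a b ∧
      2 * nu a ≤ nu (a + b) + Real.log 16 := by
  have hp := hA.one_lt
  refine radial (p := p) (s := s₁) (s' := s₂) (α := 0)
    (γ := -(4 * (σ₀ + σ₂) + 2 * σ₁ + 2 * β₁ - p))
    (D := Real.log 40 + 2 * |σ₂| * Real.log 2 + 2 * (σ₀ + σ₂) * Real.log 16) hp h₂ le_rfl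
    (by linarith [hA.far1]) (fun h => absurd h.1 (by linarith [hA.far1])) ?_
  rintro a b ⟨h, hn⟩
  obtain ⟨b1, b2, b3, b4⟩ := h.bounds (σ₂ := σ₂) h₀ h₁ h₂
  obtain ⟨hr, -, -, ha0⟩ := h
  refine ⟨hr.2.2.1, by linarith [norm_nonneg a.2], ker_sq_le hr ?_⟩
  have g1 := mul_nonneg (sub_nonneg.2 hA.b1.le) (sub_nonneg.2 b2)
  have g2 := mul_nonneg (by linarith [hA.b1'] : 0 ≤ 1 - (2 * β₁ - p)) (sub_nonneg.2 b1)
  have g3 := mul_nonneg hA.s02 (sub_nonneg.2 hn)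
  have g4 := mul_nonneg (sub_nonneg.2 hA.b2.le) (lam_nonneg s₂ b)
  have g5 := mul_nonneg hA.b0 (lam_nonneg s₀ (a + b))
  linarith

/-- The output modulation is large compared to the first one. -/
lemma ker_left_out (hA : Adm σ₀ σ₁ σ₂ β₀ β₁ β₂ p) (h₀ : s₀ = 1 ∨ s₀ = -1)
    (h₁ : s₁ = 1 ∨ s₁ = -1) (h₂ : s₂ = 1 ∨ s₂ = -1) :
    Dom (ker σ₀ σ₁ σ₂ β₀ β₁ β₂ s₀ s₁ s₂) fun a b => LeftLow s₀ s₁ s₂ a b ∧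
      nu (a + b) + Real.log 16 < 2 * nu a ∧ nu a + lam s₁ a ≤ nu (a + b) + lam s₀ (a + b) := by
  have hp := hA.one_lt
  obtain ⟨γ, hγ⟩ : ∃ γ, γ = min (2 * β₀) (2 - 2 * β₁) := ⟨_, rfl⟩
  have hγ0 : 0 ≤ γ := by
    rw [hγ]; exact le_min (by linarith [hA.b0]) (by linarith [hA.b1'])
  have hγ1 : γ ≤ 2 * β₀ := hγ.le.trans (min_le_left _ _)
  have hγ2 : γ ≤ 2 - 2 * β₁ := hγ.le.trans (min_le_right _ _)
  have hγ3 : 2 + p < 2 * (σ₀ + σ₁ + σ₂) + γ + 2 * β₁ := by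
    rcases min_choice (2 * β₀) (2 - 2 * β₁) with h | h <;> rw [hγ, h] <;>
    linarith [hA.mod1, hA.sum_pos]
  obtain ⟨m, hm⟩ : ∃ m, m = min (2 * (σ₀ + σ₁ + σ₂) + γ + 2 * β₁ - p)
    (4 * (σ₀ + σ₂) + 2 * σ₁ + 2 * β₁ - p) := ⟨_, rfl⟩
  have hm0 : 2 < m := by
    rw [hm]; exact lt_min (by linarith) (by linarith [hA.far1])
  have hm1 := hm.le.trans (min_le_left _ _)
  have hm2 := hm.le.trans (min_le_right _ _)
  refine radial (p := p) (s := s₁) (s' := s₂) (α := 0) (γ := -m)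
    (D := Real.log 40 + 2 * |σ₂| * Real.log 2) hp h₂ le_rfl
    (by linarith) (fun h => absurd h.1 (by linarith)) ?_
  rintro a b ⟨h, hn, hmod⟩
  obtain ⟨b1, b2, b3, b4⟩ := h.bounds (σ₂ := σ₂) h₀ h₁ h₂
  obtain ⟨hr, -, -, ha0⟩ := h
  refine ⟨hr.2.2.1, by linarith [norm_nonneg a.2], ker_sq_le hr ?_⟩
  have g1 := mul_nonneg (by linarith [hA.b1] : 0 ≤ 2 * β₁ + γ - p) (sub_nonneg.2 b2)
  have g2 := mul_nonneg (by linarith : 0 ≤ 1 - (2 * β₁ + γ - p)) (sub_nonneg.2 b1)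
  have g3 := mul_nonneg hγ0 (sub_nonneg.2 hmod)
  have g4 := mul_nonneg (sub_nonneg.2 hA.b2.le) (lam_nonneg s₂ b)
  have g5 := mul_nonneg (sub_nonneg.2 hγ1) (lam_nonneg s₀ (a + b))
  have g6 := convex_bound (u := γ - 2 * (σ₀ + σ₂)) (v := -2 * σ₁ - 2 * γ - 2 * β₁ + p) (δ := m) b3
    (by linarith [Real.log_nonneg (x := 16) (by norm_num)]) (by linarith) (by linarith)
  linarith

/-- The first modulation is large, and the frequencies are quantitatively transversal. -/
lemma ker_left_slab (hA : Adm σ₀ σ₁ σ₂ β₀ β₁ β₂ p) (h₀ : s₀ = 1 ∨ s₀ = -1)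
    (h₁ : s₁ = 1 ∨ s₁ = -1) (h₂ : s₂ = 1 ∨ s₂ = -1) :
    Dom (ker σ₀ σ₁ σ₂ β₀ β₁ β₂ s₀ s₁ s₂) fun a b => LeftLow s₀ s₁ s₂ a b ∧
      (nu (a + b) + Real.log 16 < 2 * nu a ∧ nu (a + b) + lam s₀ (a + b) < nu a + lam s₁ a) ∧
      ‖a.2‖ * ‖b.2‖ * (jap ‖a.2‖ ^ 5)⁻¹ < par a.2 b.2 := by
  have hp := hA.one_lt
  obtain ⟨δ, hδ⟩ : ∃ δ, δ = min (2 * (σ₀ + σ₁ + σ₂) + 2 * β₀ + 2 * β₁ - 2 - p)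
    (min (2 * (σ₀ + σ₁ + σ₂) - 1) (4 * (σ₀ + σ₂) + 2 * σ₁ + 2 * β₁ - 3)) := ⟨_, rfl⟩
  have hδ0 : 0 < δ := by
    rw [hδ]
    exact lt_min (by linarith [hA.mod1]) (lt_min (by linarith [hA.sum_pos]) (by linarith [hA.far1]))
  have hδ1 := hδ.le.trans (min_le_left _ _)
  have hδ2 := hδ.le.trans ((min_le_right _ _).trans (min_le_left _ _))
  have hδ3 := hδ.le.trans ((min_le_right _ _).trans (min_le_right _ _))
  refine slab_left (p := p) (s₀ := s₀) (s := s₂) (ε := δ / 20) (ρ := δ / 4)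
    (D := (Real.log 40 + 2 * |σ₂| * Real.log 2) / 2) hp (by linarith) (by linarith) h₂ ?_
  rintro a b ⟨h, ⟨hn, hmod⟩, hpar⟩
  obtain ⟨b1, b2, b3, b4⟩ := h.bounds (σ₂ := σ₂) h₀ h₁ h₂
  obtain ⟨hr, -, -, ha0⟩ := h
  have n1 : 0 < ‖a.2‖ := norm_pos_iff.2 hr.1
  have n2 : 0 < ‖b.2‖ := norm_pos_iff.2 hr.2.1
  have hj : 0 < jap ‖a.2‖ ^ 5 := pow_pos (jap_pos _) 5
  have hpar0 : 0 < par a.2 b.2 := lt_trans (by positivity) hpar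
  have hn16 : Real.log 4 ≤ nu a := by
    have : Real.log 16 = 2 * Real.log 4 := by
      rw [show (16:ℝ) = 4 ^ 2 by norm_num, Real.log_pow]; norm_num
    linarith [nu_nonneg (a + b)]
  have h1 : 1 ≤ ‖a.2‖ := by
    have := (Real.log_le_log_iff (by norm_num) (jap_pos _)).1 hn16
    have h' := jap_le_one_add_abs ‖a.2‖
    rw [abs_norm] at h'
    linarith
  have hsn : -5 * nu a ≤ sn a b := by
    have : (jap ‖a.2‖ ^ 5)⁻¹ ≤ par a.2 b.2 / (‖a.2‖ * ‖b.2‖) := by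
      rw [le_div_iff₀ (mul_pos n1 n2)]; linarith
    have := Real.log_le_log (by positivity) this
    rw [Real.log_inv, Real.log_pow] at this
    rw [sn, nu]
    push_cast at this
    linarith
  refine ⟨⟨hr.2.2.1, h1, hpar0⟩, ker_sq_le hr ?_⟩
  have hb3 : nu (a + b) ≤ 2 * nu a := by linarith [Real.log_nonneg (x := 16) (by norm_num)]
  have g3 := mul_nonneg (by linarith [hA.b0'] : 0 ≤ p - 2 * β₀) (sub_nonneg.2 hmod.le)
  have g4 := mul_nonneg (sub_nonneg.2 hA.b2.le) (lam_nonneg s₂ b)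
  have g6 := mul_nonneg hδ0.le (by linarith : 0 ≤ 5 * nu a + sn a b)
  rcases le_total (2 * β₀ + 2 * β₁ - p) 1 with hc | hc
  · have g1 := mul_nonneg (by linarith [hA.b1, hA.b0] : 0 ≤ 2 * β₀ + 2 * β₁ - p) (sub_nonneg.2 b2)
    have g2 := mul_nonneg (sub_nonneg.2 hc) (sub_nonneg.2 b1)
    have g5 := convex_bound (u := 1 - 2 * (σ₀ + σ₂) - p + 2 * β₀)
      (v := 1 - 2 * σ₁ + 2 * p - 4 * β₀ - 2 * β₁) (δ := δ) b3 hb3 (by linarith) (by linarith)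
    linarith
  · have g2 := mul_nonneg (sub_nonneg.2 hc)
      (by linarith [lam_nonneg s₀ (a + b)] : 0 ≤ lam s₁ a - (nu (a + b) - nu a))
    have g5 := convex_bound (u := 2 - 2 * (σ₀ + σ₂) - 2 * β₁)
      (v := -1 - 2 * σ₁ + 2 * β₁) (δ := δ) b3 hb3 (by linarith) (by linarith)
    linarith

/-- The frequencies are almost parallel. -/
lemma ker_left_small_angle (hA : Adm σ₀ σ₁ σ₂ β₀ β₁ β₂ p) (h₀ : s₀ = 1 ∨ s₀ = -1)
    (h₁ : s₁ = 1 ∨ s₁ = -1) (h₂ : s₂ = 1 ∨ s₂ = -1) :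
    Dom (ker σ₀ σ₁ σ₂ β₀ β₁ β₂ s₀ s₁ s₂) fun a b => LeftLow s₀ s₁ s₂ a b ∧
      par a.2 b.2 ≤ ‖a.2‖ * ‖b.2‖ * (jap ‖a.2‖ ^ 5)⁻¹ := by
  have hp := hA.one_lt
  refine small_angle (p := p) (s := s₂) (D := Real.log 40 + 2 * |σ₂| * Real.log 2) hp ?_
  rintro a b ⟨h, hpar⟩
  obtain ⟨b1, b2, b3, b4⟩ := h.bounds (σ₂ := σ₂) h₀ h₁ h₂
  obtain ⟨hr, -, -, ha0⟩ := h
  have ht := norm_triangle a b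
  refine ⟨⟨hr.2.2.1, by linarith, hpar⟩, ker_sq_le hr ?_⟩
  have g1 := mul_nonneg (by linarith [hA.b1] : 0 ≤ β₁) (lam_nonneg s₁ a)
  have g2 := mul_nonneg (by linarith [hA.sum_pos] : 0 ≤ σ₀ + σ₁ + σ₂) (nu_nonneg a)
  have g3 := mul_nonneg hA.s02 (sub_nonneg.2 b3)
  have g4 := mul_nonneg (sub_nonneg.2 hA.b2.le) (lam_nonneg s₂ b)
  have g5 := mul_nonneg hA.b0 (lam_nonneg s₀ (a + b))
  linarith

/-- The first modulation dominates. -/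
lemma ker_left (hA : Adm σ₀ σ₁ σ₂ β₀ β₁ β₂ p) (h₀ : s₀ = 1 ∨ s₀ = -1)
    (h₁ : s₁ = 1 ∨ s₁ = -1) (h₂ : s₂ = 1 ∨ s₂ = -1) :
    Dom (ker σ₀ σ₁ σ₂ β₀ β₁ β₂ s₀ s₁ s₂) fun a b => Reg s₁ s₂ a b ∧
      lam s₀ (a + b) ≤ lam s₁ a ∧ lam s₂ b ≤ lam s₁ a := by
  have hlow : Dom (ker σ₀ σ₁ σ₂ β₀ β₁ β₂ s₀ s₁ s₂) (LeftLow s₀ s₁ s₂) := by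
    refine ((((ker_left_very_low hA h₀ h₁ h₂).union (ker_left_out hA h₀ h₁ h₂)).union
      (ker_left_slab hA h₀ h₁ h₂)).union (ker_left_small_angle hA h₀ h₁ h₂)).mono
      fun a b h => ⟨?_, le_rfl⟩
    rcases le_or_gt (2 * nu a) (nu (a + b) + Real.log 16) with h1 | h1
    · exact Or.inl (Or.inl (Or.inl ⟨h, h1⟩))
    rcases le_or_gt (nu a + lam s₁ a) (nu (a + b) + lam s₀ (a + b)) with h2 | h2
    · exact Or.inl (Or.inl (Or.inr ⟨h, h1, h2⟩))
    rcases le_or_gt (par a.2 b.2) (‖a.2‖ * ‖b.2‖ * (jap ‖a.2‖ ^ 5)⁻¹) with h3 | h3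
    · exact Or.inr ⟨h, h3⟩
    · exact Or.inl (Or.inr ⟨h, ⟨h1, h2⟩, h3⟩)
  refine (((ker_left_low_right hA h₀ h₁ h₂).union (ker_left_low_sum hA h₀ h₁ h₂)).union hlow).mono
    fun a b h => ⟨?_, le_rfl⟩
  rcases le_total ‖a.2‖ ‖b.2‖ with h1 | h1
  · rcases le_total ‖a.2‖ ‖a.2 + b.2‖ with h2 | h2
    · exact Or.inr ⟨h.1, h.2, h1, h2⟩
    · exact Or.inl (Or.inr ⟨h.1, h.2, h2, h2.trans h1⟩)
  · rcases le_total ‖b.2‖ ‖a.2 + b.2‖ with h2 | h2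
    · exact Or.inl (Or.inl ⟨h.1, h.2, h1, h2⟩)
    · exact Or.inl (Or.inr ⟨h.1, h.2, h2.trans h1, h2⟩)

/-- The kernel of the null form is bounded. -/
theorem ker_bounded (hA : Adm σ₀ σ₁ σ₂ β₀ β₁ β₂ p) (h₀ : s₀ = 1 ∨ s₀ = -1)
    (h₁ : s₁ = 1 ∨ s₁ = -1) (h₂ : s₂ = 1 ∨ s₂ = -1) :
    Dom (ker σ₀ σ₁ σ₂ β₀ β₁ β₂ s₀ s₁ s₂) fun _ _ => True := by
  refine of_reg ?_
  have hsw : Dom (ker σ₀ σ₁ σ₂ β₀ β₁ β₂ s₀ s₁ s₂) fun a b => Reg s₁ s₂ a b ∧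
      lam s₀ (a + b) ≤ lam s₂ b ∧ lam s₁ a ≤ lam s₂ b := by
    refine swap ((ker_left hA.swap h₀ h₂ h₁).mono fun a b h => ?_)
    rw [ker_swap]
    rw [add_comm b a] at h
    exact ⟨⟨h.1.swap, h.2⟩, le_rfl⟩
  refine (((ker_out hA h₀ h₁ h₂).union (ker_left hA h₀ h₁ h₂)).union hsw).mono
    fun a b h => ⟨?_, le_rfl⟩
  rcases le_total (lam s₀ (a + b)) (lam s₁ a) with h1 | h1
  · rcases le_total (lam s₁ a) (lam s₂ b) with h2 | h2
    · exact Or.inr ⟨h, h1.trans h2, h2⟩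
    · exact Or.inl (Or.inr ⟨h, h1, h2⟩)
  · rcases le_total (lam s₀ (a + b)) (lam s₂ b) with h2 | h2
    · exact Or.inr ⟨h, h2, h1.trans h2⟩
    · exact Or.inl (Or.inl ⟨h, h1, h2⟩)

end Dom

/-- The hypotheses of the null form estimate provide admissible exponents. -/
lemma exists_adm {σ₀ σ₁ σ₂ β₀ β₁ β₂ : ℝ} (h1 : 0 ≤ β₀) (h2 : β₀ < 1/2)
    (h3 : 1/2 < β₁) (h4 : β₁ < 1) (h5 : 1/2 < β₂) (h6 : β₂ < 1)
    (h8 : σ₀ + σ₁ + σ₂ > 3/2 - (σ₀ + β₁ + σ₂))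
    (h9 : σ₀ + σ₁ + σ₂ > 3/2 - (σ₀ + σ₁ + β₂))
    (h10 : σ₀ + σ₁ + σ₂ + β₀ ≥ 1)
    (h11 : min (σ₀ + σ₁) (min (σ₀ + σ₂) (β₀ + σ₁ + σ₂)) ≥ 0)
    (h12 : ¬(σ₀ + σ₁ + σ₂ + β₀ = 1 ∧ min (σ₀ + σ₁) (min (σ₀ + σ₂) (β₀ + σ₁ + σ₂)) = 0)) :
    ∃ p, Adm σ₀ σ₁ σ₂ β₀ β₁ β₂ p := by
  have hs := le_min_iff.1 h11
  have hs' := le_min_iff.1 hs.2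
  obtain ⟨p, hp1, hp2⟩ : ∃ p, 1 < p ∧ p < min (min (2 * β₁) (2 * β₂))
      (min (2 * (σ₀ + σ₁ + σ₂)) (min (min (2 * (σ₀ + σ₁ + σ₂) + 2 * β₀ + 2 * β₁ - 2)
        (2 * (σ₀ + σ₁ + σ₂) + 2 * β₀ + 2 * β₂ - 2)) (min (4 * (σ₀ + σ₂) + 2 * σ₁ + 2 * β₁ - 2)
        (4 * (σ₀ + σ₁) + 2 * σ₂ + 2 * β₂ - 2)))) := by
    refine exists_between ?_
    simp only [lt_min_iff]
    refine ⟨⟨?_, ?_⟩, ?_, ⟨?_, ?_⟩, ?_, ?_⟩ <;> linarith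
  simp only [lt_min_iff] at hp2
  obtain ⟨⟨p1, p2⟩, p3, ⟨p4, p5⟩, p6, p7⟩ := hp2
  refine ⟨p, ⟨hp1, h1, by linarith, p1, h4, p2, h6, p3, by linarith, by linarith, by linarith,
    by linarith, h10, hs.1, hs'.1, hs'.2, fun h => h12 ⟨h.1, ?_⟩, fun h => h12 ⟨h.1, ?_⟩,
    fun h => h12 ⟨h.1, ?_⟩⟩⟩
  · exact le_antisymm (h.2 ▸ min_le_left _ _) h11
  · exact le_antisymm (h.2 ▸ (min_le_right _ _).trans (min_le_left _ _)) h11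
  · exact le_antisymm (h.2 ▸ (min_le_right _ _).trans (min_le_right _ _)) h11

/-! ## Transfer to Schwartz functions -/

/-- The weighted kernel of the null form, relative to the full light cone in the output. -/
def waveKer (σ₀ σ₁ σ₂ β₀ β₁ β₂ s₁ s₂ : ℝ) (a b : Ph) : ℝ :=
  ang s₁ s₂ a b * Real.exp (-(σ₀ * nu (a + b) + σ₁ * nu a + σ₂ * nu b +
    β₀ * Real.log (jap (|(a + b).1| - ‖(a + b).2‖)) + β₁ * lam s₁ a + β₂ * lam s₂ b))

lemma lam_one_of_nonneg {a : Ph} (h : 0 ≤ a.1) : lam 1 a = Real.log (jap (|a.1| - ‖a.2‖)) := by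
  rw [lam, abs_of_nonneg h, ← jap_neg]
  congr 2
  ring

lemma lam_neg_one_of_nonpos {a : Ph} (h : a.1 ≤ 0) :
    lam (-1) a = Real.log (jap (|a.1| - ‖a.2‖)) := by
  rw [lam, abs_of_nonpos h]
  congr 2
  ring

theorem Dom.waveKer_bounded {σ₀ σ₁ σ₂ β₀ β₁ β₂ p s₁ s₂ : ℝ} (hA : Adm σ₀ σ₁ σ₂ β₀ β₁ β₂ p)
    (h₁ : s₁ = 1 ∨ s₁ = -1) (h₂ : s₂ = 1 ∨ s₂ = -1) :
    Dom (waveKer σ₀ σ₁ σ₂ β₀ β₁ β₂ s₁ s₂) fun _ _ => True := by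
  have hp : Dom (waveKer σ₀ σ₁ σ₂ β₀ β₁ β₂ s₁ s₂) fun a b => 0 ≤ (a + b).1 :=
    (Dom.ker_bounded hA (Or.inl rfl) h₁ h₂).mono fun a b h => ⟨trivial, by
      rw [waveKer, ker, lam_one_of_nonneg h]⟩
  have hn : Dom (waveKer σ₀ σ₁ σ₂ β₀ β₁ β₂ s₁ s₂) fun a b => (a + b).1 ≤ 0 :=
    (Dom.ker_bounded hA (Or.inr rfl) h₁ h₂).mono fun a b h => ⟨trivial, by
      rw [waveKer, ker, lam_neg_one_of_nonpos h]⟩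
  exact (hp.union hn).mono fun a b _ => ⟨le_total _ _, le_rfl⟩

/-- The form `triForm` as a duality pairing. -/
lemma triForm_eq_lintegral_mul {M : Ph → Ph → ℝ≥0∞} {f₀ f₁ f₂ : Ph → ℝ≥0∞}
    (hM : Measurable (Function.uncurry M)) (h₀ : Measurable f₀) (h₁ : Measurable f₁)
    (h₂ : Measurable f₂) :
    triForm M f₀ f₁ f₂ = ∫⁻ x, f₀ x * ∫⁻ a, M a (x - a) * (f₁ a * f₂ (x - a)) := by
  rw [triForm_eq_sum hM h₀ h₁ h₂]
  refine lintegral_congr fun x => ?_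
  have hm : Measurable fun a => M a (x - a) * (f₁ a * f₂ (x - a)) :=
    (hM.comp (measurable_id.prodMk (measurable_const.sub measurable_id))).mul
      (h₁.mul (h₂.comp (measurable_const.sub measurable_id)))
  rw [← lintegral_const_mul _ hm]
  refine lintegral_congr fun a => ?_
  ring

/-- Duality in `L²`. -/
lemma sqInt_le_of_pairing {h : Ph → ℝ≥0∞} (hh : Measurable h) {A : ℝ≥0∞}
    (H : ∀ f, Measurable f → (∫⁻ x, f x * h x) ^ 2 ≤ A * sqInt f) : sqInt h ≤ A := by
  let g : ℕ → Ph → ℝ≥0∞ := fun n => (spanningSets volume n).indicator fun x => min (h x) n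
  have hg : ∀ n, Measurable (g n) := fun n =>
    (hh.min measurable_const).indicator (measurableSet_spanningSets _ n)
  have hgh : ∀ n x, g n x ≤ h x := fun n x =>
    (Set.indicator_le_self _ _ x).trans (min_le_left _ _)
  have hmono : Monotone g := fun m n hmn x => by
    refine (Set.indicator_le_indicator_of_subset (monotone_spanningSets _ hmn)
      (fun _ => zero_le) x).trans (Set.indicator_le_indicator ?_)
    exact min_le_min_left _ (by exact_mod_cast hmn)
  have hfin : ∀ n, sqInt (g n) < ⊤ := fun n => by
    calc sqInt (g n) ≤ ∫⁻ x, (spanningSets volume n).indicator (fun _ => (n : ℝ≥0∞) ^ 2) x := by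
          refine lintegral_mono fun x => ?_
          by_cases hx : x ∈ spanningSets volume n
          · simp only [g, Set.indicator_of_mem hx]
            exact pow_le_pow_left' (min_le_right _ _) 2
          · simp [g, Set.indicator_of_notMem hx]
      _ < ⊤ := by
          rw [lintegral_indicator_const (measurableSet_spanningSets _ n)]
          exact ENNReal.mul_lt_top (by simp) (measure_spanningSets_lt_top _ n)
  have hA : ∀ n, sqInt (g n) ≤ A := fun n => by
    have h1 : sqInt (g n) ≤ ∫⁻ x, g n x * h x := lintegral_mono fun x => by
      rw [sq]
      exact mul_le_mul_right (hgh n x) _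
    have h2 := (pow_le_pow_left' h1 2).trans (H _ (hg n))
    rcases eq_or_ne (sqInt (g n)) 0 with h0 | h0
    · rw [h0]; exact zero_le
    · rw [sq] at h2
      exact (ENNReal.mul_le_mul_iff_left h0 (hfin n).ne).1 h2
  have hsup : ∀ x, ⨆ n, g n x ^ 2 = h x ^ 2 := fun x => by
    refine le_antisymm (iSup_le fun n => pow_le_pow_left' (hgh n x) 2) ?_
    obtain ⟨N, hN⟩ : ∃ N, x ∈ spanningSets volume N := by
      have : x ∈ ⋃ i, spanningSets (volume : Measure Ph) i := by
        rw [iUnion_spanningSets]; trivial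
      exact Set.mem_iUnion.1 this
    have hmem : ∀ n, N ≤ n → g n x = min (h x) n := fun n hn =>
      Set.indicator_of_mem (monotone_spanningSets _ hn hN) _
    have hlim : Filter.Tendsto (fun n : ℕ => g n x ^ 2) Filter.atTop (nhds (h x ^ 2)) := by
      refine ENNReal.Tendsto.pow ?_
      have : Filter.Tendsto (fun n : ℕ => min (h x) (n : ℝ≥0∞)) Filter.atTop
          (nhds (min (h x) ⊤)) := tendsto_const_nhds.min ENNReal.tendsto_nat_nhds_top
      rw [min_eq_left le_top] at this
      refine this.congr' ?_
      filter_upwards [Filter.eventually_ge_atTop N] with n hn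
      exact (hmem n hn).symm
    exact le_of_tendsto' hlim fun n => le_iSup (fun n => g n x ^ 2) n
  rw [sqInt, ← lintegral_congr hsup, lintegral_iSup (fun n => (hg n).pow_const 2)
    fun m n hmn x => pow_le_pow_left' (hmono hmn x) 2]
  exact iSup_le hA

lemma TriBdd.sqInt_le {M : Ph → Ph → ℝ≥0∞} {C : ℝ≥0∞} (hC : TriBdd M C)
    (hM : Measurable (Function.uncurry M)) {f₁ f₂ : Ph → ℝ≥0∞} (h₁ : Measurable f₁)
    (h₂ : Measurable f₂) :
    sqInt (fun x => ∫⁻ a, M a (x - a) * (f₁ a * f₂ (x - a))) ≤ C * (sqInt f₁ * sqInt f₂) := by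
  have hm : Measurable fun z : Ph × Ph => M z.2 (z.1 - z.2) * (f₁ z.2 * f₂ (z.1 - z.2)) :=
    (hM.comp (measurable_snd.prodMk (measurable_fst.sub measurable_snd))).mul
      ((h₁.comp measurable_snd).mul (h₂.comp (measurable_fst.sub measurable_snd)))
  refine sqInt_le_of_pairing hm.lintegral_prod_right' fun f hf => ?_
  rw [← triForm_eq_lintegral_mul hM hf h₁ h₂]
  refine (hC f f₁ f₂ hf h₁ h₂).trans_eq ?_
  ring

/-- A space-time frequency as a pair `(τ, ξ)`. -/
def toPh (ζ : SpaceTime) : Ph := (ζ 0, spt ζ)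

lemma toPh_add (ζ η : SpaceTime) : toPh (ζ + η) = toPh ζ + toPh η := rfl

lemma toPh_sub (ζ η : SpaceTime) : toPh (ζ - η) = toPh ζ - toPh η := rfl

lemma stpt_toPh (ζ : SpaceTime) : stpt (toPh ζ).1 (toPh ζ).2 = ζ := by
  ext μ
  refine Fin.cases ?_ (fun i => ?_) μ <;> rfl

lemma measurePreserving_toPh : MeasurePreserving toPh := by
  have h1 := PiLp.volume_preserving_ofLp (Fin 4)
  have h2 := volume_preserving_piFinSuccAbove (fun _ : Fin 4 => ℝ) 0
  have h3 := (MeasurePreserving.id (volume : Measure ℝ)).prod (PiLp.volume_preserving_toLp (Fin 3))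
  exact h3.comp (h2.comp h1)

lemma measurable_stpt : Measurable fun a : Ph => stpt a.1 a.2 := by
  refine (WithLp.measurable_toLp 2 (Fin 4 → ℝ)).comp (measurable_pi_lambda _ fun μ => ?_)
  refine Fin.cases ?_ (fun i => ?_) μ
  · exact measurable_fst
  · exact (measurable_pi_apply i).comp ((WithLp.measurable_ofLp 2 (Fin 3 → ℝ)).comp measurable_snd)

lemma continuous_spt : Continuous spt := by
  unfold spt
  refine (PiLp.continuous_toLp 2 _).comp (continuous_pi fun i => ?_)
  fun_prop

lemma norm_spt_le (ζ : SpaceTime) : ‖spt ζ‖ ≤ ‖ζ‖ := by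
  rw [EuclideanSpace.norm_eq, EuclideanSpace.norm_eq]
  refine Real.sqrt_le_sqrt ?_
  rw [Fin.sum_univ_succ (n := 3)]
  exact le_add_of_nonneg_left (by positivity)

lemma lintegral_comp_toPh {f : Ph → ℝ≥0∞} (hf : Measurable f) :
    ∫⁻ ζ, f (toPh ζ) = ∫⁻ a, f a := measurePreserving_toPh.lintegral_comp hf

/-- Bilinear estimates on space-time from trilinear forms on `ℝ × ℝ³`. -/
lemma TriBdd.lintegral_sq_le {M : Ph → Ph → ℝ≥0∞} {C : ℝ≥0∞} (hC : TriBdd M C)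
    (hM : Measurable (Function.uncurry M)) {f₁ f₂ : SpaceTime → ℝ≥0∞} (h₁ : Measurable f₁)
    (h₂ : Measurable f₂) :
    ∫⁻ ζ, (∫⁻ η, M (toPh η) (toPh (ζ - η)) * (f₁ η * f₂ (ζ - η))) ^ 2 ≤
      C * ((∫⁻ ζ, f₁ ζ ^ 2) * ∫⁻ ζ, f₂ ζ ^ 2) := by
  let g₁ : Ph → ℝ≥0∞ := fun a => f₁ (stpt a.1 a.2)
  let g₂ : Ph → ℝ≥0∞ := fun a => f₂ (stpt a.1 a.2)
  have hg₁ : Measurable g₁ := h₁.comp measurable_stpt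
  have hg₂ : Measurable g₂ := h₂.comp measurable_stpt
  have e₁ : ∀ ζ, f₁ ζ = g₁ (toPh ζ) := fun ζ => congrArg f₁ (stpt_toPh ζ).symm
  have e₂ : ∀ ζ, f₂ ζ = g₂ (toPh ζ) := fun ζ => congrArg f₂ (stpt_toPh ζ).symm
  have hm : Measurable fun z : Ph × Ph => M z.2 (z.1 - z.2) * (g₁ z.2 * g₂ (z.1 - z.2)) :=
    (hM.comp (measurable_snd.prodMk (measurable_fst.sub measurable_snd))).mul
      ((hg₁.comp measurable_snd).mul (hg₂.comp (measurable_fst.sub measurable_snd)))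
  simp only [e₁, e₂, toPh_sub]
  rw [lintegral_comp_toPh (hg₁.pow_const 2), lintegral_comp_toPh (hg₂.pow_const 2)]
  refine le_trans (le_of_eq ?_) (hC.sqInt_le hM hg₁ hg₂)
  refine Eq.trans (lintegral_congr fun ζ => ?_)
    (lintegral_comp_toPh ((hm.lintegral_prod_right').pow_const 2))
  congr 1
  exact lintegral_comp_toPh (f := fun a => M a (toPh ζ - a) * (g₁ a * g₂ (toPh ζ - a)))
    (hm.comp (measurable_const.prodMk measurable_id))

/-- The bilinear Fourier symbol integral of `B`. -/
def nullConv (sg₁ sg₂ : Bool) (f g : SpaceTime → ℂ) (ζ : SpaceTime) : ℂ :=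
  ∫ η, (angleWt sg₁ sg₂ η (ζ - η) : ℂ) * f η * g (ζ - η)

lemma sgnv_eq (sg : Bool) : sgnv sg = 1 ∨ sgnv sg = -1 := by cases sg <;> simp [sgnv]

lemma angleWt_eq (sg₁ sg₂ : Bool) (η θ : SpaceTime) :
    angleWt sg₁ sg₂ η θ = ang (sgnv sg₁) (sgnv sg₂) (toPh η) (toPh θ) :=
  abs_of_nonneg (InnerProductGeometry.angle_nonneg _ _)

lemma hWt_pos (s b : ℝ) (ζ : SpaceTime) : 0 < hWt s b ζ :=
  mul_pos (Real.rpow_pos_of_pos (jap_pos _) _) (Real.rpow_pos_of_pos (jap_pos _) _)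

lemma xWt_pos (sg : Bool) (s b : ℝ) (ζ : SpaceTime) : 0 < xWt sg s b ζ :=
  mul_pos (Real.rpow_pos_of_pos (jap_pos _) _) (Real.rpow_pos_of_pos (jap_pos _) _)

lemma hWt_mul_angleWt (σ₀ σ₁ σ₂ β₀ β₁ β₂ : ℝ) (sg₁ sg₂ : Bool) (η θ : SpaceTime) :
    hWt (-σ₀) (-β₀) (η + θ) * angleWt sg₁ sg₂ η θ =
      waveKer σ₀ σ₁ σ₂ β₀ β₁ β₂ (sgnv sg₁) (sgnv sg₂) (toPh η) (toPh θ) *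
        (xWt sg₁ σ₁ β₁ η * xWt sg₂ σ₂ β₂ θ) := by
  have e0 : hWt (-σ₀) (-β₀) (η + θ) = Real.exp (-(σ₀ * nu (toPh η + toPh θ) +
      β₀ * Real.log (jap (|(toPh η + toPh θ).1| - ‖(toPh η + toPh θ).2‖)))) := by
    rw [hWt, jap_rpow_eq_exp, jap_rpow_eq_exp, ← Real.exp_add]
    congr 1
    simp only [nu, ← toPh_add]
    simp only [toPh]
    ring
  have e1 : ∀ sg s b ζ, xWt sg s b ζ =
      Real.exp (s * nu (toPh ζ) + b * lam (sgnv sg) (toPh ζ)) := fun sg s b ζ => by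
    rw [xWt, jap_rpow_eq_exp, jap_rpow_eq_exp, ← Real.exp_add]
    rfl
  rw [e0, e1, e1, angleWt_eq, waveKer, mul_assoc, ← Real.exp_add, ← Real.exp_add, mul_comm]
  congr 2
  ring

/-- The null form estimate on the Fourier side. -/
lemma TriBdd.lintegral_nullConv_le {σ₀ σ₁ σ₂ β₀ β₁ β₂ : ℝ} {sg₁ sg₂ : Bool}
    {M : Ph → Ph → ℝ≥0∞} {C : ℝ≥0∞} (hC : TriBdd M C)
    (hM : Measurable (Function.uncurry M))
    (hK : ∀ a b, ENNReal.ofReal (waveKer σ₀ σ₁ σ₂ β₀ β₁ β₂ (sgnv sg₁) (sgnv sg₂) a b) ≤ M a b)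
    {f g : SpaceTime → ℂ} (hf : Continuous f) (hg : Continuous g) :
    ∫⁻ ζ, ENNReal.ofReal ((hWt (-σ₀) (-β₀) ζ * ‖nullConv sg₁ sg₂ f g ζ‖) ^ 2) ≤
      C * ((∫⁻ ζ, ENNReal.ofReal ((xWt sg₁ σ₁ β₁ ζ * ‖f ζ‖) ^ 2)) *
        ∫⁻ ζ, ENNReal.ofReal ((xWt sg₂ σ₂ β₂ ζ * ‖g ζ‖) ^ 2)) := by
  have hx : ∀ sg s b, Measurable (xWt sg s b) := fun sg s b => by
    refine ((measurable_jap.comp continuous_spt.norm.measurable).pow_const s).mul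
      ((measurable_jap.comp (Continuous.measurable ?_)).pow_const b)
    have := continuous_spt
    fun_prop
  have hpow : ∀ w r : ℝ, 0 ≤ w → 0 ≤ r →
      ENNReal.ofReal ((w * r) ^ 2) = ENNReal.ofReal (w * r) ^ 2 := fun w r hw hr =>
    ENNReal.ofReal_pow (mul_nonneg hw hr) 2
  simp only [hpow _ _ (hWt_pos _ _ _).le (norm_nonneg _),
    hpow _ _ (xWt_pos _ _ _ _).le (norm_nonneg _)]
  refine le_trans (lintegral_mono fun ζ => pow_le_pow_left' ?_ 2) (hC.lintegral_sq_le hM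
    ((hx _ _ _).mul hf.norm.measurable).ennreal_ofReal
    ((hx _ _ _).mul hg.norm.measurable).ennreal_ofReal)
  rw [ENNReal.ofReal_mul (hWt_pos _ _ _).le, ofReal_norm]
  refine (mul_le_mul_right (enorm_integral_le_lintegral_enorm _) _).trans ?_
  rw [← lintegral_const_mul' _ _ ENNReal.ofReal_ne_top]
  refine lintegral_mono fun η => ?_
  have hk := hWt_mul_angleWt σ₀ σ₁ σ₂ β₀ β₁ β₂ sg₁ sg₂ η (ζ - η)
  rw [add_sub_cancel] at hk
  have hang : 0 ≤ angleWt sg₁ sg₂ η (ζ - η) := abs_nonneg _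
  have hker : 0 ≤ waveKer σ₀ σ₁ σ₂ β₀ β₁ β₂ (sgnv sg₁) (sgnv sg₂) (toPh η) (toPh (ζ - η)) :=
    mul_nonneg (InnerProductGeometry.angle_nonneg _ _) (Real.exp_pos _).le
  have hx1 := (xWt_pos sg₁ σ₁ β₁ η).le
  have hx2 := (xWt_pos sg₂ σ₂ β₂ (ζ - η)).le
  calc ENNReal.ofReal (hWt (-σ₀) (-β₀) ζ) *
        ‖(angleWt sg₁ sg₂ η (ζ - η) : ℂ) * f η * g (ζ - η)‖ₑ
      = ENNReal.ofReal (waveKer σ₀ σ₁ σ₂ β₀ β₁ β₂ (sgnv sg₁) (sgnv sg₂) (toPh η) (toPh (ζ - η)))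
        * (ENNReal.ofReal (xWt sg₁ σ₁ β₁ η * ‖f η‖) *
          ENNReal.ofReal (xWt sg₂ σ₂ β₂ (ζ - η) * ‖g (ζ - η)‖)) := by
        rw [← ofReal_norm, ← ENNReal.ofReal_mul (hWt_pos _ _ _).le,
          ← ENNReal.ofReal_mul (mul_nonneg hx1 (norm_nonneg _)), ← ENNReal.ofReal_mul hker,
          norm_mul, norm_mul, Complex.norm_real, Real.norm_of_nonneg hang]
        congr 1
        calc _ = (hWt (-σ₀) (-β₀) ζ * angleWt sg₁ sg₂ η (ζ - η)) * (‖f η‖ * ‖g (ζ - η)‖) := by ring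
          _ = _ := by rw [hk]; ring
    _ ≤ _ := mul_le_mul_left (hK _ _) _

lemma fourier_eq_zero_of_not_integrable {F : SpaceTime → ℂ} (h : ¬ Integrable F) : 𝓕 F = 0 := by
  ext w
  rw [Real.fourier_eq]
  exact integral_undef fun h' => h ((Real.fourierIntegral_convergent_iff w).1 h')

lemma norm_FT_FTinv_le {F : SpaceTime → ℂ} (hF : Continuous F) (ζ : SpaceTime) :
    ‖FT (FTinv F) ζ‖ ≤ ‖F ζ‖ := by
  have e : FTinv F = fun x => 𝓕 F (-x) := funext fun x => Real.fourierInv_eq_fourier_neg F x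
  by_cases h1 : Integrable F
  · by_cases h2 : Integrable (FTinv F)
    · have h3 : Integrable (𝓕 F) := by
        rw [e] at h2
        simpa using h2.comp_neg
      exact (congrArg norm (congrFun (hF.fourier_fourierInv_eq h1 h3) ζ)).le
    · have : FT (FTinv F) ζ = 0 := congrFun (fourier_eq_zero_of_not_integrable h2) ζ
      rw [this, norm_zero]
      exact norm_nonneg _
  · have h2 : FTinv F = 0 := by
      rw [e, fourier_eq_zero_of_not_integrable h1]
      rfl
    have : FT (FTinv F) ζ = 0 := by
      rw [h2, FT, Real.fourier_eq]
      simp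
    rw [this, norm_zero]
    exact norm_nonneg _

lemma ae_spt_ne_zero : ∀ᵐ η : SpaceTime, spt η ≠ 0 := by
  have h : ∀ᵐ a : Ph, a.2 ≠ 0 :=
    (Measure.quasiMeasurePreserving_snd (μ := (volume : Measure ℝ))
      (ν := (volume : Measure Space))).ae (Measure.ae_ne volume 0)
  exact measurePreserving_toPh.quasiMeasurePreserving.ae h

lemma ae_spt_sub_ne_zero (ζ : SpaceTime) : ∀ᵐ η : SpaceTime, spt (ζ - η) ≠ 0 :=
  (Measure.measurePreserving_sub_left volume ζ).quasiMeasurePreserving.ae ae_spt_ne_zero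

lemma measurable_angle {α : Type*} [MeasurableSpace α] {f g : α → Space} (hf : Measurable f)
    (hg : Measurable g) : Measurable fun x => InnerProductGeometry.angle (f x) (g x) :=
  Real.measurable_arccos.comp ((hf.inner hg).div (hf.norm.mul hg.norm))

lemma measurable_angleWt (sg₁ sg₂ : Bool) (ζ : SpaceTime) :
    Measurable fun η => angleWt sg₁ sg₂ η (ζ - η) := by
  have hs := continuous_spt
  have h1 : Continuous fun η : SpaceTime => sgnv sg₁ • spt η := by fun_prop
  have h2 : Continuous fun η : SpaceTime => sgnv sg₂ • spt (ζ - η) := by fun_prop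
  simp only [angleWt_eq]
  exact measurable_angle h1.measurable h2.measurable

lemma continuous_nullConv (sg₁ sg₂ : Bool) (f g : SchwartzMap SpaceTime ℂ) :
    Continuous (nullConv sg₁ sg₂ f g) := by
  refine continuous_iff_continuousAt.2 fun ζ => ?_
  refine continuousAt_of_dominated
    (bound := fun η => Real.pi * ‖f η‖ * SchwartzMap.seminorm ℝ 0 0 g) ?_ ?_ ?_ ?_
  · refine Filter.Eventually.of_forall fun ζ' => ?_
    have hg : Continuous fun η => g (ζ' - η) := g.continuous.comp (by fun_prop)
    exact (((Complex.measurable_ofReal.comp (measurable_angleWt sg₁ sg₂ ζ')).mul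
      f.continuous.measurable).mul hg.measurable).aestronglyMeasurable
  · refine Filter.Eventually.of_forall fun ζ' => Filter.Eventually.of_forall fun η => ?_
    rw [norm_mul, norm_mul, Complex.norm_real]
    gcongr
    · rw [Real.norm_eq_abs, angleWt, abs_abs, abs_of_nonneg (InnerProductGeometry.angle_nonneg _ _)]
      exact InnerProductGeometry.angle_le_pi _ _
    · exact SchwartzMap.norm_le_seminorm ℝ g _
  · exact (f.integrable.norm.const_mul _).mul_const _
  · filter_upwards [ae_spt_ne_zero, ae_spt_sub_ne_zero ζ] with η h1 h2
    have hs : ∀ sg, sgnv sg ≠ 0 := fun sg => by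
      rcases sgnv_eq sg with h | h <;> rw [h] <;> norm_num
    have hang : ContinuousAt (fun ζ' => angleWt sg₁ sg₂ η (ζ' - η)) ζ := by
      have h3 : ContinuousAt (fun ζ' : SpaceTime => (sgnv sg₁ • spt η, sgnv sg₂ • spt (ζ' - η))) ζ := by
        have := continuous_spt
        exact Continuous.continuousAt (by fun_prop)
      exact ((InnerProductGeometry.continuousAt_angle
        (x := (sgnv sg₁ • spt η, sgnv sg₂ • spt (ζ - η))) (smul_ne_zero (hs _) h1)
        (smul_ne_zero (hs _) h2)).comp_of_eq h3 rfl).abs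
    have hg : Continuous fun ζ' => g (ζ' - η) := g.continuous.comp (by fun_prop)
    exact ((Complex.continuous_ofReal.continuousAt.comp hang).mul continuousAt_const).mul
      hg.continuousAt

lemma jap_rpow_le_pow {x y : ℝ} (q : ℝ) (h : jap x ≤ y) : jap x ^ q ≤ y ^ ⌈|q|⌉₊ := by
  calc jap x ^ q ≤ jap x ^ (⌈|q|⌉₊ : ℝ) :=
        Real.rpow_le_rpow_of_exponent_le (one_le_jap x) ((le_abs_self q).trans (Nat.le_ceil _))
    _ = jap x ^ ⌈|q|⌉₊ := Real.rpow_natCast _ _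
    _ ≤ _ := pow_le_pow_left₀ (jap_pos x).le h _

lemma xWt_le (sg : Bool) (s b : ℝ) : ∃ N : ℕ, ∀ ζ, xWt sg s b ζ ≤ (1 + ‖ζ‖) ^ N := by
  refine ⟨⌈|s|⌉₊ + 2 * ⌈|b|⌉₊, fun ζ => ?_⟩
  rw [pow_add, pow_mul]
  have hn := norm_spt_le ζ
  have hz : |ζ 0| ≤ ‖ζ‖ := PiLp.norm_apply_le ζ 0
  have h1 : jap ‖spt ζ‖ ≤ 1 + ‖ζ‖ := (jap_le_one_add_abs _).trans (by rw [abs_norm]; linarith)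
  have h2 : jap (-(ζ 0) + sgnv sg * ‖spt ζ‖) ≤ (1 + ‖ζ‖) ^ 2 := by
    refine (jap_le_one_add_abs _).trans ?_
    have h3 : |-(ζ 0) + sgnv sg * ‖spt ζ‖| ≤ |ζ 0| + ‖spt ζ‖ := by
      refine (abs_add_le _ _).trans_eq ?_
      rw [abs_neg, abs_mul, abs_norm]
      rcases sgnv_eq sg with h | h <;> simp [h]
    nlinarith [sq_nonneg ‖ζ‖]
  exact mul_le_mul (jap_rpow_le_pow s h1) (jap_rpow_le_pow b h2)
    (Real.rpow_nonneg (jap_pos _).le _) (by positivity)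

lemma integrable_xWt_sq (sg : Bool) (s b : ℝ) (f : SchwartzMap SpaceTime ℂ) :
    Integrable fun ζ => (xWt sg s b ζ * ‖f ζ‖) ^ 2 := by
  obtain ⟨N, hN⟩ := xWt_le sg s b
  obtain ⟨D, hD⟩ : ∃ D, ∀ ζ, (1 + ‖ζ‖) ^ (N + 5) * ‖f ζ‖ ≤ D :=
    ⟨_, fun ζ => by
      simpa only [norm_iteratedFDeriv_zero] using SchwartzMap.one_add_le_sup_seminorm_apply (𝕜 := ℝ)
        (m := (N + 5, 0)) (k := N + 5) (n := 0) le_rfl le_rfl f ζ⟩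
  have hc : Continuous fun ζ => (xWt sg s b ζ * ‖f ζ‖) ^ 2 := by
    have h1 := continuous_spt
    have h2 : Continuous (xWt sg s b) := by
      refine Continuous.mul ?_ ?_
      · exact (continuous_jap.comp h1.norm).rpow_const fun _ => Or.inl (jap_pos _).ne'
      · exact (continuous_jap.comp (by fun_prop)).rpow_const fun _ => Or.inl (jap_pos _).ne'
    exact (h2.mul f.continuous.norm).pow 2
  refine ((integrable_one_add_norm (E := SpaceTime) (μ := volume) (r := 10)
    (by simp; norm_num)).const_mul (D ^ 2)).mono' hc.aestronglyMeasurable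
    (Filter.Eventually.of_forall fun ζ => ?_)
  have hp : 0 < 1 + ‖ζ‖ := by positivity
  have e : (1 + ‖ζ‖) ^ (-10 : ℝ) = ((1 + ‖ζ‖) ^ 10)⁻¹ := by
    rw [Real.rpow_neg hp.le]
    norm_cast
  rw [Real.norm_of_nonneg (by positivity), e, ← div_eq_mul_inv, le_div_iff₀ (by positivity)]
  have h0 := (xWt_pos sg s b ζ).le
  calc (xWt sg s b ζ * ‖f ζ‖) ^ 2 * (1 + ‖ζ‖) ^ 10
      = (xWt sg s b ζ * ‖f ζ‖ * (1 + ‖ζ‖) ^ 5) ^ 2 := by ring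
    _ ≤ ((1 + ‖ζ‖) ^ (N + 5) * ‖f ζ‖) ^ 2 := by
      refine pow_le_pow_left₀ (by positivity) ?_ 2
      calc _ ≤ (1 + ‖ζ‖) ^ N * ‖f ζ‖ * (1 + ‖ζ‖) ^ 5 := by gcongr; exact hN ζ
        _ = _ := by ring
    _ ≤ D ^ 2 := pow_le_pow_left₀ (by positivity) (hD ζ) 2

/-- the null form estimate
`‖B_{±₁,±₂}(u,v)‖_{H^{-σ₀,-β₀}} ≲ ‖u‖_{X^{σ₁,β₁}_{±₁}} ‖v‖_{X^{σ₂,β₂}_{±₂}}`. -/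
theorem null_form_estimate
    (σ₀ σ₁ σ₂ β₀ β₁ β₂ : ℝ)
    (h1 : 0 ≤ β₀) (h2 : β₀ < 1/2)
    (h3 : 1/2 < β₁) (h4 : β₁ < 1) (h5 : 1/2 < β₂) (h6 : β₂ < 1)
    (h7 : σ₀ + σ₁ + σ₂ + β₀ > 3/2 - (β₀ + σ₁ + σ₂))
    (h8 : σ₀ + σ₁ + σ₂ > 3/2 - (σ₀ + β₁ + σ₂))
    (h9 : σ₀ + σ₁ + σ₂ > 3/2 - (σ₀ + σ₁ + β₂))
    (h10 : σ₀ + σ₁ + σ₂ + β₀ ≥ 1)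
    (h11 : min (σ₀ + σ₁) (min (σ₀ + σ₂) (β₀ + σ₁ + σ₂)) ≥ 0)
    (h12 : ¬(σ₀ + σ₁ + σ₂ + β₀ = 1 ∧ min (σ₀ + σ₁) (min (σ₀ + σ₂) (β₀ + σ₁ + σ₂)) = 0)) :
    ∀ sg₁ sg₂ : Bool, ∃ C > 0, ∀ u v : SchwartzMap SpaceTime ℂ,
      HsbNorm (-σ₀) (-β₀) (Bop sg₁ sg₂ ⇑u ⇑v)
        ≤ C * XsbNorm sg₁ σ₁ β₁ ⇑u * XsbNorm sg₂ σ₂ β₂ ⇑v := by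
  intro sg₁ sg₂
  obtain ⟨p, hA⟩ := exists_adm h1 h2 h3 h4 h5 h6 h8 h9 h10 h11 h12
  obtain ⟨C, hC, M, hM, hT, hK⟩ := Dom.waveKer_bounded hA (sgnv_eq sg₁) (sgnv_eq sg₂)
  refine ⟨(C.toReal + 1) ^ ((1:ℝ)/2), by positivity, fun u v => ?_⟩
  obtain ⟨U, hu⟩ : ∃ U : SchwartzMap SpaceTime ℂ, FT ⇑u = ⇑U := ⟨𝓕 u, (SchwartzMap.fourier_coe u).symm⟩
  obtain ⟨V, hv⟩ : ∃ V : SchwartzMap SpaceTime ℂ, FT ⇑v = ⇑V := ⟨𝓕 v, (SchwartzMap.fourier_coe v).symm⟩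
  have hB : Bop sg₁ sg₂ ⇑u ⇑v = FTinv (nullConv sg₁ sg₂ ⇑U ⇑V) := by
    rw [Bop, hu, hv]; rfl
  have hmain := hT.lintegral_nullConv_le (sg₁ := sg₁) (sg₂ := sg₂) hM (fun a b => hK a b trivial)
    U.continuous V.continuous
  have hi := integrable_xWt_sq sg₁ σ₁ β₁ U
  have hi' := integrable_xWt_sq sg₂ σ₂ β₂ V
  rw [← ofReal_integral_eq_lintegral_ofReal hi
      (Filter.Eventually.of_forall fun ζ => sq_nonneg (xWt sg₁ σ₁ β₁ ζ * ‖U ζ‖)),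
    ← ofReal_integral_eq_lintegral_ofReal hi'
      (Filter.Eventually.of_forall fun ζ => sq_nonneg (xWt sg₂ σ₂ β₂ ζ * ‖V ζ‖))] at hmain
  rw [HsbNorm, XsbNorm, XsbNorm, wnorm, wnorm, wnorm, hu, hv, hB]
  have hI : 0 ≤ ∫ ζ, (xWt sg₁ σ₁ β₁ ζ * ‖U ζ‖) ^ 2 := integral_nonneg fun _ => sq_nonneg _
  have hI' : 0 ≤ ∫ ζ, (xWt sg₂ σ₂ β₂ ζ * ‖V ζ‖) ^ 2 := integral_nonneg fun _ => sq_nonneg _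
  rw [← Real.mul_rpow (by positivity) hI, ← Real.mul_rpow (by positivity) hI']
  refine Real.rpow_le_rpow (integral_nonneg fun _ => sq_nonneg _) ?_ (by norm_num)
  calc ∫ ζ, (hWt (-σ₀) (-β₀) ζ * ‖FT (FTinv (nullConv sg₁ sg₂ ⇑U ⇑V)) ζ‖) ^ 2
      ≤ (∫⁻ ζ, ENNReal.ofReal
          ‖(hWt (-σ₀) (-β₀) ζ * ‖FT (FTinv (nullConv sg₁ sg₂ ⇑U ⇑V)) ζ‖) ^ 2‖).toReal :=
        (Real.le_norm_self _).trans (norm_integral_le_lintegral_norm _)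
    _ ≤ (C * (ENNReal.ofReal (∫ ζ, (xWt sg₁ σ₁ β₁ ζ * ‖U ζ‖) ^ 2) *
          ENNReal.ofReal (∫ ζ, (xWt sg₂ σ₂ β₂ ζ * ‖V ζ‖) ^ 2))).toReal := by
        refine ENNReal.toReal_mono (ENNReal.mul_ne_top hC.ne (by finiteness)) ?_
        refine (lintegral_mono fun ζ => ENNReal.ofReal_le_ofReal ?_).trans hmain
        rw [Real.norm_of_nonneg (sq_nonneg _)]
        have hw := (hWt_pos (-σ₀) (-β₀) ζ).le
        have hle := norm_FT_FTinv_le (continuous_nullConv sg₁ sg₂ U V) ζ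
        gcongr
    _ ≤ _ := by
        rw [ENNReal.toReal_mul, ENNReal.toReal_mul, ENNReal.toReal_ofReal hI,
          ENNReal.toReal_ofReal hI', mul_assoc]
        gcongr
        linarith
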